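/- arXiv:2004.05650 — 2 statements merged into one kernel-verified Lean document; each statement's English description precedes it below -/
import Mathlib

section
/- Let m>1, 0<p<1 with m+p>2, and let σ>2(1−p)/(m−1). Then there exists at least one good profile with an interface of Type I, i.e. a solution f of the profile ODE satisfying (P1) or (P2) at ξ=0, positive on (0,ξ₀), having an interface of Type I at some ξ₀∈(0,∞). -/
open Real Filter Set Topology

/-- The function `f^m` (real power). -/
noncomputable def Fm (m : ℝ) (f : ℝ → ℝ) : ℝ → ℝ := fun ξ => f ξ ^ m

/-- `f` solves the self-similar profile ODE
`(f^m)'' - α f + β ξ f' + ξ^σ f^p = 0` on the set `S`. -/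
noncomputable def SolvesODE (m p σ α β : ℝ) (f : ℝ → ℝ) (S : Set ℝ) : Prop :=
  ∀ ξ ∈ S,
    deriv (deriv (Fm m f)) ξ - α * f ξ + β * ξ * deriv f ξ + ξ ^ σ * f ξ ^ p = 0

/-- A profile: continuous and nonnegative on `[0,∞)`, with `f^m` of class `C²`
on the (positive-space) positivity set, solving the profile ODE there. -/
noncomputable def IsProfile (m p σ α β : ℝ) (f : ℝ → ℝ) : Prop :=
  ContinuousOn f (Set.Ici 0) ∧ (∀ ξ ∈ Set.Ici (0 : ℝ), 0 ≤ f ξ) ∧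
    ContDiffOn ℝ 2 (Fm m f) {ξ : ℝ | 0 < ξ ∧ 0 < f ξ} ∧
    SolvesODE m p σ α β f {ξ : ℝ | 0 < ξ ∧ 0 < f ξ}

/-- Behavior (P1) at the origin: `f(0) = a > 0`, `f'(0) = 0`. -/
noncomputable def GoodP1 (f : ℝ → ℝ) : Prop :=
  0 < f 0 ∧ HasDerivWithinAt f 0 (Set.Ici 0) 0

/-- Behavior (P2) at the origin: `f(0) = 0`, `(f^m)'(0) = 0`. -/
noncomputable def GoodP2 (m : ℝ) (f : ℝ → ℝ) : Prop :=
  f 0 = 0 ∧ HasDerivWithinAt (Fm m f) 0 (Set.Ici 0) 0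

/-- `f` has an interface at `ξ₀ ∈ (0,∞)`: `f(ξ₀) = 0`, `(f^m)'(ξ₀) = 0`, and
`f > 0` on a left-neighborhood of `ξ₀`. -/
noncomputable def HasInterface (m : ℝ) (f : ℝ → ℝ) (ξ₀ : ℝ) : Prop :=
  0 < ξ₀ ∧ f ξ₀ = 0 ∧ HasDerivAt (Fm m f) 0 ξ₀ ∧
    ∃ δ > 0, ∀ ξ ∈ Set.Ioo (ξ₀ - δ) ξ₀, 0 < f ξ

/-- Type I interface behavior at `ξ₀`: `f(ξ)(ξ₀-ξ)^{-1/(m-1)}` has a finite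
positive limit as `ξ → ξ₀⁻`. -/
noncomputable def TypeI (m : ℝ) (f : ℝ → ℝ) (ξ₀ : ℝ) : Prop :=
  ∃ L > 0, Filter.Tendsto (fun ξ => f ξ * (ξ₀ - ξ) ^ (-(1 / (m - 1))))
    (nhdsWithin ξ₀ (Set.Iio ξ₀)) (nhds L)

/-- Type II interface behavior at `ξ₀`: `f(ξ)(ξ₀-ξ)^{-1/(1-p)}` has a finite
positive limit as `ξ → ξ₀⁻`. -/
noncomputable def TypeII (p : ℝ) (f : ℝ → ℝ) (ξ₀ : ℝ) : Prop :=
  ∃ L > 0, Filter.Tendsto (fun ξ => f ξ * (ξ₀ - ξ) ^ (-(1 / (1 - p))))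
    (nhdsWithin ξ₀ (Set.Iio ξ₀)) (nhds L)

/-- A backward first-exit principle: a continuous function that is negative at the right endpoint
and whose derivative is positive at every first zero met from the right stays negative. -/
lemma neg_of_backward_first_exit {D : ℝ → ℝ} {a b : ℝ} (hc : ContinuousOn D (Icc a b))
    (hb : D b < 0)
    (h : ∀ t ∈ Ico a b, D t = 0 → (∀ s ∈ Ioc t b, D s < 0) → ∃ d > 0, HasDerivAt D d t) :
    ∀ t ∈ Icc a b, D t < 0 := by
  by_contra hcon
  push Not at hcon
  obtain ⟨t₀, ht₀, hDt₀⟩ := hcon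
  set S := Icc a b ∩ D ⁻¹' Ici 0 with hS
  have hcl : IsClosed S := hc.preimage_isClosed_of_isClosed isClosed_Icc isClosed_Ici
  have hne : S.Nonempty := ⟨t₀, ht₀, hDt₀⟩
  have hbd : BddAbove S := ⟨b, fun x hx => hx.1.2⟩
  have htS : sSup S ∈ S := hcl.csSup_mem hne hbd
  set t := sSup S with ht
  have htb : t < b := by
    rcases lt_or_eq_of_le htS.1.2 with h1 | h1
    · exact h1
    · have := htS.2; rw [h1] at this; exact absurd hb (not_lt.2 this)
  have hneg : ∀ s ∈ Ioc t b, D s < 0 := by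
    intro s hs
    by_contra hcon
    have : s ∈ S := ⟨⟨htS.1.1.trans hs.1.le, hs.2⟩, not_lt.1 hcon⟩
    exact absurd (le_csSup hbd this) (not_le.2 hs.1)
  have hD0 : D t = 0 := by
    refine le_antisymm ?_ htS.2
    have h1 : ContinuousWithinAt D (Ioc t b) t :=
      (hc t htS.1).mono (Ioc_subset_Icc_self.trans (Icc_subset_Icc_left htS.1.1))
    have h2 : (𝓝[Ioc t b] t).NeBot := by
      rw [nhdsWithin_Ioc_eq_nhdsGT htb]; infer_instance
    exact le_of_tendsto h1 (eventually_nhdsWithin_of_forall fun s hs => (hneg s hs).le)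
  obtain ⟨d, hd, hder⟩ := h t ⟨htS.1.1, htb⟩ hD0 hneg
  have h3 : ∀ᶠ s in 𝓝[>] t, 0 < slope D t s :=
    (hasDerivAt_iff_tendsto_slope.1 hder |>.mono_left
      (nhdsWithin_mono t fun x hx => ne_of_gt hx)).eventually (lt_mem_nhds hd)
  obtain ⟨s, hs1, hs2⟩ := (h3.and (Ioc_mem_nhdsGT htb)).exists
  have h4 := hneg s hs2
  rw [slope_def_field, hD0, sub_zero] at hs1
  have : D s / (s - t) < 0 := div_neg_of_neg_of_pos h4 (sub_pos.2 hs2.1)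
  linarith

lemma image_sub_le_of_hasDerivAt_le {f f' : ℝ → ℝ} {a b C : ℝ} (hab : a ≤ b)
    (hc : ContinuousOn f (Icc a b)) (hf : ∀ x ∈ Ioo a b, HasDerivAt f (f' x) x)
    (hC : ∀ x ∈ Ioo a b, f' x ≤ C) : f b - f a ≤ C * (b - a) := by
  refine (convex_Icc a b).image_sub_le_mul_sub_of_deriv_le hc ?_ ?_ a (left_mem_Icc.2 hab) b
    (right_mem_Icc.2 hab) hab
  · rw [interior_Icc]
    exact fun x hx => (hf x hx).differentiableAt.differentiableWithinAt
  · rw [interior_Icc]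
    exact fun x hx => by rw [(hf x hx).deriv]; exact hC x hx

lemma le_image_sub_of_le_hasDerivAt {f f' : ℝ → ℝ} {a b C : ℝ} (hab : a ≤ b)
    (hc : ContinuousOn f (Icc a b)) (hf : ∀ x ∈ Ioo a b, HasDerivAt f (f' x) x)
    (hC : ∀ x ∈ Ioo a b, C ≤ f' x) : C * (b - a) ≤ f b - f a := by
  have := image_sub_le_of_hasDerivAt_le (f := fun x => -f x) (f' := fun x => -f' x) (C := -C) hab
    hc.neg (fun x hx => (hf x hx).neg) (fun x hx => neg_le_neg (hC x hx))
  linarith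

open scoped NNReal in
/-- Picard–Lindelöf for a bounded, globally Lipschitz planar system depending on a parameter,
solved backwards from time `1`, with joint continuity in the parameter and time. -/
lemma exists_continuous_flow {P Q b A : ℝ → ℝ} {KP KQ : ℝ≥0} (hP : LipschitzWith KP P)
    (hQ : LipschitzWith KQ Q) {B : ℝ} (hPB : ∀ x, |P x| ≤ B) (hQB : ∀ x, |Q x| ≤ B)
    (hb : Continuous b) (hA : Continuous A) (γ u₀ : ℝ) {R N : ℝ} (hR : 0 ≤ R) (hN : 0 ≤ N) :
    ∃ U Z : ℝ → ℝ → ℝ,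
      (∀ Λ ∈ Icc 0 N, U Λ 1 = u₀ ∧ Z Λ 1 = 0 ∧ ∀ t ∈ Icc (0 : ℝ) 1,
        HasDerivAt (U Λ) (max (-R) (min (Z Λ t) R) - b t * P (U Λ t)) t ∧
        HasDerivAt (Z Λ) (γ * P (U Λ t) - Λ * A t * Q (U Λ t)) t) ∧
      ContinuousOn (fun x : ℝ × ℝ => U x.1 x.2) (Icc 0 N ×ˢ Icc 0 1) ∧
      ContinuousOn (fun x : ℝ × ℝ => Z x.1 x.2) (Icc 0 N ×ˢ Icc 0 1) := by
  have hB : 0 ≤ B := (abs_nonneg _).trans (hPB 0)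
  obtain ⟨b₁, hb₁⟩ := isCompact_Icc.exists_bound_of_continuousOn (s := Icc (-1 : ℝ) 2) hb.continuousOn
  obtain ⟨A₁, hA₁⟩ := isCompact_Icc.exists_bound_of_continuousOn (s := Icc (-1 : ℝ) 2) hA.continuousOn
  have hb₁0 : 0 ≤ b₁ := (norm_nonneg _).trans (hb₁ 0 (by norm_num))
  have hA₁0 : 0 ≤ A₁ := (norm_nonneg _).trans (hA₁ 0 (by norm_num))
  have clip1 : ∀ {M : ℝ}, ∀ x y : ℝ, |max (-M) (min x M) - max (-M) (min y M)| ≤ |x - y| := by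
    intro M x y
    refine (abs_max_sub_max_le_max (-M) (min x M) (-M) (min y M)).trans ?_
    simpa using abs_min_sub_min_le_max x M y M
  have clip2 : ∀ {M : ℝ}, 0 ≤ M → ∀ x : ℝ, |max (-M) (min x M)| ≤ M := by
    intro M hM x
    rw [abs_le]
    exact ⟨le_max_left _ _, max_le (by linarith) (min_le_right _ _)⟩
  let v : ℝ → ℝ × ℝ × ℝ → ℝ × ℝ × ℝ := fun t x =>
    (max (-R) (min x.2.1 R) - b t * P x.1,
      γ * P x.1 - max (-N) (min x.2.2 N) * A t * Q x.1, 0)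
  let K : ℝ≥0 := Real.toNNReal (1 + b₁ * KP + (|γ| * KP + A₁ * (N * KQ + B)))
  let L : ℝ≥0 := Real.toNNReal (R + b₁ * B + (|γ| * B + N * A₁ * B))
  let N' : ℝ≥0 := Real.toNNReal N
  have hK : (K : ℝ) = 1 + b₁ * KP + (|γ| * KP + A₁ * (N * KQ + B)) :=
    Real.coe_toNNReal _ (by positivity)
  have hL : (L : ℝ) = R + b₁ * B + (|γ| * B + N * A₁ * B) := Real.coe_toNNReal _ (by positivity)
  have hN' : (N' : ℝ) = N := Real.coe_toNNReal _ hN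
  have hPL : IsPicardLindelof v (tmin := -1) (tmax := 2) ⟨1, by norm_num⟩ (u₀, 0, 0)
      (2 * L + N') N' L K := by
    refine ⟨fun t ht => ?_, fun x hx => ?_, fun t ht x hx => ?_, ?_⟩
    · refine LipschitzOnWith.of_dist_le_mul fun x _ y _ => ?_
      have h1 : |x.1 - y.1| ≤ dist x y := by
        rw [← Real.dist_eq]; exact le_max_left _ _
      have h2 : |x.2.1 - y.2.1| ≤ dist x y := by
        rw [← Real.dist_eq]; exact (le_max_left _ _).trans (le_max_right _ _)
      have h3 : |x.2.2 - y.2.2| ≤ dist x y := by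
        rw [← Real.dist_eq]; exact (le_max_right _ _).trans (le_max_right _ _)
      set d := dist x y
      have hd : 0 ≤ d := dist_nonneg
      have hPd : |P x.1 - P y.1| ≤ KP * d := by
        rw [← Real.dist_eq]
        exact (hP.dist_le_mul _ _).trans (by rw [Real.dist_eq]; gcongr)
      have hQd : |Q x.1 - Q y.1| ≤ KQ * d := by
        rw [← Real.dist_eq]
        exact (hQ.dist_le_mul _ _).trans (by rw [Real.dist_eq]; gcongr)
      have hbt : |b t| ≤ b₁ := hb₁ t ht
      have hAt : |A t| ≤ A₁ := hA₁ t ht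
      rw [hK]
      have e1 : |(max (-R) (min x.2.1 R) - b t * P x.1) - (max (-R) (min y.2.1 R) - b t * P y.1)|
          ≤ d + b₁ * (KP * d) := by
        calc _ = |(max (-R) (min x.2.1 R) - max (-R) (min y.2.1 R)) - b t * (P x.1 - P y.1)| := by
              ring_nf
          _ ≤ |max (-R) (min x.2.1 R) - max (-R) (min y.2.1 R)| + |b t| * |P x.1 - P y.1| := by
              rw [← abs_mul]; exact abs_sub _ _
          _ ≤ _ := by gcongr; exact (clip1 _ _).trans h2
      set l := max (-N) (min x.2.2 N) with hl
      set l' := max (-N) (min y.2.2 N) with hl'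
      have hll : |l - l'| ≤ d := (clip1 _ _).trans h3
      have hlN : |l| ≤ N := clip2 hN _
      have e2 : |(γ * P x.1 - l * A t * Q x.1) - (γ * P y.1 - l' * A t * Q y.1)|
          ≤ |γ| * (KP * d) + A₁ * (N * (KQ * d) + d * B) := by
        calc _ = |γ * (P x.1 - P y.1) - A t * (l * (Q x.1 - Q y.1) + (l - l') * Q y.1)| := by
              ring_nf
          _ ≤ |γ| * |P x.1 - P y.1| + |A t| * (|l| * |Q x.1 - Q y.1| + |l - l'| * |Q y.1|) := by
              refine (abs_sub _ _).trans ?_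
              rw [abs_mul, abs_mul]
              gcongr
              refine (abs_add_le _ _).trans ?_
              rw [abs_mul, abs_mul]
          _ ≤ _ := by gcongr; exact hQB _
      have p1 : 0 ≤ b₁ * (KP * d) := by positivity
      have p2 : 0 ≤ |γ| * (KP * d) + A₁ * (N * (KQ * d) + d * B) := by positivity
      rw [Prod.dist_eq, Prod.dist_eq]
      refine max_le ?_ (max_le ?_ ?_)
      · rw [Real.dist_eq]; refine e1.trans ?_; nlinarith
      · rw [Real.dist_eq]; refine e2.trans ?_; nlinarith
      · simp only [v, dist_self]; positivity
    · fun_prop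
    · have hbt : |b t| ≤ b₁ := hb₁ t ht
      have hAt : |A t| ≤ A₁ := hA₁ t ht
      rw [hL, Prod.norm_def, Prod.norm_def]
      refine max_le ?_ (max_le ?_ ?_)
      · rw [Real.norm_eq_abs]
        refine (abs_sub _ _).trans ?_
        rw [abs_mul]
        have : |b t| * |P x.1| ≤ b₁ * B := by gcongr; exact hPB _
        have := clip2 hR x.2.1
        have : 0 ≤ |γ| * B + N * A₁ * B := by positivity
        linarith
      · rw [Real.norm_eq_abs]
        refine (abs_sub _ _).trans ?_
        rw [abs_mul, abs_mul, abs_mul]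
        have h1 : |γ| * |P x.1| ≤ |γ| * B := by gcongr; exact hPB _
        have h2 : |max (-N) (min x.2.2 N)| * |A t| * |Q x.1| ≤ N * A₁ * B := by
          gcongr
          · exact clip2 hN _
          · exact hQB _
        have : 0 ≤ R + b₁ * B := by positivity
        linarith
      · simp only [v, norm_zero]; positivity
    · push_cast
      norm_num
      linarith
  obtain ⟨F, hF, hFc⟩ := hPL.exists_forall_mem_closedBall_eq_hasDerivWithinAt_continuousOn
  have hmem : ∀ Λ ∈ Icc 0 N, (u₀, (0 : ℝ), Λ) ∈ Metric.closedBall (u₀, (0 : ℝ), (0 : ℝ)) N' := by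
    intro Λ hΛ
    simp [Prod.dist_eq, hN', abs_of_nonneg hΛ.1, hΛ.2, hN]
  have hmaps : MapsTo (fun x : ℝ × ℝ => ((u₀, (0 : ℝ), x.1), x.2)) (Icc 0 N ×ˢ Icc 0 1)
      (Metric.closedBall (u₀, (0 : ℝ), (0 : ℝ)) N' ×ˢ Icc (-1) 2) := fun x hx =>
    ⟨hmem _ hx.1, by linarith [hx.2.1], by linarith [hx.2.2]⟩
  have hcomp : ContinuousOn (fun x : ℝ × ℝ => F ((u₀, 0, x.1), x.2)) (Icc 0 N ×ˢ Icc 0 1) :=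
    hFc.comp (by fun_prop) hmaps
  refine ⟨fun Λ t => (F ((u₀, 0, Λ), t)).1, fun Λ t => (F ((u₀, 0, Λ), t)).2.1,
    fun Λ hΛ => ?_, hcomp.fst, hcomp.snd.fst⟩
  obtain ⟨h0, h1⟩ := hF _ (hmem Λ hΛ)
  have hd : ∀ t ∈ Ioo (-1 : ℝ) 2, HasDerivAt (fun t => F ((u₀, 0, Λ), t))
      (v t (F ((u₀, 0, Λ), t))) t := fun t ht =>
    (h1 t (Ioo_subset_Icc_self ht)).hasDerivAt (Icc_mem_nhds ht.1 ht.2)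
  have hconst : ∀ t ∈ Icc (-1 : ℝ) 2, (F ((u₀, 0, Λ), t)).2.2 = Λ := by
    intro t ht
    have hc : ∀ t ∈ Icc (-1 : ℝ) 2,
        HasDerivWithinAt (fun t => (F ((u₀, 0, Λ), t)).2.2) 0 (Icc (-1 : ℝ) 2) t := fun t ht =>
      ((ContinuousLinearMap.snd ℝ ℝ ℝ).comp
        (ContinuousLinearMap.snd ℝ ℝ (ℝ × ℝ))).hasFDerivAt.comp_hasDerivWithinAt t (h1 t ht)
    have := (convex_Icc (-1 : ℝ) 2).is_const_of_fderivWithin_eq_zero (𝕜 := ℝ)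
      (f := fun t => (F ((u₀, 0, Λ), t)).2.2) (x := t) (y := 1)
      (fun s hs => (hc s hs).differentiableWithinAt)
      (fun s hs => by
        have := (hc s hs).hasFDerivWithinAt.fderivWithin
          (uniqueDiffOn_Icc (by norm_num) s hs)
        rw [this]; ext; simp) ht (by norm_num)
    rw [this, h0]
  refine ⟨by simp only [h0], by simp only [h0], fun t ht => ?_⟩
  have ht' : t ∈ Ioo (-1 : ℝ) 2 := ⟨by linarith [ht.1], by linarith [ht.2]⟩
  have := hd t ht'
  refine ⟨(ContinuousLinearMap.fst ℝ ℝ (ℝ × ℝ)).hasFDerivAt.comp_hasDerivAt t this, ?_⟩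
  have h2 : HasDerivAt (fun t => (F ((u₀, 0, Λ), t)).2.1) (v t (F ((u₀, 0, Λ), t))).2.1 t :=
    ((ContinuousLinearMap.fst ℝ ℝ ℝ).comp
      (ContinuousLinearMap.snd ℝ ℝ (ℝ × ℝ))).hasFDerivAt.comp_hasDerivAt t this
  have h3 : max (-N) (min Λ N) = Λ := by
    rw [min_eq_left hΛ.2, max_eq_right (by linarith [hΛ.1])]
  simpa only [v, hconst t (Ioo_subset_Icc_self ht'), h3] using h2

/-- The profile `u ^ (1 / m)`, with `u` truncated from below at `ε`. -/
noncomputable def cutProfile (m ε u : ℝ) : ℝ := max u ε ^ (1 / m)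

/-- A solution on `[0, 1]` of the system satisfied by `u = f ^ m` and the flux
`z = (f ^ m)' + β t f`, with the nonlinearities truncated at `u = ε`, reaction coefficient `Λ` and
data `u = 2 ε`, `z = 0` at the right endpoint. -/
structure IsCutSolution (m p σ α β ε Λ : ℝ) (u z : ℝ → ℝ) : Prop where
  hasDerivAt_u : ∀ t ∈ Icc (0 : ℝ) 1, HasDerivAt u (z t - β * t * cutProfile m ε (u t)) t
  hasDerivAt_z : ∀ t ∈ Icc (0 : ℝ) 1, HasDerivAt z
    ((α + β) * cutProfile m ε (u t) - Λ * t ^ σ * cutProfile m ε (u t) ^ p) t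
  u_one : u 1 = 2 * ε
  z_one : z 1 = 0

lemma rpow_le_one_add {x r : ℝ} (hx : 0 ≤ x) (hr0 : 0 ≤ r) (hr1 : r ≤ 1) : x ^ r ≤ 1 + x := by
  rcases le_total x 1 with h | h
  · linarith [Real.rpow_le_one hx h hr0]
  · have := Real.rpow_le_rpow_of_exponent_le h hr1
    rw [Real.rpow_one] at this
    linarith

lemma cutProfile_pos {m ε u : ℝ} (hε : 0 < ε) : 0 < cutProfile m ε u :=
  Real.rpow_pos_of_pos (lt_max_of_lt_right hε) _

lemma cutProfile_of_le {m ε u : ℝ} (h : ε ≤ u) : cutProfile m ε u = u ^ (1 / m) := by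
  rw [cutProfile, max_eq_left h]

lemma cutProfile_le {m ε u : ℝ} (hm : 1 < m) (hε : 0 < ε) (hε1 : ε ≤ 1) :
    cutProfile m ε u ≤ 2 + |u| := by
  have h0 : 0 ≤ max u ε := hε.le.trans (le_max_right _ _)
  have h1 : max u ε ≤ 1 + |u| :=
    max_le (by linarith [le_abs_self u]) (by linarith [abs_nonneg u])
  have := rpow_le_one_add h0 (r := 1 / m) (by positivity)
    (by rw [div_le_one (by linarith)]; exact hm.le)
  unfold cutProfile
  linarith

lemma cutProfile_rpow_le {m p ε u : ℝ} (hm : 1 < m) (hp0 : 0 < p) (hp1 : p < 1) (hε : 0 < ε)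
    (hε1 : ε ≤ 1) : cutProfile m ε u ^ p ≤ 3 + |u| := by
  have := rpow_le_one_add (cutProfile_pos (m := m) (u := u) hε).le hp0.le hp1.le
  linarith [cutProfile_le (u := u) hm hε hε1]

lemma exists_bound_of_linear_growth {C : ℝ} (hC : 0 < C) :
    ∃ R : ℝ, 2 ≤ R ∧ ∀ u z u' z' : ℝ → ℝ,
      (∀ t ∈ Icc (0 : ℝ) 1, HasDerivAt u (u' t) t) → (∀ t ∈ Icc (0 : ℝ) 1, HasDerivAt z (z' t) t) →
      (∀ t ∈ Icc (0 : ℝ) 1, |u' t| ≤ C * (1 + max |u t| |z t|)) →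
      (∀ t ∈ Icc (0 : ℝ) 1, |z' t| ≤ C * (1 + max |u t| |z t|)) → |u 1| ≤ 2 → z 1 = 0 →
      ∀ t ∈ Icc (0 : ℝ) 1, |u t| ≤ R ∧ |z t| ≤ R := by
  refine ⟨max 2 (gronwallBound 2 C C 1), le_max_left _ _, ?_⟩
  intro u z u' z' hu hz hu' hz' h1 h2 t ht
  have hmem : ∀ s ∈ Icc (0 : ℝ) 1, 1 - s ∈ Icc (0 : ℝ) 1 := fun s hs =>
    ⟨by linarith [hs.2], by linarith [hs.1]⟩
  have hd : ∀ s ∈ Icc (0 : ℝ) 1, HasDerivAt (fun s => ((u (1 - s), z (1 - s)) : ℝ × ℝ))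
      (-u' (1 - s), -z' (1 - s)) s := by
    intro s hs
    have e : HasDerivAt (fun s : ℝ => 1 - s) (-1) s := by
      simpa using (hasDerivAt_id s).const_sub 1
    have a := (hu _ (hmem s hs)).comp s e
    have b := (hz _ (hmem s hs)).comp s e
    simpa using a.prodMk b
  have key := norm_le_gronwallBound_of_norm_deriv_right_le (a := 0) (b := 1) (δ := 2) (K := C)
    (ε := C) (f := fun s => ((u (1 - s), z (1 - s)) : ℝ × ℝ))
    (f' := fun s => (-u' (1 - s), -z' (1 - s)))
    (fun s hs => (hd s hs).continuousAt.continuousWithinAt)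
    (fun s hs => (hd s (Ico_subset_Icc_self hs)).hasDerivWithinAt)
    (by simpa [Prod.norm_def, h2] using h1)
    (fun s hs => by
      have hs' := hmem s (Ico_subset_Icc_self hs)
      rw [Prod.norm_def, Prod.norm_def]
      simp only [norm_neg, Real.norm_eq_abs]
      have := hu' _ hs'
      have := hz' _ hs'
      refine max_le ?_ ?_ <;> linarith)
    (1 - t) (hmem t ht)
  have hmono : gronwallBound 2 C C (1 - t - 0) ≤ gronwallBound 2 C C 1 :=
    gronwallBound_mono (by norm_num) hC.le hC.le (by linarith [ht.1])
  rw [Prod.norm_def] at key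
  simp only [Real.norm_eq_abs, sub_sub_cancel] at key
  have := key.trans (hmono.trans (le_max_right 2 _))
  exact ⟨(le_max_left _ _).trans this, (le_max_right _ _).trans this⟩

lemma abs_flux_le {m α β p σ ε Λ N C u z t w : ℝ} (hm : 1 < m) (hp0 : 0 < p) (hp1 : p < 1)
    (hσ : 0 < σ) (hα : 0 < α) (hβ : 0 < β) (hε : 0 < ε) (hε1 : ε ≤ 1) (hΛ : Λ ∈ Icc 0 N)
    (ht : t ∈ Icc (0 : ℝ) 1) (hC : C = 1 + 2 * β + 2 * (α + β) + 3 * N) (hw : |w| ≤ |z|)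
    {v : ℝ} (hv : |v| ≤ |u|) :
    |w - β * t * cutProfile m ε v| ≤ C * (1 + max |u| |z|) ∧
    |(α + β) * cutProfile m ε v - Λ * t ^ σ * cutProfile m ε v ^ p| ≤ C * (1 + max |u| |z|) := by
  have hφ := cutProfile_pos (m := m) (u := v) hε
  have hφp := Real.rpow_pos_of_pos hφ p
  have h1 := cutProfile_le (u := v) hm hε hε1
  have h2 := cutProfile_rpow_le (u := v) hm hp0 hp1 hε hε1
  have hu : |u| ≤ max |u| |z| := le_max_left _ _
  have hz : |z| ≤ max |u| |z| := le_max_right _ _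
  set φ := cutProfile m ε v
  set M := max |u| |z|
  have hM : 0 ≤ M := (abs_nonneg u).trans hu
  have htσ : 0 ≤ t ^ σ := Real.rpow_nonneg ht.1 _
  have htσ1 : t ^ σ ≤ 1 := Real.rpow_le_one ht.1 ht.2 hσ.le
  have hN : 0 ≤ N := hΛ.1.trans hΛ.2
  constructor
  · have e : β * t * φ ≤ β * 1 * (2 + M) := by
      gcongr
      · exact ht.2
      · linarith
    have e0 : 0 ≤ β * t * φ := by have := ht.1; positivity
    refine (abs_sub _ _).trans ?_
    rw [abs_of_nonneg e0, hC]
    nlinarith [mul_nonneg hα.le hM, mul_nonneg hβ.le hM, mul_nonneg hN hM]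
  · have e : Λ * t ^ σ * φ ^ p ≤ N * 1 * (3 + M) := by
      gcongr
      · exact hΛ.2
      · linarith
    have e0 : 0 ≤ Λ * t ^ σ * φ ^ p := by have := hΛ.1; positivity
    have e1 : (α + β) * φ ≤ (α + β) * (2 + M) := by gcongr; linarith
    have e2 : 0 ≤ (α + β) * φ := by positivity
    refine (abs_sub _ _).trans ?_
    rw [abs_of_nonneg e0, abs_of_nonneg e2, hC]
    nlinarith [mul_nonneg hα.le hM, mul_nonneg hβ.le hM, mul_nonneg hN hM]

lemma IsCutSolution.exists_bound {m p σ α β N : ℝ} (hm : 1 < m) (hp0 : 0 < p) (hp1 : p < 1)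
    (hσ : 0 < σ) (hα : 0 < α) (hβ : 0 < β) (hN : 0 ≤ N) :
    ∃ M : ℝ, 0 < M ∧ ∀ ε Λ : ℝ, 0 < ε → ε ≤ 1 → Λ ∈ Icc 0 N → ∀ u z : ℝ → ℝ,
      IsCutSolution m p σ α β ε Λ u z → ∀ t ∈ Icc (0 : ℝ) 1, |u t| ≤ M ∧ |z t| ≤ M ∧
        |z t - β * t * cutProfile m ε (u t)| ≤ M ∧
        |(α + β) * cutProfile m ε (u t) - Λ * t ^ σ * cutProfile m ε (u t) ^ p| ≤ M := by
  set C := 1 + 2 * β + 2 * (α + β) + 3 * N with hC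
  have hC1 : 1 ≤ C := by rw [hC]; nlinarith
  obtain ⟨R, hR2, hR⟩ := exists_bound_of_linear_growth (C := C) (by linarith)
  refine ⟨C * (1 + R), by positivity, fun ε Λ hε hε1 hΛ u z h t ht => ?_⟩
  have hgr := fun t ht => abs_flux_le (u := u t) (v := u t) (z := z t) (w := z t) (t := t) hm hp0 hp1 hσ hα hβ hε hε1 hΛ ht hC
    le_rfl le_rfl
  obtain ⟨h1, h2⟩ := hR u z _ _ h.hasDerivAt_u h.hasDerivAt_z (fun t ht => (hgr t ht).1)
    (fun t ht => (hgr t ht).2) (by rw [h.u_one, abs_of_pos (by positivity)]; linarith) h.z_one t ht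
  have h3 : C * (1 + max |u t| |z t|) ≤ C * (1 + R) := by gcongr; exact max_le h1 h2
  have h4 : R ≤ C * (1 + R) := by nlinarith
  exact ⟨h1.trans h4, h2.trans h4, (hgr t ht).1.trans h3, (hgr t ht).2.trans h3⟩

lemma exists_continuous_cutSolution {m p σ α β ε N : ℝ} (hm : 1 < m) (hp0 : 0 < p) (hp1 : p < 1)
    (hσ : 0 < σ) (hα : 0 < α) (hβ : 0 < β) (hε : 0 < ε) (hε1 : ε ≤ 1) (hN : 0 ≤ N) :
    ∃ U Z : ℝ → ℝ → ℝ, (∀ Λ ∈ Icc 0 N, IsCutSolution m p σ α β ε Λ (U Λ) (Z Λ)) ∧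
      ContinuousOn (fun x : ℝ × ℝ => U x.1 x.2) (Icc 0 N ×ˢ Icc 0 1) ∧
      ContinuousOn (fun x : ℝ × ℝ => Z x.1 x.2) (Icc 0 N ×ˢ Icc 0 1) := by
  set C := 1 + 2 * β + 2 * (α + β) + 3 * N with hC
  have hC1 : 1 ≤ C := by rw [hC]; nlinarith
  obtain ⟨R, hR2, hR⟩ := exists_bound_of_linear_growth (C := C) (by linarith)
  have hclip : LipschitzWith 1 fun u : ℝ => max (min u R) ε := (LipschitzWith.id.min_const R).max_const ε
  have hmaps : ∀ u : ℝ, max (min u R) ε ∈ Icc ε R := fun u =>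
    ⟨le_max_right _ _, max_le (min_le_right _ _) (by linarith)⟩
  have hcd : ∀ r : ℝ, ContDiffOn ℝ 1 (fun x : ℝ => x ^ r) (Icc ε R) := fun r x hx =>
    (Real.contDiffAt_rpow_const_of_ne (hε.trans_le hx.1).ne').contDiffWithinAt
  have hlip : ∀ r : ℝ, ∃ K, LipschitzWith K fun u : ℝ => max (min u R) ε ^ r := by
    intro r
    obtain ⟨K, hK⟩ := (hcd r).exists_lipschitzOnWith one_ne_zero (convex_Icc _ _) isCompact_Icc
    refine ⟨K * 1, ?_⟩
    rw [← lipschitzOnWith_univ] at hclip ⊢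
    exact hK.comp hclip fun u _ => hmaps u
  have hQeq : ∀ u, cutProfile m ε (min u R) ^ p = max (min u R) ε ^ (1 / m * p) := fun u => by
    rw [cutProfile, ← Real.rpow_mul (hε.le.trans (hmaps u).1)]
  obtain ⟨KP, hKP⟩ := hlip (1 / m)
  obtain ⟨KQ, hKQ⟩ := hlip (1 / m * p)
  have hPB : ∀ u, |cutProfile m ε (min u R)| ≤ 2 + R := by
    intro u
    rw [abs_of_pos (cutProfile_pos hε)]
    have := rpow_le_one_add (hε.le.trans (hmaps u).1) (r := 1 / m) (by positivity)
      (by rw [div_le_one (by linarith)]; exact hm.le)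
    unfold cutProfile
    linarith [(hmaps u).2]
  have hQB : ∀ u, |cutProfile m ε (min u R) ^ p| ≤ 2 + R := by
    intro u
    rw [abs_of_pos (Real.rpow_pos_of_pos (cutProfile_pos hε) _), hQeq]
    have := rpow_le_one_add (hε.le.trans (hmaps u).1) (r := 1 / m * p) (by positivity)
      (by rw [one_div_mul_eq_div, div_le_one (by linarith)]; linarith)
    linarith [(hmaps u).2]
  obtain ⟨U, Z, hUZ, hUc, hZc⟩ := exists_continuous_flow (P := fun u => cutProfile m ε (min u R))
    (Q := fun u => cutProfile m ε (min u R) ^ p) (b := fun t => β * t) (A := fun t => t ^ σ)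
    hKP (by simpa only [hQeq] using hKQ) hPB hQB (by fun_prop)
    (Real.continuous_rpow_const hσ.le) (α + β) (2 * ε) (R := R) (by linarith) hN
  refine ⟨U, Z, fun Λ hΛ => ?_, hUc, hZc⟩
  obtain ⟨hu1, hz1, hder⟩ := hUZ Λ hΛ
  have habs : ∀ x : ℝ, |min x R| ≤ |x| := fun x => by
    rw [abs_le]
    exact ⟨le_min (neg_abs_le x) (by linarith [abs_nonneg x]), (min_le_left _ _).trans (le_abs_self x)⟩
  have habs' : ∀ x : ℝ, |max (-R) (min x R)| ≤ |x| := fun x => by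
    rw [abs_le]
    exact ⟨le_max_of_le_right (abs_le.1 (habs x)).1,
      max_le (by linarith [abs_nonneg x]) (abs_le.1 (habs x)).2⟩
  have hgr := fun t ht => abs_flux_le (z := Z Λ t) (u := U Λ t) (t := t) hm hp0 hp1 hσ hα hβ hε hε1 hΛ ht hC
    (habs' _) (habs _)
  have hb := hR (U Λ) (Z Λ) _ _ (fun t ht => (hder t ht).1) (fun t ht => (hder t ht).2)
    (fun t ht => (hgr t ht).1) (fun t ht => (hgr t ht).2)
    (by rw [hu1, abs_of_pos (by positivity)]; linarith) hz1
  have hmin : ∀ t ∈ Icc (0 : ℝ) 1, min (U Λ t) R = U Λ t := fun t ht =>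
    min_eq_left (abs_le.1 (hb t ht).1).2
  refine ⟨fun t ht => ?_, fun t ht => ?_, hu1, hz1⟩
  · have := (hder t ht).1
    rwa [hmin t ht, min_eq_left (abs_le.1 (hb t ht).2).2,
      max_eq_right (abs_le.1 (hb t ht).2).1] at this
  · have := (hder t ht).2
    rwa [hmin t ht] at this

lemma hasDerivAt_cutProfile {m ε : ℝ} (hm : 1 < m) (hε : 0 < ε) {u : ℝ → ℝ} {u' t : ℝ}
    (hu : HasDerivAt u u' t) (h : ε < u t) :
    HasDerivAt (fun s => cutProfile m ε (u s)) (cutProfile m ε (u t) ^ (1 - m) * u' / m) t := by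
  have hpos : 0 < u t := hε.trans h
  have h1 : HasDerivAt (fun s => u s ^ (1 / m)) (cutProfile m ε (u t) ^ (1 - m) * u' / m) t := by
    convert hu.rpow_const (p := 1 / m) (Or.inl hpos.ne') using 1
    rw [cutProfile_of_le h.le, ← Real.rpow_mul hpos.le]
    have : 1 / m * (1 - m) = 1 / m - 1 := by field_simp
    rw [this]
    field_simp
  refine h1.congr_of_eventuallyEq ?_
  filter_upwards [hu.continuousAt.eventually (lt_mem_nhds h)] with s hs
  exact cutProfile_of_le hs.le

lemma hasDerivAt_cutProfile_rpow {m ε q : ℝ} (hm : 1 < m) (hε : 0 < ε) {u : ℝ → ℝ} {u' t : ℝ}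
    (hu : HasDerivAt u u' t) (h : ε < u t) :
    HasDerivAt (fun s => cutProfile m ε (u s) ^ q)
      (q / m * cutProfile m ε (u t) ^ (q - m) * u') t := by
  have hφ := cutProfile_pos (m := m) (u := u t) hε
  convert (hasDerivAt_cutProfile hm hε hu h).rpow_const (p := q) (Or.inl hφ.ne') using 1
  have : q - m = (1 - m) + (q - 1) := by ring
  rw [this, Real.rpow_add hφ]
  ring

lemma IsCutSolution.continuousOn_u {m p σ α β ε Λ : ℝ} {u z : ℝ → ℝ}
    (h : IsCutSolution m p σ α β ε Λ u z) : ContinuousOn u (Icc 0 1) :=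
  fun t ht => (h.hasDerivAt_u t ht).continuousAt.continuousWithinAt

lemma IsCutSolution.continuousOn_z {m p σ α β ε Λ : ℝ} {u z : ℝ → ℝ}
    (h : IsCutSolution m p σ α β ε Λ u z) : ContinuousOn z (Icc 0 1) :=
  fun t ht => (h.hasDerivAt_z t ht).continuousAt.continuousWithinAt

lemma continuous_cutProfile {m ε : ℝ} (hm : 1 < m) : Continuous (cutProfile m ε) := by
  unfold cutProfile
  exact (continuous_id.max continuous_const).rpow_const fun x => Or.inr (by positivity)

/-- A barrier for the flux: `z < κ t f` propagates from the interface as long as the reaction term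
is dominated along the trajectory. -/
lemma IsCutSolution.flux_lt {m p σ α β ε Λ κ a : ℝ} {u z : ℝ → ℝ}
    (h : IsCutSolution m p σ α β ε Λ u z) (hm : 1 < m) (hε : 0 < ε) (hκ : 0 < κ)
    (hβ : β = 2 * κ) (ha : 0 < a)
    (hΛ : ∀ t ∈ Ico a 1, 2 * ε ≤ u t → Λ * t ^ σ * cutProfile m ε (u t) ^ p <
      (α + κ) * cutProfile m ε (u t) + κ ^ 2 / m * t ^ 2 * cutProfile m ε (u t) ^ (2 - m)) :
    ∀ t ∈ Icc a 1, 2 * ε ≤ u t ∧ z t < κ * t * cutProfile m ε (u t) := by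
  have hsub : Icc a 1 ⊆ Icc (0 : ℝ) 1 := Icc_subset_Icc_left ha.le
  have hu_ge : ∀ t ∈ Icc a 1, (∀ s ∈ Ioc t 1, z s - κ * s * cutProfile m ε (u s) < 0) →
      2 * ε ≤ u t := by
    intro t ht hs
    have := image_sub_le_of_hasDerivAt_le (C := 0) (f := u) ht.2
      (h.continuousOn_u.mono (Icc_subset_Icc_left (ha.le.trans ht.1)))
      (fun x hx => h.hasDerivAt_u x ⟨by linarith [hx.1, ht.1], hx.2.le⟩) (fun x hx => by
        have h1 := hs x ⟨hx.1, hx.2.le⟩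
        have h2 : 0 < κ * x * cutProfile m ε (u x) :=
          mul_pos (mul_pos hκ (by linarith [hx.1, ht.1])) (cutProfile_pos hε)
        rw [hβ]
        linarith)
    rw [h.u_one] at this
    linarith
  have hneg : ∀ t ∈ Icc a 1, z t - κ * t * cutProfile m ε (u t) < 0 := by
    refine neg_of_backward_first_exit (D := fun t => z t - κ * t * cutProfile m ε (u t)) ?_ ?_ ?_
    · exact (h.continuousOn_z.mono hsub).sub ((continuousOn_const.mul continuousOn_id).mul
        ((continuous_cutProfile hm).comp_continuousOn (h.continuousOn_u.mono hsub)))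
    · have := cutProfile_pos (m := m) (u := u 1) hε
      simp only [h.z_one]
      nlinarith
    · intro t ht hD hs
      have ht' : t ∈ Icc a 1 := Ico_subset_Icc_self ht
      have hu := hu_ge t ht' hs
      have hφ := cutProfile_pos (m := m) (u := u t) hε
      have hder := (h.hasDerivAt_z t (hsub ht')).sub
        (((hasDerivAt_id t).const_mul κ).mul
          (hasDerivAt_cutProfile hm hε (h.hasDerivAt_u t (hsub ht')) (by linarith)))
      refine ⟨_, ?_, hder⟩
      have h1 := hΛ t ht hu
      simp only [id, mul_one]
      set φ := cutProfile m ε (u t)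
      have hz : z t = κ * t * φ := by linarith [hD]
      have h2 : φ ^ (2 - m) = φ ^ (1 - m) * φ := by
        rw [show 2 - m = (1 - m) + 1 by ring, Real.rpow_add hφ, Real.rpow_one]
      rw [h2] at h1
      rw [hz, hβ]
      have : κ * t * (φ ^ (1 - m) * (κ * t * φ - 2 * κ * t * φ) / m) =
          - (κ ^ 2 / m * t ^ 2 * (φ ^ (1 - m) * φ)) := by ring
      rw [this]
      linarith
  exact fun t ht => ⟨hu_ge t ht fun s hs => hneg s ⟨ht.1.trans hs.1.le, hs.2⟩, by
    linarith [hneg t ht]⟩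

lemma rpow_mul_rpow_le_add {m p x y : ℝ} (hp1 : p < 1) (hmp : 2 < m + p) (hx : 0 < x)
    (hy : 0 < y) : y ^ (1 - p) * x ^ p ≤ x + y ^ (m - 1) * x ^ (2 - m) := by
  rcases le_total y x with h | h
  · have h1 : y ^ (1 - p) * x ^ p ≤ x ^ (1 - p) * x ^ p := by gcongr
    rw [← Real.rpow_add hx, sub_add_cancel, Real.rpow_one] at h1
    have : 0 < y ^ (m - 1) * x ^ (2 - m) := by positivity
    linarith
  · have h1 : x ^ p = x ^ (m + p - 2) * x ^ (2 - m) := by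
      rw [← Real.rpow_add hx]; congr 1; ring
    have h2 : y ^ (m - 1) = y ^ (1 - p) * y ^ (m + p - 2) := by
      rw [← Real.rpow_add hy]; congr 1; ring
    have h3 : y ^ (1 - p) * (x ^ (m + p - 2) * x ^ (2 - m)) ≤
        y ^ (1 - p) * (y ^ (m + p - 2) * x ^ (2 - m)) := by gcongr
    rw [h1, h2]
    nlinarith

/-- For a small reaction coefficient the solution is monotone down to the origin. -/
lemma exists_small_reaction {m p σ α β : ℝ} (hm : 1 < m) (hp1 : p < 1)
    (hmp : 2 < m + p) (hσ : 2 * (1 - p) / (m - 1) < σ) (hα : 0 < α) (hβ : 0 < β) :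
    ∃ Λ : ℝ, 0 < Λ ∧ ∀ ε > 0, ∀ u z : ℝ → ℝ, IsCutSolution m p σ α β ε Λ u z →
      (∀ t ∈ Icc (0 : ℝ) 1, 2 * ε ≤ u t) ∧ z 0 ≤ 0 := by
  set κ := β / 2 with hκ
  have hκ0 : 0 < κ := by positivity
  have hm1 : 0 < m - 1 := by linarith
  set B := κ ^ 2 / (m * α) with hB
  have hB0 : 0 < B := by positivity
  set r := (1 - p) / (m - 1) with hr
  have hr0 : 0 < r := div_pos (by linarith) hm1
  refine ⟨α * B ^ r, by positivity, fun ε hε u z h => ?_⟩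
  have key : ∀ t ∈ Ioc (0 : ℝ) 1, 2 * ε ≤ u t ∧ z t < κ * t * cutProfile m ε (u t) := by
    intro a ha
    refine h.flux_lt hm hε hκ0 (by rw [hκ]; ring) ha.1 (fun t ht _ => ?_) a ⟨le_rfl, ha.2⟩
    have ht0 : 0 < t := ha.1.trans_le ht.1
    have hφ := cutProfile_pos (m := m) (u := u t) hε
    set φ := cutProfile m ε (u t)
    have hBt : 0 < B * t ^ 2 := by positivity
    have e1 := rpow_mul_rpow_le_add (m := m) hp1 hmp hφ
      (Real.rpow_pos_of_pos hBt (1 / (m - 1)))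
    rw [← Real.rpow_mul hBt.le, ← Real.rpow_mul hBt.le, one_div_mul_cancel hm1.ne', Real.rpow_one,
      one_div_mul_eq_div, ← hr, Real.mul_rpow hB0.le (by positivity), ← Real.rpow_natCast t 2,
      ← Real.rpow_mul ht0.le] at e1
    have e2 : t ^ σ ≤ t ^ (((2 : ℕ) : ℝ) * r) := by
      apply Real.rpow_le_rpow_of_exponent_ge ht0 ht.2.le
      push_cast
      rw [hr, ← mul_div_assoc]
      exact hσ.le
    have e3 : α * B ^ r * t ^ σ * φ ^ p ≤ α * (B ^ r * t ^ (((2 : ℕ) : ℝ) * r) * φ ^ p) := by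
      have : α * B ^ r * t ^ σ * φ ^ p = α * (B ^ r * t ^ σ * φ ^ p) := by ring
      rw [this]
      gcongr
    rw [Real.rpow_natCast] at e1
    have e4 := mul_le_mul_of_nonneg_left e1 hα.le
    have e5 : α * (φ + B * t ^ 2 * φ ^ (2 - m)) = α * φ + κ ^ 2 / m * t ^ 2 * φ ^ (2 - m) := by
      rw [hB]; field_simp
    nlinarith [mul_pos hκ0 hφ]
  have hcl : (0 : ℝ) ∈ closure (Ioc (0 : ℝ) 1) := by
    rw [closure_Ioc zero_ne_one]; exact left_mem_Icc.2 zero_le_one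
  have hnb : (𝓝[Ioc (0 : ℝ) 1] 0).NeBot := mem_closure_iff_nhdsWithin_neBot.1 hcl
  have h0 : (0 : ℝ) ∈ Icc (0 : ℝ) 1 := left_mem_Icc.2 zero_le_one
  have hu0 : 2 * ε ≤ u 0 := ge_of_tendsto
    ((h.continuousOn_u 0 h0).mono Ioc_subset_Icc_self)
    (eventually_nhdsWithin_of_forall fun t ht => (key t ht).1)
  refine ⟨fun t ht => ?_, ?_⟩
  · rcases ht.1.eq_or_lt with h1 | h1
    · rw [← h1]; exact hu0
    · exact (key t ⟨h1, ht.2⟩).1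
  · have hc : ContinuousOn (fun t => z t - κ * t * cutProfile m ε (u t)) (Icc 0 1) :=
      h.continuousOn_z.sub ((continuousOn_const.mul continuousOn_id).mul
        ((continuous_cutProfile hm).comp_continuousOn h.continuousOn_u))
    have := le_of_tendsto ((hc 0 h0).mono Ioc_subset_Icc_self)
      (eventually_nhdsWithin_of_forall fun t ht => by
        show z t - κ * t * cutProfile m ε (u t) ≤ 0
        linarith [(key t ht).2])
    simpa using this

/-- Uniform non-degeneracy near the interface. -/
lemma exists_interface_estimate {m p σ α β N : ℝ} (hm : 1 < m) (hp0 : 0 < p) (hp1 : p < 1)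
    (hmp : 2 < m + p) (hσ : 0 < σ) (hα : 0 < α) (hβ : 0 < β) (hN : 0 ≤ N) :
    ∃ δ ∈ Ioo (0 : ℝ) (1 / 2), ∃ c > 0, ∃ ε₀ ∈ Ioc (0 : ℝ) 1, ∀ ε ∈ Ioc 0 ε₀, ∀ Λ ∈ Icc 0 N,
      ∀ u z : ℝ → ℝ, IsCutSolution m p σ α β ε Λ u z →
      ∀ t ∈ Icc (1 - δ) 1, z t ≤ β / 2 * t * cutProfile m ε (u t) ∧
        c * (1 - t) ≤ cutProfile m ε (u t) ^ (m - 1) := by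
  obtain ⟨M, hM, hMb⟩ := IsCutSolution.exists_bound (σ := σ) hm hp0 hp1 hσ hα hβ hN
  set κ := β / 2 with hκ
  have hκ0 : 0 < κ := by positivity
  have hm0 : 0 < m := by linarith
  have hm1 : 0 < m - 1 := by linarith
  obtain ⟨τ, hτ0, hτ⟩ : ∃ τ > 0, τ ^ ((m + p - 2) / m) * N ≤ κ ^ 2 / (4 * m) := by
    have hr : 0 < (m + p - 2) / m := div_pos (by linarith) hm0
    refine ⟨(κ ^ 2 / (4 * m) / (N + 1)) ^ ((m + p - 2) / m)⁻¹, by positivity, ?_⟩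
    rw [Real.rpow_inv_rpow (by positivity) hr.ne', div_mul_eq_mul_div, div_le_iff₀ (by positivity)]
    have : 0 < κ ^ 2 / (4 * m) := by positivity
    nlinarith
  refine ⟨min (1 / 4) (τ / (2 * M)), ⟨by positivity, (min_le_left _ _).trans_lt (by norm_num)⟩,
    (m - 1) / m * (κ / 2), by positivity, min 1 (τ / 4), ⟨by positivity, min_le_left _ _⟩, ?_⟩
  set δ := min (1 / 4) (τ / (2 * M)) with hδ
  intro ε hε Λ hΛ u z h
  have hδ0 : 0 < δ := by positivity
  have hδ1 : δ ≤ 1 / 4 := min_le_left _ _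
  have hδ2 : M * δ ≤ τ / 2 := by
    have := min_le_right (1 / 4) (τ / (2 * M))
    rw [← hδ, le_div_iff₀ (by positivity)] at this
    linarith
  have hε4 : ε ≤ τ / 4 := hε.2.trans (min_le_right _ _)
  have hε1 : ε ≤ 1 := hε.2.trans (min_le_left _ _)
  have hb := hMb ε Λ hε.1 hε1 hΛ u z h
  have hsub : Icc (1 - δ) 1 ⊆ Icc (0 : ℝ) 1 := Icc_subset_Icc_left (by linarith)
  have hbar := h.flux_lt (a := 1 - δ) hm hε.1 hκ0 (by rw [hκ]; ring) (by linarith) (by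
    intro t ht hut
    have ht' : t ∈ Icc (1 - δ) 1 := Ico_subset_Icc_self ht
    have hφ := cutProfile_pos (m := m) (u := u t) hε.1
    have huτ : u t ≤ τ := by
      have := le_image_sub_of_le_hasDerivAt (C := -M) (f := u) ht'.2
        (h.continuousOn_u.mono (Icc_subset_Icc_left (hsub ht').1))
        (fun x hx => h.hasDerivAt_u x ⟨by linarith [hx.1, (hsub ht').1], hx.2.le⟩)
        (fun x hx => (abs_le.1 (hb x ⟨by linarith [hx.1, (hsub ht').1], hx.2.le⟩).2.2.1).1)
      rw [h.u_one] at this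
      nlinarith [ht.1]
    have hut0 : 0 ≤ u t := by linarith [hε.1]
    have hφτ : cutProfile m ε (u t) ^ (m + p - 2) * N ≤ κ ^ 2 / (4 * m) := by
      refine le_trans ?_ hτ
      rw [cutProfile_of_le (by linarith [hε.1]), ← Real.rpow_mul hut0, one_div_mul_eq_div]
      gcongr
    set φ := cutProfile m ε (u t)
    have h1 : φ ^ p = φ ^ (m + p - 2) * φ ^ (2 - m) := by
      rw [← Real.rpow_add hφ]; congr 1; ring
    have h2 : 0 < φ ^ (2 - m) := Real.rpow_pos_of_pos hφ _
    have h3 : 0 < φ ^ (m + p - 2) := Real.rpow_pos_of_pos hφ _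
    have ht0 : 0 < t := by linarith [ht.1]
    have h4 : Λ * t ^ σ ≤ N * 1 :=
      mul_le_mul hΛ.2 (Real.rpow_le_one ht0.le ht.2.le hσ.le) (Real.rpow_nonneg ht0.le _) hN
    have h5 : κ ^ 2 / (4 * m) ≤ κ ^ 2 / m * t ^ 2 := by
      have : κ ^ 2 / (4 * m) = κ ^ 2 / m * (1 / 4) := by field_simp
      rw [this]
      gcongr
      nlinarith [ht.1]
    calc Λ * t ^ σ * φ ^ p ≤ N * 1 * φ ^ p := by gcongr
      _ = φ ^ (m + p - 2) * N * φ ^ (2 - m) := by rw [h1]; ring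
      _ ≤ κ ^ 2 / m * t ^ 2 * φ ^ (2 - m) := mul_le_mul_of_nonneg_right (hφτ.trans h5) h2.le
      _ < _ := by have : 0 < (α + κ) * φ := by positivity
                  linarith)
  intro t ht
  refine ⟨(hbar t ht).2.le, ?_⟩
  have := image_sub_le_of_hasDerivAt_le (C := -((m - 1) / m * (κ / 2))) ht.2
    (f := fun s => cutProfile m ε (u s) ^ (m - 1))
    (fun x hx => (hasDerivAt_cutProfile_rpow hm hε.1 (h.hasDerivAt_u x (hsub ⟨ht.1.trans hx.1, hx.2⟩))
      (by linarith [(hbar x ⟨ht.1.trans hx.1, hx.2⟩).1, hε.1])).continuousAt.continuousWithinAt)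
    (fun x hx => hasDerivAt_cutProfile_rpow hm hε.1
      (h.hasDerivAt_u x (hsub ⟨ht.1.trans hx.1.le, hx.2.le⟩))
      (by linarith [(hbar x ⟨ht.1.trans hx.1.le, hx.2.le⟩).1, hε.1]))
    (fun x hx => by
      have hbx := (hbar x ⟨ht.1.trans hx.1.le, hx.2.le⟩).2
      have hφ := cutProfile_pos (m := m) (u := u x) hε.1
      set φ := cutProfile m ε (u x)
      rw [show m - 1 - m = -1 by ring, Real.rpow_neg_one]
      have h1 : z x - β * x * φ ≤ -(κ / 2 * φ) := by
        have : β = 2 * κ := by rw [hκ]; ring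
        rw [this]
        have : 1 / 2 ≤ x := by linarith [hx.1, ht.1]
        nlinarith [mul_pos hκ0 hφ, mul_le_mul_of_nonneg_left this (mul_pos hκ0 hφ).le]
      calc (m - 1) / m * φ⁻¹ * (z x - β * x * φ) ≤ (m - 1) / m * φ⁻¹ * (-(κ / 2 * φ)) := by gcongr
        _ = _ := by field_simp)
  have hpos : 0 ≤ cutProfile m ε (u 1) ^ (m - 1) := (Real.rpow_pos_of_pos (cutProfile_pos hε.1) _).le
  linarith

lemma IsCutSolution.hasDerivAt_deriv {m p σ α β ε Λ : ℝ} {u z : ℝ → ℝ} (hm : 1 < m) (hε : 0 < ε)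
    (h : IsCutSolution m p σ α β ε Λ u z) {t : ℝ} (ht : t ∈ Icc (0 : ℝ) 1) (hu : ε < u t) :
    HasDerivAt (fun t => z t - β * t * cutProfile m ε (u t))
      (α * cutProfile m ε (u t) - Λ * t ^ σ * cutProfile m ε (u t) ^ p -
        β * t * (cutProfile m ε (u t) ^ (1 - m) * (z t - β * t * cutProfile m ε (u t)) / m)) t := by
  refine ((h.hasDerivAt_z t ht).sub (((hasDerivAt_id t).const_mul β).mul
    (hasDerivAt_cutProfile hm hε (h.hasDerivAt_u t ht) hu))).congr_deriv ?_
  simp only [id, mul_one]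
  ring

lemma cutProfile_rpow_self {m ε u : ℝ} (hm : 1 < m) (hε : 0 < ε) (h : ε ≤ u) :
    cutProfile m ε u ^ m = u := by
  rw [cutProfile_of_le h, ← Real.rpow_mul (hε.le.trans h), one_div_mul_cancel (by linarith),
    Real.rpow_one]

/-- For a large reaction coefficient the solution falls below its boundary value. -/
lemma exists_large_reaction {m p σ α β : ℝ} (hm : 1 < m) (hp0 : 0 < p) (hp1 : p < 1)
    (hσ : 0 < σ) (hα : 0 < α) (hβ : 0 < β) {Λ₁ : ℝ} (hΛ₁ : 0 < Λ₁) :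
    ∃ Λ : ℝ, Λ₁ ≤ Λ ∧ ∀ ε : ℝ, 0 < ε → 2 * ε < 1 → ∀ u z : ℝ → ℝ,
      IsCutSolution m p σ α β ε Λ u z → ¬ ∀ t ∈ Icc (0 : ℝ) 1, 2 * ε ≤ u t := by
  have hm0 : 0 < m := by linarith
  have hm1 : 0 < m - 1 := by linarith
  have hp1' : 0 < 1 - p := by linarith
  obtain ⟨C, hC0, hC⟩ : ∃ C > 0, C ^ (m - 1) = 1 + β :=
    ⟨(1 + β) ^ (m - 1)⁻¹, by positivity, Real.rpow_inv_rpow (by positivity) hm1.ne'⟩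
  obtain ⟨k, hk0, hkΛ, hk1, hk2, hk3⟩ : ∃ k > 0, Λ₁ ≤ k ∧ (α + β) * C ^ (1 - p) ≤ k ∧
      (β * C) ^ (1 - p) < (1 - p) * (k * β ^ (-p)) / 4 ∧ 16 * C ^ (m - p) ≤ k := by
    have e1 : 0 < (α + β) * C ^ (1 - p) := by positivity
    have e2 : 0 < 16 * C ^ (m - p) := by positivity
    have e3 : 0 < 4 * (β * C) ^ (1 - p) / ((1 - p) * β ^ (-p)) := by positivity
    refine ⟨Λ₁ + (α + β) * C ^ (1 - p) + 16 * C ^ (m - p) +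
      4 * (β * C) ^ (1 - p) / ((1 - p) * β ^ (-p)), by positivity, by linarith, by linarith, ?_,
      by linarith⟩
    have e4 : (β * C) ^ (1 - p) =
        (1 - p) * (4 * (β * C) ^ (1 - p) / ((1 - p) * β ^ (-p)) * β ^ (-p)) / 4 := by
      field_simp
    conv_lhs => rw [e4]
    gcongr
    linarith
  refine ⟨2 * k * 4 ^ σ, ?_, fun ε hε hε1 u z h hu => ?_⟩
  · have : (1 : ℝ) ≤ 4 ^ σ := Real.one_le_rpow (by norm_num) hσ.le
    nlinarith
  have hφ : ∀ t, 0 < cutProfile m ε (u t) := fun t => cutProfile_pos hε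
  have hmem : ∀ t ∈ Icc (1 / 4 : ℝ) 1, t ∈ Icc (0 : ℝ) 1 := fun t ht =>
    ⟨by linarith [ht.1], ht.2⟩
  have hu' : ∀ t ∈ Icc (1 / 4 : ℝ) 1, ε < u t := fun t ht => by linarith [hu t (hmem t ht)]
  have hreac : ∀ t ∈ Icc (1 / 4 : ℝ) 1, cutProfile m ε (u t) ≤ C →
      (α + β) * cutProfile m ε (u t) - 2 * k * 4 ^ σ * t ^ σ * cutProfile m ε (u t) ^ p ≤
        -(k * cutProfile m ε (u t) ^ p) := by
    intro t ht hle
    have h0 := hφ t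
    set φ := cutProfile m ε (u t)
    have e1 : 1 ≤ (4 : ℝ) ^ σ * t ^ σ := by
      rw [← Real.mul_rpow (by norm_num) (by linarith [ht.1])]
      exact Real.one_le_rpow (by linarith [ht.1]) hσ.le
    have e2 : φ = φ ^ (1 - p) * φ ^ p := by
      rw [← Real.rpow_add h0, sub_add_cancel, Real.rpow_one]
    have e3 : (α + β) * φ ≤ k * φ ^ p := by
      calc (α + β) * φ = (α + β) * φ ^ (1 - p) * φ ^ p := by rw [mul_assoc, ← e2]
        _ ≤ (α + β) * C ^ (1 - p) * φ ^ p := by gcongr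
        _ ≤ _ := by gcongr
    have e4 : 0 < k * φ ^ p := by positivity
    nlinarith
  have hle_of : ∀ t ∈ Icc (1 / 4 : ℝ) 1,
      cutProfile m ε (u t) ^ (m - 1) - 1 - β * (1 - t) ≤ 0 → cutProfile m ε (u t) ≤ C := by
    intro t ht hE
    rw [← Real.rpow_le_rpow_iff (hφ t).le hC0.le hm1, hC]
    nlinarith [ht.1]
  have hz_anti : ∀ t ∈ Icc (1 / 4 : ℝ) 1, (∀ s ∈ Ioo t 1, cutProfile m ε (u s) ≤ C) →
      0 ≤ z t := by
    intro t ht hs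
    have := image_sub_le_of_hasDerivAt_le (C := 0) (f := z) ht.2
      (h.continuousOn_z.mono (Icc_subset_Icc_left (hmem t ht).1))
      (fun x hx => h.hasDerivAt_z x ⟨by linarith [hx.1, ht.1], hx.2.le⟩) (fun x hx => by
        have h1 := hreac x ⟨by linarith [hx.1, ht.1], hx.2.le⟩ (hs x hx)
        have h2 : 0 < k * cutProfile m ε (u x) ^ p := mul_pos hk0 (Real.rpow_pos_of_pos (hφ x) _)
        linarith)
    rw [h.z_one] at this
    linarith
  have hE : ∀ t ∈ Icc (1 / 4 : ℝ) 1, cutProfile m ε (u t) ^ (m - 1) - 1 - β * (1 - t) < 0 := by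
    have hd : ∀ t ∈ Icc (1 / 4 : ℝ) 1, HasDerivAt
        (fun t => cutProfile m ε (u t) ^ (m - 1) - 1 - β * (1 - t))
        ((m - 1) / m * cutProfile m ε (u t) ^ (m - 1 - m) * (z t - β * t * cutProfile m ε (u t))
          + β) t := by
      intro t ht
      refine (((hasDerivAt_cutProfile_rpow (q := m - 1) hm hε (h.hasDerivAt_u t (hmem t ht))
        (hu' t ht)).sub_const 1).sub (((hasDerivAt_id t).const_sub 1).const_mul β)).congr_deriv ?_
      ring
    refine neg_of_backward_first_exit (fun t ht => (hd t ht).continuousAt.continuousWithinAt) ?_ ?_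
    · rw [h.u_one, cutProfile_of_le (by linarith), ← Real.rpow_mul (by linarith)]
      have : (2 * ε) ^ (1 / m * (m - 1)) < 1 :=
        Real.rpow_lt_one (by linarith) hε1 (by positivity)
      linarith
    · intro t ht hD hs
      have ht' := Ico_subset_Icc_self ht
      refine ⟨_, ?_, hd t ht'⟩
      have hzt := hz_anti t ht' fun s hs' => hle_of s ⟨ht.1.trans hs'.1.le, hs'.2.le⟩
        (hs s ⟨hs'.1, hs'.2.le⟩).le
      have h0 := hφ t
      set φ := cutProfile m ε (u t)
      rw [show m - 1 - m = -1 by ring, Real.rpow_neg_one]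
      have e1 : (m - 1) / m * φ⁻¹ * (-(β * t * φ)) ≤ (m - 1) / m * φ⁻¹ * (z t - β * t * φ) := by
        gcongr; linarith
      have e2 : (m - 1) / m * φ⁻¹ * (-(β * t * φ)) = - ((m - 1) / m * β * t) := by field_simp
      have e3 : (m - 1) / m < 1 := by rw [div_lt_one hm0]; linarith
      have e4 : (m - 1) / m * (β * t) ≤ (m - 1) / m * (β * 1) := by
        gcongr; exact ht.2.le
      nlinarith
  have hφC : ∀ t ∈ Icc (1 / 4 : ℝ) 1, cutProfile m ε (u t) ≤ C := fun t ht =>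
    hle_of t ht (hE t ht).le
  have hz' : ∀ t ∈ Icc (1 / 4 : ℝ) 1,
      (α + β) * cutProfile m ε (u t) - 2 * k * 4 ^ σ * t ^ σ * cutProfile m ε (u t) ^ p ≤
        -(k * cutProfile m ε (u t) ^ p) := fun t ht => hreac t ht (hφC t ht)
  have hz0 : ∀ t ∈ Ico (3 / 4 : ℝ) 1, 0 < z t := by
    have := strictAntiOn_of_deriv_neg (convex_Icc (3 / 4 : ℝ) 1)
      (h.continuousOn_z.mono (Icc_subset_Icc_left (by norm_num))) (fun x hx => by
        rw [interior_Icc] at hx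
        rw [(h.hasDerivAt_z x ⟨by linarith [hx.1], hx.2.le⟩).deriv]
        have h1 := hz' x ⟨by linarith [hx.1], hx.2.le⟩
        have h2 : 0 < k * cutProfile m ε (u x) ^ p := mul_pos hk0 (Real.rpow_pos_of_pos (hφ x) _)
        linarith)
    intro t ht
    have := this (Ico_subset_Icc_self ht) ⟨by norm_num, le_rfl⟩ ht.2
    rwa [h.z_one] at this
  obtain ⟨η, hη, hVη⟩ : ∃ η ∈ Icc (3 / 4 : ℝ) 1, 0 < z η - β * η * cutProfile m ε (u η) := by
    by_contra hcon
    push Not at hcon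
    have hle : ∀ t ∈ Ico (3 / 4 : ℝ) 1, z t ≤ β * cutProfile m ε (u t) := by
      intro t ht
      have h1 := hcon t (Ico_subset_Icc_self ht)
      have : β * t * cutProfile m ε (u t) ≤ β * 1 * cutProfile m ε (u t) := by
        have := (hφ t).le
        gcongr
        exact ht.2.le
      linarith
    have := image_sub_le_of_hasDerivAt_le (C := -((1 - p) * (k * β ^ (-p))))
      (f := fun t => z t ^ (1 - p)) (by norm_num : (3 / 4 : ℝ) ≤ 1)
      ((h.continuousOn_z.mono (Icc_subset_Icc_left (by norm_num))).rpow_const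
        fun _ _ => Or.inr hp1'.le)
      (fun x hx => (h.hasDerivAt_z x ⟨by linarith [hx.1], hx.2.le⟩).rpow_const
        (Or.inl (hz0 x (Ioo_subset_Ico_self hx)).ne')) (fun x hx => by
        have hzx := hz0 x (Ioo_subset_Ico_self hx)
        have e1 := hz' x ⟨by linarith [hx.1], hx.2.le⟩
        have e2 : (z x) ^ p ≤ β ^ p * cutProfile m ε (u x) ^ p := by
          rw [← Real.mul_rpow hβ.le (hφ x).le]
          exact Real.rpow_le_rpow hzx.le (hle x (Ioo_subset_Ico_self hx)) hp0.le
        have e3 : β ^ (-p) * z x ^ p ≤ cutProfile m ε (u x) ^ p := by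
          rw [Real.rpow_neg hβ.le, inv_mul_le_iff₀ (by positivity)]
          exact e2
        have e4 : z x ^ p * z x ^ (1 - p - 1) = 1 := by
          rw [← Real.rpow_add hzx]; simp
        have e5 : 0 < z x ^ (1 - p - 1) := Real.rpow_pos_of_pos hzx _
        have e6 : (α + β) * cutProfile m ε (u x) -
            2 * k * 4 ^ σ * x ^ σ * cutProfile m ε (u x) ^ p ≤ -(k * (β ^ (-p) * z x ^ p)) :=
          e1.trans (neg_le_neg (by gcongr))
        have e7 := mul_le_mul_of_nonneg_right e6 (mul_pos hp1' e5).le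
        have e8 : -(k * (β ^ (-p) * z x ^ p)) * ((1 - p) * z x ^ (1 - p - 1)) =
          -((1 - p) * (k * β ^ (-p))) := by linear_combination (-((1 - p) * (k * β ^ (-p)))) * e4
        rw [e8] at e7
        linarith)
    simp only [h.z_one] at this
    rw [Real.zero_rpow hp1'.ne'] at this
    have hz34 : z (3 / 4) ^ (1 - p) ≤ (β * C) ^ (1 - p) := by
      have h1 : (3 / 4 : ℝ) ∈ Ico (3 / 4 : ℝ) 1 := by norm_num
      refine Real.rpow_le_rpow (hz0 _ h1).le ((hle _ h1).trans ?_) hp1'.le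
      have := hφC (3 / 4) (by norm_num)
      gcongr
    linarith
  have hV : ∀ t ∈ Icc (1 / 4) η, 0 < z t - β * t * cutProfile m ε (u t) := by
    have hsub : ∀ t ∈ Icc (1 / 4) η, t ∈ Icc (1 / 4 : ℝ) 1 := fun t ht => ⟨ht.1, ht.2.trans hη.2⟩
    have hd := fun t (ht : t ∈ Icc (1 / 4) η) =>
      (h.hasDerivAt_deriv hm hε (hmem t (hsub t ht)) (hu' t (hsub t ht))).neg
    have := neg_of_backward_first_exit
      (fun t ht => (hd t ht).continuousAt.continuousWithinAt) (by simpa using hVη) (fun t ht hD _ => by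
        have ht' := Ico_subset_Icc_self ht
        refine ⟨_, ?_, hd t ht'⟩
        have e1 := hz' t (hsub t ht')
        have hV0 : z t - β * t * cutProfile m ε (u t) = 0 := by
          simp only [Pi.neg_apply] at hD
          linarith
        rw [hV0]
        have e2 : 0 < k * cutProfile m ε (u t) ^ p := mul_pos hk0 (Real.rpow_pos_of_pos (hφ t) _)
        have e3 := mul_pos hβ (hφ t)
        simp only [mul_zero, zero_div, sub_zero]
        linarith)
    intro t ht
    simpa using this t ht
  have hmem' : ∀ t ∈ Icc (1 / 4 : ℝ) (3 / 4), t ∈ Icc (1 / 4 : ℝ) 1 ∧ t ∈ Icc (1 / 4) η :=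
    fun t ht => ⟨⟨ht.1, by linarith [ht.2]⟩, ht.1, ht.2.trans hη.1⟩
  have hdV := fun t (ht : t ∈ Icc (1 / 4 : ℝ) (3 / 4)) =>
    h.hasDerivAt_deriv hm hε (hmem t (hmem' t ht).1) (hu' t (hmem' t ht).1)
  have hVk : ∀ t ∈ Icc (1 / 4 : ℝ) (3 / 4), α * cutProfile m ε (u t) -
      2 * k * 4 ^ σ * t ^ σ * cutProfile m ε (u t) ^ p -
        β * t * (cutProfile m ε (u t) ^ (1 - m) * (z t - β * t * cutProfile m ε (u t)) / m) ≤
      -(k * cutProfile m ε (u t) ^ p) := by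
    intro t ht
    have e1 := hz' t (hmem' t ht).1
    have e2 := mul_pos hβ (hφ t)
    have e3 : 0 ≤ β * t *
        (cutProfile m ε (u t) ^ (1 - m) * (z t - β * t * cutProfile m ε (u t)) / m) := by
      have := hV t (hmem' t ht).2
      have := hφ t
      have := (hmem t (hmem' t ht).1).1
      positivity
    linarith
  have hu_mono : ∀ t ∈ Icc (1 / 2 : ℝ) (3 / 4), u (1 / 2) ≤ u t := by
    intro t ht
    have := le_image_sub_of_le_hasDerivAt (C := 0) (f := u) ht.1
      (h.continuousOn_u.mono (Icc_subset_Icc (by norm_num) (by linarith [ht.2])))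
      (fun x hx => h.hasDerivAt_u x ⟨by linarith [hx.1], by linarith [hx.2, ht.2]⟩)
      (fun x hx => (hV x ⟨by linarith [hx.1], by linarith [hx.2, ht.2, hη.1]⟩).le)
    linarith
  have hφ_mono : ∀ t ∈ Icc (1 / 2 : ℝ) (3 / 4),
      cutProfile m ε (u (1 / 2)) ≤ cutProfile m ε (u t) := fun t ht =>
    Real.rpow_le_rpow (le_max_of_le_right hε.le) (max_le_max_right _ (hu_mono t ht))
      (by positivity)
  have s1 := image_sub_le_of_hasDerivAt_le (C := -(k * cutProfile m ε (u (1 / 2)) ^ p))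
    (by norm_num : (1 / 2 : ℝ) ≤ 3 / 4)
    (fun t ht => (hdV t ⟨by linarith [ht.1], ht.2⟩).continuousAt.continuousWithinAt)
    (fun t ht => hdV t ⟨by linarith [ht.1], ht.2.le⟩) (fun t ht => by
      refine (hVk t ⟨by linarith [ht.1], ht.2.le⟩).trans (neg_le_neg ?_)
      have := hφ_mono t (Ioo_subset_Icc_self ht)
      have := hφ (1 / 2)
      gcongr)
  have hV34 := hV (3 / 4) ⟨by norm_num, hη.1⟩
  have s2 : ∀ t ∈ Icc (1 / 4 : ℝ) (1 / 2), z (1 / 2) - β * (1 / 2) * cutProfile m ε (u (1 / 2)) ≤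
      z t - β * t * cutProfile m ε (u t) := by
    intro t ht
    have := image_sub_le_of_hasDerivAt_le (C := 0) ht.2
      (fun s hs => (hdV s ⟨ht.1.trans hs.1, by linarith [hs.2]⟩).continuousAt.continuousWithinAt)
      (fun s hs => hdV s ⟨ht.1.trans hs.1.le, by linarith [hs.2]⟩) (fun s hs => by
        have h1 := hVk s ⟨ht.1.trans hs.1.le, by linarith [hs.2]⟩
        have h2 : 0 < k * cutProfile m ε (u s) ^ p := mul_pos hk0 (Real.rpow_pos_of_pos (hφ s) _)
        linarith)
    linarith
  have s3 := le_image_sub_of_le_hasDerivAt (f := u) (by norm_num : (1 / 4 : ℝ) ≤ 1 / 2)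
    (h.continuousOn_u.mono (Icc_subset_Icc (by norm_num) (by norm_num)))
    (fun x hx => h.hasDerivAt_u x ⟨by linarith [hx.1], by linarith [hx.2]⟩)
    (fun x hx => s2 x (Ioo_subset_Icc_self hx))
  have hu14 := hu' (1 / 4) (by norm_num)
  have s4 : u (1 / 2) ≤ C ^ (m - p) * cutProfile m ε (u (1 / 2)) ^ p := by
    have h0 := hφ (1 / 2)
    conv_lhs => rw [← cutProfile_rpow_self hm hε (hu' (1 / 2) (by norm_num)).le]
    rw [show m = (m - p) + p by ring, Real.rpow_add (by convert h0 using 2; ring)]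
    simp only [sub_add_cancel]
    have := hφC (1 / 2) (by norm_num)
    have : 0 ≤ m - p := by linarith
    gcongr
  have s5 : 0 < cutProfile m ε (u (1 / 2)) ^ p := Real.rpow_pos_of_pos (hφ _) _
  nlinarith

lemma eventually_lt_of_hasDerivAt_neg {f : ℝ → ℝ} {d x : ℝ} (h : HasDerivAt f d x) (hd : d < 0) :
    ∀ᶠ s in 𝓝[>] x, f s < f x := by
  have h1 : ∀ᶠ s in 𝓝[>] x, slope f x s < 0 :=
    (hasDerivAt_iff_tendsto_slope.1 h |>.mono_left
      (nhdsWithin_mono x fun y hy => ne_of_gt hy)).eventually (gt_mem_nhds hd)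
  filter_upwards [h1, self_mem_nhdsWithin] with s hs hxs
  rw [slope_def_field] at hs
  have hsx : 0 < s - x := sub_pos.2 hxs
  by_contra hcon
  exact absurd hs (not_lt.2 (div_nonneg (by linarith) hsx.le))

/-- Cut solutions stay above their boundary value on a uniform neighbourhood of the endpoint. -/
lemma exists_boundary_layer {m p σ α β ε N : ℝ} (hm : 1 < m) (hp0 : 0 < p) (hp1 : p < 1)
    (hσ : 0 < σ) (hα : 0 < α) (hβ : 0 < β) (hε : 0 < ε) (hε1 : ε ≤ 1) (hN : 0 ≤ N) :
    ∃ δ ∈ Ioo (0 : ℝ) 1, ∀ Λ ∈ Icc 0 N, ∀ u z : ℝ → ℝ, IsCutSolution m p σ α β ε Λ u z →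
      ∀ t ∈ Icc (1 - δ) 1, 2 * ε ≤ u t := by
  obtain ⟨M, hM, hMb⟩ := IsCutSolution.exists_bound (σ := σ) hm hp0 hp1 hσ hα hβ hN
  have hε' : 0 < β * ε ^ (1 / m) := by positivity
  refine ⟨min (1 / 2) (β * ε ^ (1 / m) / (2 * M)), ⟨by positivity,
    (min_le_left _ _).trans_lt (by norm_num)⟩, fun Λ hΛ u z h t ht => ?_⟩
  set δ := min (1 / 2) (β * ε ^ (1 / m) / (2 * M)) with hδ
  have hδ1 : δ ≤ 1 / 2 := min_le_left _ _
  have hδ2 : M * δ ≤ β * ε ^ (1 / m) / 2 := by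
    have := min_le_right (1 / 2) (β * ε ^ (1 / m) / (2 * M))
    rw [← hδ, le_div_iff₀ (by positivity)] at this
    linarith
  have hb := hMb ε Λ hε hε1 hΛ u z h
  have hzt : ∀ x ∈ Icc (1 - δ) 1, z x ≤ M * δ := by
    intro x hx
    have := le_image_sub_of_le_hasDerivAt (C := -M) (f := z) hx.2
      (h.continuousOn_z.mono (Icc_subset_Icc_left (by linarith [hx.1])))
      (fun y hy => h.hasDerivAt_z y ⟨by linarith [hx.1, hy.1], hy.2.le⟩)
      (fun y hy => (abs_le.1 (hb y ⟨by linarith [hx.1, hy.1], hy.2.le⟩).2.2.2).1)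
    rw [h.z_one] at this
    nlinarith [hx.1]
  have := image_sub_le_of_hasDerivAt_le (C := 0) (f := u) ht.2
    (h.continuousOn_u.mono (Icc_subset_Icc_left (by linarith [ht.1])))
    (fun x hx => h.hasDerivAt_u x ⟨by linarith [ht.1, hx.1], hx.2.le⟩) (fun x hx => by
      have h1 := hzt x ⟨ht.1.trans hx.1.le, hx.2.le⟩
      have h2 : ε ^ (1 / m) ≤ cutProfile m ε (u x) :=
        Real.rpow_le_rpow hε.le (le_max_right _ _) (by positivity)
      have h3 : β * (1 / 2) * ε ^ (1 / m) ≤ β * x * cutProfile m ε (u x) := by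
        have h4 : 1 / 2 ≤ x := by linarith [hx.1, ht.1]
        have h5 : 0 ≤ β * x := mul_nonneg hβ.le (by linarith)
        gcongr
      linarith)
  rw [h.u_one] at this
  linarith

/-- Along a cut solution touching its lower bound, the flux is small near the origin. -/
lemma IsCutSolution.touching_estimate {m p σ α β ε Λ : ℝ} {u z : ℝ → ℝ} (hm : 1 < m)
    (hβ : 0 < β) (hε : 0 < ε)
    (h : IsCutSolution m p σ α β ε Λ u z) (hu : ∀ t ∈ Icc (0 : ℝ) 1, 2 * ε ≤ u t) {η : ℝ}
    (hη : η ∈ Ioo (0 : ℝ) 1) (huη : u η = 2 * ε) :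
    Λ * η ^ σ ≤ α * (2 * ε) ^ ((1 - p) / m) ∧ |z η| ≤ β * (2 * ε) ^ (1 / m) := by
  have hη' := Ioo_subset_Icc_self hη
  have hφη : cutProfile m ε (u η) = (2 * ε) ^ (1 / m) := by
    rw [huη, cutProfile_of_le (by linarith)]
  have hφ := cutProfile_pos (m := m) (u := u η) hε
  have hmin : IsLocalMin u η := by
    filter_upwards [Icc_mem_nhds hη.1 hη.2] with s hs
    rw [huη]; exact hu s hs
  have hu' := hmin.hasDerivAt_eq_zero (h.hasDerivAt_u η hη')
  constructor
  · have hV := h.hasDerivAt_deriv hm hε hη' (by linarith)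
    rw [hu'] at hV
    simp only [mul_zero, zero_div, sub_zero] at hV
    have hV0 : 0 ≤ α * cutProfile m ε (u η) - Λ * η ^ σ * cutProfile m ε (u η) ^ p := by
      by_contra hcon
      have hev := eventually_lt_of_hasDerivAt_neg hV (not_le.1 hcon)
      rw [hu'] at hev
      obtain ⟨b, hb, hbV⟩ := (mem_nhdsGT_iff_exists_Ioo_subset.1
        (inter_mem hev (Ioo_mem_nhdsGT hη.2)))
      have hηb : η < b := hb
      set c := (η + b) / 2 with hc
      have hcb : c < b := by linarith
      have hηc : η < c := by linarith
      have hmem : ∀ x ∈ Ioc η c, x ∈ Icc (0 : ℝ) 1 := fun x hx =>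
        ⟨hη.1.le.trans hx.1.le, (hbV ⟨hx.1, hx.2.trans_lt hcb⟩).2.2.le⟩
      have := strictAntiOn_of_deriv_neg (convex_Icc η c) (f := u)
        (h.continuousOn_u.mono (Icc_subset_Icc hη.1.le (hmem c ⟨hηc, le_rfl⟩).2)) (fun x hx => by
          rw [interior_Icc] at hx
          rw [(h.hasDerivAt_u x (hmem x ⟨hx.1, hx.2.le⟩)).deriv]
          exact (hbV ⟨hx.1, hx.2.trans hcb⟩).1)
      have h1 := this ⟨le_rfl, hηc.le⟩ ⟨hηc.le, le_rfl⟩ hηc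
      have h2 := hu c (hmem c ⟨hηc, le_rfl⟩)
      linarith
    have e1 : (2 * ε) ^ ((1 - p) / m) = cutProfile m ε (u η) ^ (1 - p) := by
      rw [hφη, ← Real.rpow_mul (by linarith), one_div_mul_eq_div]
    rw [e1]
    set φ := cutProfile m ε (u η)
    have e2 : φ = φ ^ (1 - p) * φ ^ p := by
      rw [← Real.rpow_add hφ, sub_add_cancel, Real.rpow_one]
    have e3 : 0 < φ ^ p := Real.rpow_pos_of_pos hφ _
    have e4 : α * φ = α * φ ^ (1 - p) * φ ^ p := by rw [mul_assoc, ← e2]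
    exact le_of_mul_le_mul_right (by linarith) e3
  · have hz : z η = β * η * cutProfile m ε (u η) := by linarith
    have h1 : 0 ≤ β * η * cutProfile m ε (u η) := by have := hη.1; positivity
    rw [hz, abs_of_nonneg h1, hφη]
    rw [hφη] at hφ
    have : β * η ≤ β * 1 := by gcongr; exact hη.2.le
    nlinarith

/-- The shooting argument at a fixed truncation level. -/
lemma exists_shooting {m p σ α β ε Λ₁ Λ₂ : ℝ} (hm : 1 < m) (hp0 : 0 < p) (hp1 : p < 1)
    (hσ : 0 < σ) (hα : 0 < α) (hβ : 0 < β) (hε : 0 < ε) (hε1 : ε ≤ 1) (hΛ₁ : 0 < Λ₁)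
    (hΛ : Λ₁ ≤ Λ₂)
    (h₁ : ∀ u z : ℝ → ℝ, IsCutSolution m p σ α β ε Λ₁ u z →
      (∀ t ∈ Icc (0 : ℝ) 1, 2 * ε ≤ u t) ∧ z 0 ≤ 0)
    (h₂ : ∀ u z : ℝ → ℝ, IsCutSolution m p σ α β ε Λ₂ u z → ¬ ∀ t ∈ Icc (0 : ℝ) 1, 2 * ε ≤ u t) :
    ∃ Λ ∈ Icc Λ₁ Λ₂, ∃ u z : ℝ → ℝ, IsCutSolution m p σ α β ε Λ u z ∧
      (∀ t ∈ Icc (0 : ℝ) 1, 2 * ε ≤ u t) ∧ ∃ η ∈ Icc (0 : ℝ) 1,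
        Λ₁ * η ^ σ ≤ α * (2 * ε) ^ ((1 - p) / m) ∧ |z η| ≤ β * (2 * ε) ^ (1 / m) := by
  have hN : 0 ≤ Λ₂ := hΛ₁.le.trans hΛ
  obtain ⟨U, Z, hUZ, hUc, hZc⟩ := exists_continuous_cutSolution (N := Λ₂) hm hp0 hp1 hσ hα hβ hε hε1
    hN
  obtain ⟨δ, hδ, hlay⟩ := exists_boundary_layer hm hp0 hp1 hσ hα hβ hε hε1 hN
  have hsub : Icc Λ₁ Λ₂ ⊆ Icc 0 Λ₂ := Icc_subset_Icc_left hΛ₁.le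
  let a : ℝ → ℝ := fun Λ => projIcc Λ₁ Λ₂ hΛ Λ
  let b : ℝ → ℝ := fun t => projIcc (0 : ℝ) 1 zero_le_one t
  have ha : ∀ Λ ∈ Icc Λ₁ Λ₂, a Λ = Λ := fun Λ hΛ' => by simp only [a, projIcc_of_mem hΛ hΛ']
  have hb : ∀ t ∈ Icc (0 : ℝ) 1, b t = t := fun t ht => by
    simp only [b, projIcc_of_mem zero_le_one ht]
  have hac : Continuous a := continuous_subtype_val.comp continuous_projIcc
  have hbc : Continuous b := continuous_subtype_val.comp continuous_projIcc
  have hmaps : ∀ x : ℝ × ℝ, (a x.1, b x.2) ∈ Icc 0 Λ₂ ×ˢ Icc (0 : ℝ) 1 := fun x =>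
    ⟨hsub (projIcc Λ₁ Λ₂ hΛ x.1).2, (projIcc (0 : ℝ) 1 zero_le_one x.2).2⟩
  have hU : Continuous fun x : ℝ × ℝ => U (a x.1) (b x.2) :=
    hUc.comp_continuous ((hac.comp continuous_fst).prodMk (hbc.comp continuous_snd)) hmaps
  have hZ : Continuous fun x : ℝ × ℝ => Z (a x.1) (b x.2) :=
    hZc.comp_continuous ((hac.comp continuous_fst).prodMk (hbc.comp continuous_snd)) hmaps
  let S : Set ℝ := Icc Λ₁ Λ₂ ∩ ({Λ | ∀ t, 2 * ε ≤ U (a Λ) (b t)} ∩ {Λ | Z (a Λ) (b 0) ≤ 0})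
  have hScl : IsClosed S := by
    refine isClosed_Icc.inter (IsClosed.inter ?_ ?_)
    · rw [ofPred_forall]
      exact isClosed_iInter fun t => isClosed_le continuous_const
        (hU.comp (continuous_id.prodMk continuous_const))
    · exact isClosed_le (hZ.comp (continuous_id.prodMk continuous_const)) continuous_const
  have h0 : (0 : ℝ) ∈ Icc (0 : ℝ) 1 := left_mem_Icc.2 zero_le_one
  have hSne : S.Nonempty := by
    have hmem : Λ₁ ∈ Icc Λ₁ Λ₂ := left_mem_Icc.2 hΛ
    obtain ⟨h3, h4⟩ := h₁ _ _ (hUZ Λ₁ (hsub hmem))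
    refine ⟨Λ₁, hmem, fun t => ?_, ?_⟩
    · rw [ha _ hmem]; exact h3 _ (projIcc (0 : ℝ) 1 zero_le_one t).2
    · show Z (a Λ₁) (b 0) ≤ 0
      rw [ha _ hmem, hb _ h0]; exact h4
  have hSbd : BddAbove S := ⟨Λ₂, fun x hx => hx.1.2⟩
  have hmem : sSup S ∈ S := hScl.csSup_mem hSne hSbd
  set Λ := sSup S with hΛdef
  obtain ⟨hΛI, hΛu, hΛz⟩ := hmem
  have hsol := hUZ Λ (hsub hΛI)
  have hu : ∀ t ∈ Icc (0 : ℝ) 1, 2 * ε ≤ U Λ t := fun t ht => by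
    have := hΛu t; rwa [ha _ hΛI, hb _ ht] at this
  have hz : Z Λ 0 ≤ 0 := by
    have : Z (a Λ) (b 0) ≤ 0 := hΛz
    rwa [ha _ hΛI, hb _ h0] at this
  have hlt : Λ < Λ₂ := by
    refine lt_of_le_of_ne hΛI.2 fun heq => ?_
    rw [heq] at hsol hu
    exact h₂ _ _ hsol hu
  have hcase : Z Λ 0 = 0 ∨ ∃ t ∈ Icc 0 (1 - δ), U Λ t = 2 * ε := by
    by_contra! hcon
    obtain ⟨hc1, hc2⟩ := hcon
    have e1 : ∀ᶠ x in 𝓝 Λ, ∀ t ∈ Icc 0 (1 - δ), 2 * ε < U (a x) (b t) := by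
      refine isCompact_Icc.eventually_forall_of_forall_eventually fun t ht => ?_
      refine hU.continuousAt.eventually (lt_mem_nhds ?_)
      have ht' : t ∈ Icc (0 : ℝ) 1 := ⟨ht.1, by linarith [ht.2, hδ.1]⟩
      show 2 * ε < U (a Λ) (b t)
      rw [ha _ hΛI, hb _ ht']
      exact lt_of_le_of_ne (hu t ht') (hc2 t ht).symm
    have e2 : ∀ᶠ x in 𝓝 Λ, Z (a x) (b 0) < 0 := by
      refine (hZ.comp (continuous_id.prodMk continuous_const)).continuousAt.eventually
        (gt_mem_nhds ?_)
      show Z (a Λ) (b 0) < 0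
      rw [ha _ hΛI, hb _ h0]
      exact lt_of_le_of_ne hz hc1
    obtain ⟨x, ⟨hx1, hx2⟩, hx3⟩ := (((e1.and e2).filter_mono nhdsWithin_le_nhds).and
      (Ioo_mem_nhdsGT hlt)).exists
    have hxI : x ∈ Icc Λ₁ Λ₂ := ⟨hΛI.1.trans hx3.1.le, hx3.2.le⟩
    have hxS : x ∈ S := by
      refine ⟨hxI, fun t => ?_, hx2.le⟩
      have hbt : b t ∈ Icc (0 : ℝ) 1 := (projIcc (0 : ℝ) 1 zero_le_one t).2
      rcases le_total (b t) (1 - δ) with h | h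
      · have := hx1 (b t) ⟨hbt.1, h⟩
        rw [hb _ hbt] at this
        exact this.le
      · rw [ha _ hxI]
        exact hlay x (hsub hxI) _ _ (hUZ x (hsub hxI)) _ ⟨h, hbt.2⟩
    exact absurd (le_csSup hSbd hxS) (not_le.2 hx3.1)
  refine ⟨Λ, hΛI, U Λ, Z Λ, hsol, hu, ?_⟩
  have hzero : Z Λ 0 = 0 → ∃ η ∈ Icc (0 : ℝ) 1,
      Λ₁ * η ^ σ ≤ α * (2 * ε) ^ ((1 - p) / m) ∧ |Z Λ η| ≤ β * (2 * ε) ^ (1 / m) := by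
    intro h
    refine ⟨0, h0, ?_, ?_⟩
    · rw [Real.zero_rpow hσ.ne', mul_zero]; positivity
    · rw [h, abs_zero]; positivity
  rcases hcase with h | ⟨t, ht, h⟩
  · exact hzero h
  · rcases ht.1.eq_or_lt with h3 | h3
    · refine hzero (le_antisymm hz ?_)
      by_contra hcon
      have hder := hsol.hasDerivAt_u 0 h0
      rw [mul_zero, zero_mul, sub_zero] at hder
      obtain ⟨s, hs1, hs2⟩ := ((eventually_lt_of_hasDerivAt_neg hder (not_le.1 hcon)).and
        (Ioo_mem_nhdsGT zero_lt_one)).exists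
      have := hu s (Ioo_subset_Icc_self hs2)
      rw [h3, h] at hs1
      linarith
    · have ht' : t ∈ Ioo (0 : ℝ) 1 := ⟨h3, by linarith [ht.2, hδ.1]⟩
      obtain ⟨h4, h5⟩ := hsol.touching_estimate (α := α) (p := p) (σ := σ) hm hβ hε hu ht' h
      refine ⟨t, Ioo_subset_Icc_self ht', le_trans ?_ h4, h5⟩
      exact mul_le_mul_of_nonneg_right hΛI.1 (Real.rpow_nonneg ht.1 _)

lemma hasDerivWithinAt_of_tendsto_of_bounded {w w' : ℕ → ℝ → ℝ} {v g : ℝ → ℝ} {M : ℝ}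
    (hd : ∀ n, ∀ t ∈ Icc (0 : ℝ) 1, HasDerivAt (w n) (w' n t) t)
    (hc : ∀ n, ContinuousOn (w' n) (Icc 0 1)) (hb : ∀ n, ∀ t ∈ Icc (0 : ℝ) 1, |w' n t| ≤ M)
    (hv : ∀ t ∈ Icc (0 : ℝ) 1, Tendsto (fun n => w n t) atTop (𝓝 (v t)))
    (hg : ∀ t ∈ Icc (0 : ℝ) 1, Tendsto (fun n => w' n t) atTop (𝓝 (g t)))
    (hgc : ContinuousOn g (Icc 0 1)) :
    ∀ t ∈ Icc (0 : ℝ) 1, HasDerivWithinAt v (g t) (Icc 0 1) t := by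
  have hG : Continuous (IccExtend (zero_le_one' ℝ) ((Icc (0 : ℝ) 1).domRestrict g)) :=
    (continuousOn_iff_continuous_domRestrict.1 hgc).Icc_extend'
  set G := IccExtend (zero_le_one' ℝ) ((Icc (0 : ℝ) 1).domRestrict g) with hGdef
  have hGg : ∀ t ∈ Icc (0 : ℝ) 1, G t = g t := fun t ht => by
    rw [hGdef, IccExtend_of_mem _ _ ht]; rfl
  have hint : ∀ t ∈ Icc (0 : ℝ) 1, v t = v 0 + ∫ s in (0 : ℝ)..t, G s := by
    intro t ht
    have hsub : uIcc 0 t ⊆ Icc (0 : ℝ) 1 := by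
      rw [uIcc_of_le ht.1]; exact Icc_subset_Icc_right ht.2
    have hsub' : uIoc 0 t ⊆ Icc (0 : ℝ) 1 := uIoc_subset_uIcc.trans hsub
    have h1 : ∀ n, ∫ s in (0 : ℝ)..t, w' n s = w n t - w n 0 := fun n =>
      intervalIntegral.integral_eq_sub_of_hasDerivAt (fun x hx => hd n x (hsub hx))
        ((hc n).mono hsub).intervalIntegrable
    have h2 : Tendsto (fun n => ∫ s in (0 : ℝ)..t, w' n s) atTop (𝓝 (∫ s in (0 : ℝ)..t, G s)) := by
      refine intervalIntegral.tendsto_integral_filter_of_dominated_convergence (fun _ => M) ?_ ?_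
        intervalIntegrable_const ?_
      · exact Eventually.of_forall fun n =>
          ((hc n).mono hsub').aestronglyMeasurable measurableSet_uIoc
      · exact Eventually.of_forall fun n => Eventually.of_forall fun x hx => hb n x (hsub' hx)
      · refine Eventually.of_forall fun x hx => ?_
        rw [hGg x (hsub' hx)]
        exact hg x (hsub' hx)
    simp only [h1] at h2
    have h3 := tendsto_nhds_unique h2 ((hv t ht).sub (hv 0 (left_mem_Icc.2 zero_le_one)))
    linarith
  intro t ht
  rw [← hGg t ht]
  have h4 : HasDerivAt (fun t => v 0 + ∫ s in (0 : ℝ)..t, G s) (G t) t :=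
    (hG.integral_hasStrictDerivAt 0 t).hasDerivAt.const_add _
  exact h4.hasDerivWithinAt.congr hint (hint t ht)

open scoped NNReal BoundedContinuousFunction in
lemma exists_subseq_tendsto_of_lipschitz {w : ℕ → ℝ → ℝ × ℝ} {M : ℝ} {K : ℝ≥0}
    (hb : ∀ n, ∀ t ∈ Icc (0 : ℝ) 1, ‖w n t‖ ≤ M)
    (hL : ∀ n, LipschitzOnWith K (w n) (Icc 0 1)) :
    ∃ φ : ℕ → ℕ, StrictMono φ ∧ ∃ v : ℝ → ℝ × ℝ, Continuous v ∧
      ∀ t ∈ Icc (0 : ℝ) 1, Tendsto (fun n => w (φ n) t) atTop (𝓝 (v t)) := by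
  let W : ℕ → (Icc (0 : ℝ) 1 →ᵇ ℝ × ℝ) := fun n =>
    BoundedContinuousFunction.mkOfCompact ⟨(Icc (0 : ℝ) 1).domRestrict (w n),
      continuousOn_iff_continuous_domRestrict.1 (hL n).continuousOn⟩
  have hcomp : IsCompact (closure (range W)) := by
    refine BoundedContinuousFunction.arzela_ascoli (Metric.closedBall 0 M)
      (isCompact_closedBall 0 M) _ ?_ ?_
    · rintro f x ⟨n, rfl⟩
      rw [mem_closedBall_zero_iff]
      exact hb n x x.2
    · refine (LipschitzWith.uniformEquicontinuous _ K ?_).equicontinuous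
      rintro ⟨f, n, rfl⟩
      exact (hL n).to_restrict
  obtain ⟨V, -, φ, hφ, hV⟩ := hcomp.tendsto_subseq (x := W) fun n => subset_closure ⟨n, rfl⟩
  refine ⟨φ, hφ, fun t => V (projIcc 0 1 zero_le_one t), V.continuous.comp continuous_projIcc,
    fun t ht => ?_⟩
  simp only [projIcc_of_mem _ ht]
  have := ((continuous_eval_const (⟨t, ht⟩ : Icc (0 : ℝ) 1)).tendsto V).comp hV
  exact this

/-- A solution on `[0, 1]` of the untruncated system for `u = f ^ m` and `z = (f ^ m)' + β t f`,
with vanishing flux at both endpoints and an interface at `1`. -/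
structure IsLimitSolution (m p σ α β Λ : ℝ) (u z : ℝ → ℝ) : Prop where
  hasDerivWithinAt_u : ∀ t ∈ Icc (0 : ℝ) 1,
    HasDerivWithinAt u (z t - β * t * u t ^ (1 / m)) (Icc 0 1) t
  hasDerivWithinAt_z : ∀ t ∈ Icc (0 : ℝ) 1, HasDerivWithinAt z
    ((α + β) * u t ^ (1 / m) - Λ * t ^ σ * (u t ^ (1 / m)) ^ p) (Icc 0 1) t
  u_nonneg : ∀ t ∈ Icc (0 : ℝ) 1, 0 ≤ u t
  u_one : u 1 = 0
  z_one : z 1 = 0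
  z_zero : z 0 = 0

lemma exists_limitSolution {m p σ α β : ℝ} (hm : 1 < m) (hp0 : 0 < p) (hp1 : p < 1)
    (hmp : 2 < m + p) (hσ : 2 * (1 - p) / (m - 1) < σ) (hα : 0 < α) (hβ : 0 < β) :
    ∃ Λ : ℝ, 0 < Λ ∧ ∃ u z : ℝ → ℝ, IsLimitSolution m p σ α β Λ u z ∧
      ∃ δ ∈ Ioo (0 : ℝ) (1 / 2), ∃ c > 0, ∀ t ∈ Icc (1 - δ) 1,
        z t ≤ β / 2 * t * u t ^ (1 / m) ∧ c * (1 - t) ≤ (u t ^ (1 / m)) ^ (m - 1) := by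
  have hm0 : 0 < m := by linarith
  have hσ0 : 0 < σ := lt_trans (div_pos (by linarith) (by linarith)) hσ
  obtain ⟨Λ₁, hΛ₁, h₁⟩ := exists_small_reaction hm hp1 hmp hσ hα hβ
  obtain ⟨Λ₂, hΛ, h₂⟩ := exists_large_reaction (p := p) hm hp0 hp1 hσ0 hα hβ hΛ₁
  have hN : 0 ≤ Λ₂ := hΛ₁.le.trans hΛ
  obtain ⟨δ, hδ, c, hc, ε₀, hε₀, hint⟩ :=
    exists_interface_estimate (N := Λ₂) hm hp0 hp1 hmp hσ0 hα hβ hN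
  obtain ⟨M, hM, hMb⟩ := IsCutSolution.exists_bound (σ := σ) hm hp0 hp1 hσ0 hα hβ hN
  set ε : ℕ → ℝ := fun n => min ε₀ (1 / 4) * (1 / ((n : ℝ) + 1)) with hε
  have hmin : 0 < min ε₀ (1 / 4) := lt_min hε₀.1 (by norm_num)
  have hε0 : ∀ n, 0 < ε n := fun n => mul_pos hmin (by positivity)
  have hεm : ∀ n, ε n ≤ min ε₀ (1 / 4) := fun n => by
    refine mul_le_of_le_one_right hmin.le ?_
    rw [div_le_one (by positivity)]
    linarith [n.cast_nonneg (α := ℝ)]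
  have hε1 : ∀ n, ε n ≤ 1 / 4 := fun n => (hεm n).trans (min_le_right _ _)
  have hεlim : Tendsto ε atTop (𝓝 0) := by
    have := (tendsto_one_div_add_atTop_nhds_zero_nat (𝕜 := ℝ)).const_mul (min ε₀ (1 / 4))
    rwa [mul_zero] at this
  have hshoot := fun n => exists_shooting (ε := ε n) hm hp0 hp1 hσ0 hα hβ (hε0 n)
    (by linarith [hε1 n]) hΛ₁ hΛ (h₁ (ε n) (hε0 n)) (h₂ (ε n) (hε0 n) (by linarith [hε1 n]))
  choose L hL u z hsol hu η hη hησ hzη using hshoot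
  have hL0 : ∀ n, L n ∈ Icc 0 Λ₂ := fun n => ⟨hΛ₁.le.trans (hL n).1, (hL n).2⟩
  have hb := fun n => hMb (ε n) (L n) (hε0 n) (by linarith [hε1 n]) (hL0 n) _ _ (hsol n)
  have hφeq : ∀ n, ∀ t ∈ Icc (0 : ℝ) 1, cutProfile m (ε n) (u n t) = u n t ^ (1 / m) :=
    fun n t ht => cutProfile_of_le (by linarith [hε0 n, hu n t ht])
  have hlipu : ∀ n, LipschitzOnWith M.toNNReal (u n) (Icc 0 1) := fun n =>
    (convex_Icc _ _).lipschitzOnWith_of_nnnorm_hasDerivWithin_le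
      (fun t ht => ((hsol n).hasDerivAt_u t ht).hasDerivWithinAt) fun t ht => by
        rw [← NNReal.coe_le_coe, coe_nnnorm, Real.coe_toNNReal _ hM.le]; exact (hb n t ht).2.2.1
  have hlipz : ∀ n, LipschitzOnWith M.toNNReal (z n) (Icc 0 1) := fun n =>
    (convex_Icc _ _).lipschitzOnWith_of_nnnorm_hasDerivWithin_le
      (fun t ht => ((hsol n).hasDerivAt_z t ht).hasDerivWithinAt) fun t ht => by
        rw [← NNReal.coe_le_coe, coe_nnnorm, Real.coe_toNNReal _ hM.le]; exact (hb n t ht).2.2.2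
  obtain ⟨Λ, hΛI, φ₁, hφ₁, hΛlim⟩ := isCompact_Icc.tendsto_subseq hL
  obtain ⟨φ₂, hφ₂, v, hv, hvlim⟩ := exists_subseq_tendsto_of_lipschitz
    (w := fun n t => (u (φ₁ n) t, z (φ₁ n) t)) (M := M) (K := max M.toNNReal M.toNNReal)
    (fun n t ht => max_le (hb _ t ht).1 (hb _ t ht).2.1)
    (fun n => (hlipu _).prodMk (hlipz _))
  set φ := φ₁ ∘ φ₂ with hφ
  have hφt : Tendsto φ atTop atTop := (hφ₁.comp hφ₂).tendsto_atTop
  have hLlim : Tendsto (fun n => L (φ n)) atTop (𝓝 Λ) := hΛlim.comp hφ₂.tendsto_atTop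
  have hεφ : Tendsto (fun n => ε (φ n)) atTop (𝓝 0) := hεlim.comp hφt
  have hulim : ∀ t ∈ Icc (0 : ℝ) 1, Tendsto (fun n => u (φ n) t) atTop (𝓝 (v t).1) :=
    fun t ht => (continuous_fst.tendsto _).comp (hvlim t ht)
  have hzlim : ∀ t ∈ Icc (0 : ℝ) 1, Tendsto (fun n => z (φ n) t) atTop (𝓝 (v t).2) :=
    fun t ht => (continuous_snd.tendsto _).comp (hvlim t ht)
  have hφlim : ∀ t ∈ Icc (0 : ℝ) 1, Tendsto (fun n => cutProfile m (ε (φ n)) (u (φ n) t)) atTop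
      (𝓝 ((v t).1 ^ (1 / m))) := fun t ht => by
    simp only [hφeq _ t ht]
    exact (hulim t ht).rpow_const (Or.inr (by positivity))
  have hvφ : Continuous fun t => (v t).1 ^ (1 / m) :=
    (continuous_fst.comp hv).rpow_const fun t => Or.inr (by positivity)
  have hcut : ∀ n, ContinuousOn (fun t => cutProfile m (ε n) (u n t)) (Icc 0 1) := fun n =>
    (continuous_cutProfile hm).comp_continuousOn (hsol n).continuousOn_u
  have h0 : (0 : ℝ) ∈ Icc (0 : ℝ) 1 := left_mem_Icc.2 zero_le_one
  have h1 : (1 : ℝ) ∈ Icc (0 : ℝ) 1 := right_mem_Icc.2 zero_le_one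
  refine ⟨Λ, hΛ₁.trans_le hΛI.1, fun t => (v t).1, fun t => (v t).2, ⟨?_, ?_, ?_, ?_, ?_, ?_⟩,
    δ, hδ, c, hc, fun t ht => ⟨?_, ?_⟩⟩
  · exact hasDerivWithinAt_of_tendsto_of_bounded
      (fun n t ht => (hsol (φ n)).hasDerivAt_u t ht)
      (fun n => (hsol _).continuousOn_z.sub ((continuousOn_const.mul continuousOn_id).mul (hcut _)))
      (fun n t ht => (hb (φ n) t ht).2.2.1) hulim
      (fun t ht => (hzlim t ht).sub ((hφlim t ht).const_mul _))
      (Continuous.continuousOn (by fun_prop))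
  · exact hasDerivWithinAt_of_tendsto_of_bounded
      (fun n t ht => (hsol (φ n)).hasDerivAt_z t ht)
      (fun n => (continuousOn_const.mul (hcut _)).sub ((continuousOn_const.mul
        (Real.continuous_rpow_const hσ0.le).continuousOn).mul
        ((hcut _).rpow_const fun _ _ => Or.inr hp0.le)))
      (fun n t ht => (hb (φ n) t ht).2.2.2) hzlim
      (fun t ht => ((hφlim t ht).const_mul _).sub ((hLlim.mul_const _).mul
        ((hφlim t ht).rpow_const (Or.inr hp0.le))))
      (Continuous.continuousOn ((continuous_const.mul hvφ).sub ((continuous_const.mul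
        (Real.continuous_rpow_const hσ0.le)).mul (hvφ.rpow_const fun _ => Or.inr hp0.le))))
  · exact fun t ht => ge_of_tendsto' (hulim t ht) fun n => by linarith [hu (φ n) t ht, hε0 (φ n)]
  · refine tendsto_nhds_unique (hulim 1 h1) ?_
    simp only [fun n => (hsol n).u_one]
    simpa using hεφ.const_mul 2
  · refine tendsto_nhds_unique (hzlim 1 h1) ?_
    simp only [fun n => (hsol n).z_one]
    exact tendsto_const_nhds
  · refine tendsto_nhds_unique (hzlim 0 h0) ?_
    have hpow : ∀ r : ℝ, 0 < r → Tendsto (fun n => (2 * ε (φ n)) ^ r) atTop (𝓝 0) := by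
      intro r hr
      have := (hεφ.const_mul 2).rpow_const (p := r) (Or.inr hr.le)
      rwa [mul_zero, Real.zero_rpow hr.ne'] at this
    have hηlim : Tendsto (fun n => η (φ n)) atTop (𝓝 0) := by
      have e1 : Tendsto (fun n => (α * (2 * ε (φ n)) ^ ((1 - p) / m) / Λ₁) ^ σ⁻¹) atTop (𝓝 0) := by
        have := (((hpow ((1 - p) / m) (div_pos (by linarith) hm0)).const_mul α).div_const
          Λ₁).rpow_const (p := σ⁻¹) (Or.inr (by positivity))
        rwa [mul_zero, zero_div, Real.zero_rpow (by positivity)] at this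
      refine squeeze_zero (fun n => (hη _).1) (fun n => ?_) e1
      rw [Real.le_rpow_inv_iff_of_pos (hη _).1 (by have := hε0 (φ n); positivity) hσ0,
        le_div_iff₀ hΛ₁, mul_comm]
      exact hησ _
    have hbound : Tendsto (fun n => β * (2 * ε (φ n)) ^ (1 / m) + M * η (φ n)) atTop (𝓝 0) := by
      simpa using ((hpow (1 / m) (by positivity)).const_mul β).add (hηlim.const_mul M)
    refine squeeze_zero_norm (fun n => ?_) hbound
    have e2 := (hlipz (φ n)).dist_le_mul 0 h0 _ (hη (φ n))
    rw [Real.coe_toNNReal _ hM.le, Real.dist_eq, Real.dist_eq, zero_sub, abs_neg,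
      abs_of_nonneg (hη (φ n)).1] at e2
    rw [Real.norm_eq_abs]
    calc |z (φ n) 0| = |z (φ n) (η (φ n)) + (z (φ n) 0 - z (φ n) (η (φ n)))| := by ring_nf
      _ ≤ _ := (abs_add_le _ _).trans (add_le_add (hzη _) e2)
  · have ht' : t ∈ Icc (0 : ℝ) 1 := ⟨by linarith [ht.1, hδ.2], ht.2⟩
    exact le_of_tendsto_of_tendsto' (hzlim t ht') ((hφlim t ht').const_mul (β / 2 * t)) fun n =>
      (hint _ ⟨hε0 _, (hεm _).trans (min_le_left _ _)⟩ _ (hL0 _) _ _ (hsol (φ n)) t ht).1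
  · have ht' : t ∈ Icc (0 : ℝ) 1 := ⟨by linarith [ht.1, hδ.2], ht.2⟩
    exact ge_of_tendsto' ((hφlim t ht').rpow_const (Or.inr (by linarith))) fun n =>
      (hint _ ⟨hε0 _, (hεm _).trans (min_le_left _ _)⟩ _ (hL0 _) _ _ (hsol (φ n)) t ht).2

lemma IsLimitSolution.hasDerivAt_u {m p σ α β Λ : ℝ} {u z : ℝ → ℝ}
    (h : IsLimitSolution m p σ α β Λ u z) {t : ℝ} (ht : t ∈ Ioo (0 : ℝ) 1) :
    HasDerivAt u (z t - β * t * u t ^ (1 / m)) t :=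
  (h.hasDerivWithinAt_u t (Ioo_subset_Icc_self ht)).hasDerivAt (Icc_mem_nhds ht.1 ht.2)

lemma IsLimitSolution.hasDerivAt_z {m p σ α β Λ : ℝ} {u z : ℝ → ℝ}
    (h : IsLimitSolution m p σ α β Λ u z) {t : ℝ} (ht : t ∈ Ioo (0 : ℝ) 1) :
    HasDerivAt z ((α + β) * u t ^ (1 / m) - Λ * t ^ σ * (u t ^ (1 / m)) ^ p) t :=
  (h.hasDerivWithinAt_z t (Ioo_subset_Icc_self ht)).hasDerivAt (Icc_mem_nhds ht.1 ht.2)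

lemma IsLimitSolution.continuousOn_u {m p σ α β Λ : ℝ} {u z : ℝ → ℝ}
    (h : IsLimitSolution m p σ α β Λ u z) : ContinuousOn u (Icc 0 1) :=
  fun t ht => (h.hasDerivWithinAt_u t ht).continuousWithinAt

lemma IsLimitSolution.continuousOn_z {m p σ α β Λ : ℝ} {u z : ℝ → ℝ}
    (h : IsLimitSolution m p σ α β Λ u z) : ContinuousOn z (Icc 0 1) :=
  fun t ht => (h.hasDerivWithinAt_z t ht).continuousWithinAt

lemma IsLimitSolution.pos_near_one {m p σ α β Λ : ℝ} {u z : ℝ → ℝ}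
    (h : IsLimitSolution m p σ α β Λ u z) (hm : 1 < m) {δ c : ℝ} (hδ : δ ∈ Ioo (0 : ℝ) (1 / 2))
    (hc : 0 < c) (hest : ∀ t ∈ Icc (1 - δ) 1, c * (1 - t) ≤ (u t ^ (1 / m)) ^ (m - 1)) :
    ∀ t ∈ Ico (1 - δ) 1, 0 < u t := by
  intro t ht
  refine lt_of_le_of_ne (h.u_nonneg t ⟨by linarith [ht.1, hδ.2], ht.2.le⟩) fun h0 => ?_
  have h1 := hest t (Ico_subset_Icc_self ht)
  rw [← h0, Real.zero_rpow (by have : 0 < m := by linarith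
                               positivity), Real.zero_rpow (by linarith)] at h1
  nlinarith [ht.2]

lemma IsLimitSolution.pos {m p σ α β Λ : ℝ} {u z : ℝ → ℝ}
    (h : IsLimitSolution m p σ α β Λ u z) (hm : 1 < m) (hp0 : 0 < p) (hp1 : p < 1) (hσ : 0 < σ)
    (hβ : 0 < β) (hΛ : 0 < Λ) {δ c : ℝ} (hδ : δ ∈ Ioo (0 : ℝ) (1 / 2))
    (hc : 0 < c) (hest : ∀ t ∈ Icc (1 - δ) 1, c * (1 - t) ≤ (u t ^ (1 / m)) ^ (m - 1)) :
    ∀ t ∈ Ioo (0 : ℝ) 1, 0 < u t := by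
  intro a ha
  refine lt_of_le_of_ne (h.u_nonneg a (Ioo_subset_Icc_self ha)) fun ha0 => ?_
  have hm0 : 0 < m := by linarith
  have hnear := h.pos_near_one hm hδ hc hest
  have haδ : a ≤ 1 - δ := by
    by_contra hcon
    have := hnear a ⟨(not_le.1 hcon).le, ha.2⟩
    linarith
  have hsub : Icc a (1 - δ) ⊆ Ioo (0 : ℝ) 1 := fun t ht =>
    ⟨ha.1.trans_le ht.1, by linarith [ht.2, hδ.1]⟩
  set S := Icc a (1 - δ) ∩ u ⁻¹' {0} with hS
  have hScl : IsClosed S := (h.continuousOn_u.mono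
    (hsub.trans Ioo_subset_Icc_self)).preimage_isClosed_of_isClosed isClosed_Icc isClosed_singleton
  have hSbd : BddAbove S := ⟨1 - δ, fun x hx => hx.1.2⟩
  have hmem : sSup S ∈ S := hScl.csSup_mem ⟨a, ⟨le_rfl, haδ⟩, ha0.symm⟩ hSbd
  set ξ := sSup S with hξ
  have hξI := hsub hmem.1
  have hξ0 : u ξ = 0 := hmem.2
  have hφ0 : u ξ ^ (1 / m) = 0 := by rw [hξ0, Real.zero_rpow (by positivity)]
  have hmin : IsLocalMin u ξ := by
    filter_upwards [Icc_mem_nhds hξI.1 hξI.2] with s hs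
    rw [hξ0]; exact h.u_nonneg s hs
  have hz0 : z ξ = 0 := by
    have := hmin.hasDerivAt_eq_zero (h.hasDerivAt_u hξI)
    rw [hφ0] at this
    linarith
  have hev : ∀ᶠ t in 𝓝 ξ, (α + β) * (u t ^ (1 / m)) ^ (1 - p) - Λ * t ^ σ < 0 := by
    have hcont : ContinuousAt (fun t => (α + β) * (u t ^ (1 / m)) ^ (1 - p) - Λ * t ^ σ) ξ := by
      have h1 := (h.hasDerivAt_u hξI).continuousAt
      exact (continuousAt_const.mul ((h1.rpow_const (Or.inr (by positivity))).rpow_const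
        (Or.inr (by linarith)))).sub (continuousAt_const.mul
        (continuousAt_id.rpow_const (Or.inr hσ.le)))
    refine hcont.eventually (gt_mem_nhds ?_)
    beta_reduce
    rw [hφ0, Real.zero_rpow (by linarith), mul_zero, zero_sub, neg_lt_zero]
    exact mul_pos hΛ (Real.rpow_pos_of_pos hξI.1 _)
  obtain ⟨b, hb, hbV⟩ := (mem_nhdsGT_iff_exists_Ioo_subset.1
    (inter_mem (mem_nhdsWithin_of_mem_nhds hev) (Ioo_mem_nhdsGT hξI.2)))
  have hξb : ξ < b := hb
  set d := (ξ + b) / 2 with hd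
  have hdb : d < b := by linarith
  have hξd : ξ < d := by linarith
  have hI : ∀ t ∈ Icc ξ d, t ∈ Ioo (0 : ℝ) 1 := fun t ht =>
    ⟨hξI.1.trans_le ht.1, ht.2.trans_lt (hbV ⟨hξd, hdb⟩).2.2⟩
  have hz : ∀ t ∈ Icc ξ d, z t ≤ 0 := by
    intro t ht
    have := image_sub_le_of_hasDerivAt_le (C := 0) ht.1
      (fun s hs => (h.hasDerivAt_z (hI s ⟨hs.1, hs.2.trans ht.2⟩)).continuousAt.continuousWithinAt)
      (fun s hs => h.hasDerivAt_z (hI s ⟨hs.1.le, hs.2.le.trans ht.2⟩)) (fun s hs => by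
        have h1 : (α + β) * (u s ^ (1 / m)) ^ (1 - p) - Λ * s ^ σ < 0 :=
          (hbV ⟨hs.1, hs.2.trans (ht.2.trans_lt hdb)⟩).1
        have h2 : 0 ≤ u s ^ (1 / m) := Real.rpow_nonneg
          (h.u_nonneg s (Ioo_subset_Icc_self (hI s ⟨hs.1.le, hs.2.le.trans ht.2⟩))) _
        have h3 : (u s ^ (1 / m)) = (u s ^ (1 / m)) ^ (1 - p) * (u s ^ (1 / m)) ^ p := by
          rw [← Real.rpow_add' h2 (by simp), sub_add_cancel, Real.rpow_one]
        set φ := u s ^ (1 / m)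
        have h4 : (α + β) * φ = (α + β) * φ ^ (1 - p) * φ ^ p := by rw [mul_assoc, ← h3]
        rw [h4, ← sub_mul]
        exact mul_nonpos_of_nonpos_of_nonneg h1.le (Real.rpow_nonneg h2 _))
    rw [hz0] at this
    linarith
  have hud := image_sub_le_of_hasDerivAt_le (C := 0) hξd.le
    (fun s hs => (h.hasDerivAt_u (hI s hs)).continuousAt.continuousWithinAt)
    (fun s hs => h.hasDerivAt_u (hI s (Ioo_subset_Icc_self hs))) (fun s hs => by
      have hs' := hI s (Ioo_subset_Icc_self hs)
      have h1 := hz s (Ioo_subset_Icc_self hs)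
      have h2 : 0 ≤ β * s * u s ^ (1 / m) := mul_nonneg (mul_nonneg hβ.le hs'.1.le)
        (Real.rpow_nonneg (h.u_nonneg s (Ioo_subset_Icc_self hs')) _)
      linarith)
  have hdI := hI d ⟨hξd.le, le_rfl⟩
  have hud0 : u d = 0 := le_antisymm (by linarith) (h.u_nonneg d (Ioo_subset_Icc_self hdI))
  have hdδ : d ≤ 1 - δ := by
    by_contra hcon
    have := hnear d ⟨(not_le.1 hcon).le, hdI.2⟩
    linarith
  exact absurd (le_csSup hSbd ⟨⟨hmem.1.1.trans hξd.le, hdδ⟩, hud0⟩) (not_le.2 hξd)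

lemma IsLimitSolution.tendsto_flux_div {m p σ α β Λ : ℝ} {u z : ℝ → ℝ}
    (h : IsLimitSolution m p σ α β Λ u z) (hm : 1 < m) (hp0 : 0 < p) (hmp : 2 < m + p)
    (hσ : 0 < σ) (hα : 0 < α) (hβ : 0 < β) (hΛ : 0 < Λ) {δ c : ℝ} (hδ : δ ∈ Ioo (0 : ℝ) (1 / 2))
    (hc : 0 < c) (hest : ∀ t ∈ Icc (1 - δ) 1, z t ≤ β / 2 * t * u t ^ (1 / m) ∧
      c * (1 - t) ≤ (u t ^ (1 / m)) ^ (m - 1)) :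
    Tendsto (fun t => z t / u t ^ (1 / m)) (𝓝[<] 1) (𝓝 0) := by
  have hm0 : 0 < m := by linarith
  have hpos := h.pos_near_one hm hδ hc fun t ht => (hest t ht).2
  have hI : ∀ t ∈ Icc (1 - δ) 1, t ∈ Icc (0 : ℝ) 1 := fun t ht => ⟨by linarith [ht.1, hδ.2], ht.2⟩
  have hmono : ∀ t ∈ Icc (1 - δ) 1, ∀ s ∈ Icc t 1, u s ≤ u t := by
    intro t ht s hs
    have := image_sub_le_of_hasDerivAt_le (C := 0) hs.1
      (h.continuousOn_u.mono (Icc_subset_Icc (hI t ht).1 hs.2))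
      (fun x hx => h.hasDerivAt_u ⟨by linarith [hx.1, (hI t ht).1], hx.2.trans_le hs.2⟩)
      (fun x hx => by
        have hx' : x ∈ Icc (1 - δ) 1 := ⟨ht.1.trans hx.1.le, hx.2.le.trans hs.2⟩
        have h1 := (hest x hx').1
        have h2 : 0 ≤ β / 2 * x * u x ^ (1 / m) := mul_nonneg
          (mul_nonneg (by positivity) (hI x hx').1) (Real.rpow_nonneg (h.u_nonneg x (hI x hx')) _)
        linarith)
    linarith
  have hzt : ∀ t ∈ Ico (1 - δ) 1, |z t| ≤
      ((α + β) * u t ^ (1 / m) + Λ * (u t ^ (1 / m)) ^ p) * (1 - t) := by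
    intro t ht
    have ht' := Ico_subset_Icc_self ht
    have hbd : ∀ x ∈ Ioo t 1, 0 ≤ (α + β) * u x ^ (1 / m) ∧
        (α + β) * u x ^ (1 / m) ≤ (α + β) * u t ^ (1 / m) ∧
        0 ≤ Λ * x ^ σ * (u x ^ (1 / m)) ^ p ∧
        Λ * x ^ σ * (u x ^ (1 / m)) ^ p ≤ Λ * (u t ^ (1 / m)) ^ p := by
      intro x hx
      have hx' : x ∈ Icc (1 - δ) 1 := ⟨ht.1.trans hx.1.le, hx.2.le⟩
      have hx0 := (hI x hx').1
      have hux := h.u_nonneg x (hI x hx')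
      have hle := hmono t ht' x ⟨hx.1.le, hx.2.le⟩
      have hφ : u x ^ (1 / m) ≤ u t ^ (1 / m) := Real.rpow_le_rpow hux hle (by positivity)
      refine ⟨by positivity, by gcongr, by positivity, ?_⟩
      calc Λ * x ^ σ * (u x ^ (1 / m)) ^ p ≤ Λ * 1 * (u t ^ (1 / m)) ^ p := by
            gcongr
            exact Real.rpow_le_one hx0 hx'.2 hσ.le
        _ = _ := by ring
    have hcont := h.continuousOn_z.mono (Icc_subset_Icc_left (hI t ht').1)
    have hder : ∀ x ∈ Ioo t 1, HasDerivAt z _ x := fun x hx =>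
      h.hasDerivAt_z ⟨by linarith [hx.1, (hI t ht').1], hx.2⟩
    have e1 := image_sub_le_of_hasDerivAt_le
      (C := (α + β) * u t ^ (1 / m) + Λ * (u t ^ (1 / m)) ^ p) ht.2.le hcont hder (fun x hx => by
        obtain ⟨a1, a2, a3, a4⟩ := hbd x hx
        linarith)
    have e2 := le_image_sub_of_le_hasDerivAt
      (C := -((α + β) * u t ^ (1 / m) + Λ * (u t ^ (1 / m)) ^ p)) ht.2.le hcont hder
      (fun x hx => by
        obtain ⟨a1, a2, a3, a4⟩ := hbd x hx
        linarith)
    rw [h.z_one] at e1 e2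
    rw [abs_le]
    constructor <;> linarith
  have hquot : ∀ t ∈ Ico (1 - δ) 1, ‖z t / u t ^ (1 / m)‖ ≤
      (α + β) * (1 - t) + Λ / c * (u t ^ (1 / m)) ^ (m + p - 2) := by
    intro t ht
    have hφ : 0 < u t ^ (1 / m) := Real.rpow_pos_of_pos (hpos t ht) _
    have h1 := hzt t ht
    have h2 := (hest t (Ico_subset_Icc_self ht)).2
    set φ := u t ^ (1 / m)
    have h3 : φ ^ (m - 1) * φ ^ p = φ ^ (m + p - 2) * φ := by
      rw [← Real.rpow_add hφ, ← Real.rpow_add_one hφ.ne']; congr 1; ring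
    have hφp : 0 < φ ^ p := Real.rpow_pos_of_pos hφ _
    have h4 : Λ * φ ^ p * (1 - t) ≤ Λ / c * φ ^ (m + p - 2) * φ := by
      calc Λ * φ ^ p * (1 - t) = Λ / c * φ ^ p * (c * (1 - t)) := by field_simp
        _ ≤ Λ / c * φ ^ p * φ ^ (m - 1) := by gcongr
        _ = _ := by rw [mul_assoc, mul_comm (φ ^ p), h3]; ring
    rw [Real.norm_eq_abs, abs_div, abs_of_pos hφ, div_le_iff₀ hφ]
    nlinarith
  have hulim : Tendsto u (𝓝[<] 1) (𝓝 0) := by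
    have := h.continuousOn_u 1 (right_mem_Icc.2 zero_le_one)
    rw [← h.u_one]
    refine tendsto_nhdsWithin_congr (fun _ _ => rfl) (this.mono_left ?_)
    rw [← nhdsWithin_Ico_eq_nhdsLT zero_lt_one]
    exact nhdsWithin_mono _ Ico_subset_Icc_self
  have hφlim : Tendsto (fun t => (u t ^ (1 / m)) ^ (m + p - 2)) (𝓝[<] 1) (𝓝 0) := by
    have := (hulim.rpow_const (p := 1 / m) (Or.inr (by positivity))).rpow_const (p := m + p - 2)
      (Or.inr (by linarith))
    rwa [Real.zero_rpow (by positivity), Real.zero_rpow (by linarith)] at this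
  have htlim : Tendsto (fun t : ℝ => 1 - t) (𝓝[<] 1) (𝓝 0) := by
    have : Tendsto (fun t : ℝ => 1 - t) (𝓝 1) (𝓝 (1 - 1)) := by
      exact (continuous_const.sub continuous_id).tendsto 1
    rw [sub_self] at this
    exact this.mono_left nhdsWithin_le_nhds
  refine squeeze_zero_norm' (a := fun t => (α + β) * (1 - t) + Λ / c * (u t ^ (1 / m)) ^ (m + p - 2))
    ?_ ?_
  · filter_upwards [Ico_mem_nhdsLT (show 1 - δ < 1 by linarith [hδ.1])] with t ht
    exact hquot t ht
  · simpa using (htlim.const_mul (α + β)).add (hφlim.const_mul (Λ / c))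

lemma IsLimitSolution.exists_interface_limit {m p σ α β Λ : ℝ} {u z : ℝ → ℝ}
    (h : IsLimitSolution m p σ α β Λ u z) (hm : 1 < m) (hp0 : 0 < p) (hmp : 2 < m + p)
    (hσ : 0 < σ) (hα : 0 < α) (hβ : 0 < β) (hΛ : 0 < Λ) {δ c : ℝ} (hδ : δ ∈ Ioo (0 : ℝ) (1 / 2))
    (hc : 0 < c) (hest : ∀ t ∈ Icc (1 - δ) 1, z t ≤ β / 2 * t * u t ^ (1 / m) ∧
      c * (1 - t) ≤ (u t ^ (1 / m)) ^ (m - 1)) :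
    ∃ L > 0, Tendsto (fun t => u t ^ (1 / m) * (1 - t) ^ (-(1 / (m - 1)))) (𝓝[<] 1) (𝓝 L) := by
  have hm0 : 0 < m := by linarith
  have hm1 : 0 < m - 1 := by linarith
  have hδ0 := hδ.1
  have hpos := h.pos_near_one hm hδ hc fun t ht => (hest t ht).2
  have hflux := h.tendsto_flux_div hm hp0 hmp hσ hα hβ hΛ hδ hc hest
  have hder : ∀ t ∈ Ioo (1 - δ) 1, HasDerivAt (fun t => u t ^ ((m - 1) / m))
      ((m - 1) / m * (z t / u t ^ (1 / m) - β * t)) t := by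
    intro t ht
    have hut := hpos t (Ioo_subset_Ico_self ht)
    refine ((h.hasDerivAt_u ⟨by linarith [ht.1, hδ.2], ht.2⟩).rpow_const
      (p := (m - 1) / m) (Or.inl hut.ne')).congr_deriv ?_
    have e1 : (m - 1) / m - 1 = -(1 / m) := by field_simp; ring
    have e2 : 0 < u t ^ (1 / m) := Real.rpow_pos_of_pos hut _
    rw [e1, Real.rpow_neg hut.le]
    field_simp
  have hs : Ioo (1 - δ) 1 ∈ 𝓝[<] (1 : ℝ) := Ioo_mem_nhdsLT (by linarith)
  have hK : HasDerivWithinAt (fun t => u t ^ ((m - 1) / m)) ((m - 1) / m * (0 - β * 1)) (Iic 1) 1 := by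
    refine hasDerivWithinAt_Iic_of_tendsto_deriv (s := Ioo (1 - δ) 1)
      (fun t ht => (hder t ht).differentiableAt.differentiableWithinAt) ?_ hs ?_
    · exact ((h.continuousOn_u 1 (right_mem_Icc.2 zero_le_one)).mono
        (fun t ht => ⟨by linarith [ht.1, hδ.2], ht.2.le⟩)).rpow_const (Or.inr (by positivity))
    · have hid : Tendsto (fun t : ℝ => t) (𝓝[<] 1) (𝓝 1) := tendsto_id.mono_left nhdsWithin_le_nhds
      refine ((hflux.sub (hid.const_mul β)).const_mul ((m - 1) / m)).congr' ?_
      filter_upwards [hs] with t ht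
      exact (hder t ht).deriv.symm
  rw [hasDerivWithinAt_iff_tendsto_slope, Iic_sdiff_right] at hK
  set K := (m - 1) / m * β with hKdef
  have hK0 : 0 < K := by positivity
  refine ⟨K ^ (1 / (m - 1)), by positivity, ?_⟩
  have hK' := hK.neg.rpow_const (p := 1 / (m - 1)) (Or.inr (by positivity))
  have e3 : -((m - 1) / m * (0 - β * 1)) = K := by rw [hKdef]; ring
  rw [e3] at hK'
  refine hK'.congr' ?_
  filter_upwards [hs] with t ht
  have hut := hpos t (Ioo_subset_Ico_self ht)
  have h1t : 0 < 1 - t := by linarith [ht.2]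
  have e4 : -slope (fun t => u t ^ ((m - 1) / m)) 1 t = u t ^ ((m - 1) / m) * (1 - t)⁻¹ := by
    rw [slope_def_field, h.u_one, Real.zero_rpow (by positivity), sub_zero, ← neg_sub 1 t, div_neg,
      neg_neg, div_eq_mul_inv]
  rw [e4, Real.mul_rpow (by positivity) (by positivity), ← Real.rpow_mul hut.le,
    Real.inv_rpow h1t.le, Real.rpow_neg h1t.le]
  congr 2
  field_simp

lemma contDiffOn_succ_of_hasDerivAt {f f' : ℝ → ℝ} {S : Set ℝ} {n : ℕ} (hS : IsOpen S)
    (hf : ∀ x ∈ S, HasDerivAt f (f' x) x) (hf' : ContDiffOn ℝ n f' S) :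
    ContDiffOn ℝ (n + 1) f S := by
  refine (contDiffOn_succ_iff_deriv_of_isOpen hS).2
    ⟨fun x hx => (hf x hx).differentiableAt.differentiableWithinAt, fun h => ?_,
      hf'.congr fun x hx => (hf x hx).deriv⟩
  exact absurd h (by simp)

lemma IsLimitSolution.contDiffOn_u {m p σ α β Λ : ℝ} {u z : ℝ → ℝ}
    (h : IsLimitSolution m p σ α β Λ u z) (hpos : ∀ t ∈ Ioo (0 : ℝ) 1, 0 < u t) :
    ContDiffOn ℝ 2 u (Ioo 0 1) := by
  have hφ0 : ∀ t ∈ Ioo (0 : ℝ) 1, u t ^ (1 / m) ≠ 0 := fun t ht =>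
    (Real.rpow_pos_of_pos (hpos t ht) _).ne'
  have hu0 : ∀ t ∈ Ioo (0 : ℝ) 1, u t ≠ 0 := fun t ht => (hpos t ht).ne'
  have step (n : ℕ) (hu : ContDiffOn ℝ n u (Ioo 0 1)) : ContDiffOn ℝ (n + 1) z (Ioo 0 1) := by
    refine contDiffOn_succ_of_hasDerivAt isOpen_Ioo (fun t ht => h.hasDerivAt_z ht) ?_
    have hφ := hu.rpow_const_of_ne (p := 1 / m) hu0
    exact (contDiffOn_const.mul hφ).sub ((contDiffOn_const.mul
      (contDiffOn_id.rpow_const_of_ne fun x hx => hx.1.ne')).mul (hφ.rpow_const_of_ne hφ0))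
  have step' (n : ℕ) (hu : ContDiffOn ℝ n u (Ioo 0 1)) (hz : ContDiffOn ℝ n z (Ioo 0 1)) :
      ContDiffOn ℝ (n + 1) u (Ioo 0 1) :=
    contDiffOn_succ_of_hasDerivAt isOpen_Ioo (fun t ht => h.hasDerivAt_u ht)
      (hz.sub ((contDiffOn_const.mul contDiffOn_id).mul (hu.rpow_const_of_ne hu0)))
  have hu_zero : ContDiffOn ℝ (0 : ℕ) u (Ioo 0 1) :=
    contDiffOn_zero.2 (h.continuousOn_u.mono Ioo_subset_Icc_self)
  have hz_one := step 0 hu_zero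
  have hu_one := step' 0 hu_zero (hz_one.of_le (by simp))
  have hu_two := step' 1 (by simpa using hu_one) (by simpa using hz_one)
  norm_num at hu_two
  exact hu_two

lemma IsLimitSolution.hasDerivAt_flux {m p σ α β Λ : ℝ} {u z : ℝ → ℝ}
    (h : IsLimitSolution m p σ α β Λ u z) (hpos : ∀ t ∈ Ioo (0 : ℝ) 1, 0 < u t)
    {t : ℝ} (ht : t ∈ Ioo (0 : ℝ) 1) :
    ∃ d, HasDerivAt (fun t => u t ^ (1 / m)) d t ∧
      HasDerivAt (fun t => z t - β * t * u t ^ (1 / m))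
        (α * u t ^ (1 / m) - β * t * d - Λ * t ^ σ * (u t ^ (1 / m)) ^ p) t := by
  have hφ := (h.hasDerivAt_u ht).rpow_const (p := 1 / m) (Or.inl (hpos t ht).ne')
  refine ⟨_, hφ, ?_⟩
  have := (h.hasDerivAt_z ht).sub (((hasDerivAt_id t).const_mul β).mul hφ)
  refine this.congr_deriv ?_
  simp only [id]
  ring

lemma IsLimitSolution.exists_extension {m p σ α β Λ : ℝ} {u z : ℝ → ℝ}
    (h : IsLimitSolution m p σ α β Λ u z) :
    ∃ w : ℝ → ℝ, Continuous w ∧ (∀ t, 0 ≤ w t) ∧ (∀ t, 1 ≤ t → w t = 0) ∧ EqOn w u (Icc 0 1) ∧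
      IsLimitSolution m p σ α β Λ w z := by
  have heq : EqOn (IccExtend (zero_le_one' ℝ) ((Icc (0 : ℝ) 1).domRestrict u)) u (Icc 0 1) :=
    fun t ht => by rw [IccExtend_of_mem _ _ ht, Set.domRestrict_apply]
  refine ⟨_, (continuousOn_iff_continuous_domRestrict.1 h.continuousOn_u).Icc_extend',
    fun t => h.u_nonneg _ (projIcc 0 1 (zero_le_one' ℝ) t).2, fun t ht => ?_, heq, ?_⟩
  · rw [IccExtend_of_right_le _ _ ht]
    exact h.u_one
  · refine ⟨fun t ht => ?_, fun t ht => ?_, fun t ht => ?_, ?_, h.z_one, h.z_zero⟩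
    · rw [heq ht]
      exact (h.hasDerivWithinAt_u t ht).congr heq (heq ht)
    · rw [heq ht]
      exact h.hasDerivWithinAt_z t ht
    · rw [heq ht]
      exact h.u_nonneg t ht
    · rw [heq ⟨zero_le_one, le_rfl⟩]
      exact h.u_one

lemma IsLimitSolution.hasDerivAt_one {m p σ α β Λ : ℝ} {u z : ℝ → ℝ}
    (h : IsLimitSolution m p σ α β Λ u z) (hm : 0 < m) (hzero : ∀ t, 1 ≤ t → u t = 0) :
    HasDerivAt u 0 1 := by
  have hl := (h.hasDerivWithinAt_u 1 ⟨zero_le_one, le_rfl⟩).mono_of_mem_nhdsWithin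
    (Icc_mem_nhdsLE zero_lt_one)
  rw [h.u_one, h.z_one, Real.zero_rpow (by positivity), mul_zero, sub_zero] at hl
  have hr : HasDerivWithinAt u 0 (Ici 1) 1 :=
    (hasDerivWithinAt_const 1 _ (0 : ℝ)).congr (fun t ht => hzero t ht) h.u_one
  have := hl.union hr
  rwa [Iic_union_Ici, hasDerivWithinAt_univ] at this

lemma IsLimitSolution.hasDerivWithinAt_zero {m p σ α β Λ : ℝ} {u z : ℝ → ℝ}
    (h : IsLimitSolution m p σ α β Λ u z) : HasDerivWithinAt u 0 (Ici 0) 0 := by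
  have := (h.hasDerivWithinAt_u 0 ⟨le_rfl, zero_le_one⟩).mono_of_mem_nhdsWithin
    (Icc_mem_nhdsGE zero_lt_one)
  simpa [h.z_zero] using this

/-- The amplitude and length scale turning `Λ` into `1`. -/
lemma exists_scaling {m p σ Λ : ℝ} (hm : 1 < m) (hσ : 2 * (1 - p) / (m - 1) < σ) (hΛ : 0 < Λ) :
    ∃ κ μ : ℝ, 0 < κ ∧ 0 < μ ∧ μ ^ m = μ * κ ^ 2 ∧ κ ^ σ * μ ^ p = μ * Λ := by
  have hm1 : 0 < m - 1 := by linarith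
  have hθ : 0 < σ - 2 * (1 - p) / (m - 1) := by linarith
  set θ := σ - 2 * (1 - p) / (m - 1) with hθd
  set κ := Λ ^ (1 / θ) with hκd
  have hκ : 0 < κ := Real.rpow_pos_of_pos hΛ _
  have hΛκ : Λ = κ ^ θ := by
    rw [hκd, ← Real.rpow_mul hΛ.le, one_div_mul_cancel hθ.ne', Real.rpow_one]
  refine ⟨κ, κ ^ (2 / (m - 1)), hκ, Real.rpow_pos_of_pos hκ _, ?_, ?_⟩
  · rw [← Real.rpow_natCast κ 2, ← Real.rpow_mul hκ.le, ← Real.rpow_add hκ]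
    congr 1
    push_cast
    field_simp
    ring
  · rw [hΛκ, ← Real.rpow_mul hκ.le, ← Real.rpow_add hκ, ← Real.rpow_add hκ]
    congr 1
    rw [hθd]
    field_simp
    ring

section RescaledProfile

variable {m p σ α β Λ κ μ : ℝ} {u z : ℝ → ℝ}

lemma Fm_rescaled (hm : 0 < m) (hμ : 0 < μ) (hu : ∀ t, 0 ≤ u t) :
    Fm m (fun ξ => μ * u (ξ / κ) ^ (1 / m)) = fun ξ => μ ^ m * u (ξ / κ) := by
  funext ξ
  rw [Fm, Real.mul_rpow hμ.le (Real.rpow_nonneg (hu _) _), ← Real.rpow_mul (hu _),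
    one_div_mul_cancel hm.ne', Real.rpow_one]

lemma positivitySet_rescaled (hm : 0 < m) (hκ : 0 < κ) (hμ : 0 < μ)
    (hzero : ∀ t, 1 ≤ t → u t = 0) (hpos : ∀ t ∈ Ioo (0 : ℝ) 1, 0 < u t) :
    {ξ : ℝ | 0 < ξ ∧ 0 < μ * u (ξ / κ) ^ (1 / m)} = Ioo 0 κ := by
  ext ξ
  refine ⟨fun ⟨h0, h1⟩ => ⟨h0, not_le.1 fun hle => ?_⟩, fun hξ => ⟨hξ.1, ?_⟩⟩
  · rw [hzero _ ((one_le_div hκ).2 hle), Real.zero_rpow (by positivity), mul_zero] at h1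
    exact h1.false
  · exact mul_pos hμ (Real.rpow_pos_of_pos
      (hpos _ ⟨div_pos hξ.1 hκ, (div_lt_one hκ).2 hξ.2⟩) _)

lemma IsLimitSolution.isProfile (h : IsLimitSolution m p σ α β Λ u z) (hm : 0 < m)
    (hκ : 0 < κ) (hμ : 0 < μ) (hμm : μ ^ m = μ * κ ^ 2) (hκσ : κ ^ σ * μ ^ p = μ * Λ)
    (hcont : Continuous u) (hu : ∀ t, 0 ≤ u t) (hzero : ∀ t, 1 ≤ t → u t = 0)
    (hpos : ∀ t ∈ Ioo (0 : ℝ) 1, 0 < u t) :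
    IsProfile m p σ α β (fun ξ => μ * u (ξ / κ) ^ (1 / m)) := by
  have hI : ∀ ξ ∈ Ioo 0 κ, ξ / κ ∈ Ioo (0 : ℝ) 1 := fun ξ hξ =>
    ⟨div_pos hξ.1 hκ, (div_lt_one hκ).2 hξ.2⟩
  refine ⟨?_, fun ξ _ => mul_nonneg hμ.le (Real.rpow_nonneg (hu _) _), ?_, ?_⟩
  · exact (continuous_const.mul ((hcont.comp (continuous_id.div_const κ)).rpow_const
      fun _ => Or.inr (by positivity))).continuousOn
  · rw [positivitySet_rescaled hm hκ hμ hzero hpos, Fm_rescaled hm hμ hu]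
    exact contDiffOn_const.mul ((h.contDiffOn_u hpos).comp (contDiffOn_id.div_const κ) hI)
  · rw [positivitySet_rescaled hm hκ hμ hzero hpos]
    intro ξ hξ
    rw [Fm_rescaled hm hμ hu]
    have hscale : ∀ x : ℝ, HasDerivAt (fun x => x / κ) (1 / κ) x := fun x =>
      (hasDerivAt_id x).div_const κ
    have hF : ∀ x ∈ Ioo 0 κ, deriv (fun x => μ ^ m * u (x / κ)) x =
        μ ^ m * ((z (x / κ) - β * (x / κ) * u (x / κ) ^ (1 / m)) * (1 / κ)) := fun x hx =>
      (((h.hasDerivAt_u (hI x hx)).comp x (hscale x)).const_mul (μ ^ m)).deriv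
    obtain ⟨d, hd, hflux⟩ := h.hasDerivAt_flux hpos (hI ξ hξ)
    have hF2 := (((hflux.comp ξ (hscale ξ)).mul_const (1 / κ)).const_mul (μ ^ m)).congr_of_eventuallyEq
      (Filter.eventually_of_mem (Ioo_mem_nhds hξ.1 hξ.2) hF)
    have hf := (hd.comp ξ (hscale ξ)).const_mul μ
    have hf' : deriv (fun ξ => μ * u (ξ / κ) ^ (1 / m)) ξ = μ * (d * (1 / κ)) := hf.deriv
    have hξκ : ξ ^ σ = κ ^ σ * (ξ / κ) ^ σ := by
      rw [← Real.mul_rpow hκ.le (hI ξ hξ).1.le, mul_div_cancel₀ _ hκ.ne']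
    beta_reduce
    rw [hF2.deriv, hf', hμm, Real.mul_rpow hμ.le (Real.rpow_nonneg (hu _) _), hξκ]
    have : κ ^ σ * (ξ / κ) ^ σ * (μ ^ p * (u (ξ / κ) ^ (1 / m)) ^ p) =
        μ * Λ * ((ξ / κ) ^ σ * (u (ξ / κ) ^ (1 / m)) ^ p) := by
      rw [← hκσ]; ring
    rw [this]
    generalize (ξ / κ) ^ σ = A, (u (ξ / κ) ^ (1 / m)) ^ p = B, u (ξ / κ) ^ (1 / m) = C
    field_simp
    ring

lemma IsLimitSolution.good (h : IsLimitSolution m p σ α β Λ u z) (hm : 0 < m)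
    (hκ : 0 < κ) (hμ : 0 < μ) (hu : ∀ t, 0 ≤ u t) :
    GoodP1 (fun ξ => μ * u (ξ / κ) ^ (1 / m)) ∨
      GoodP2 m (fun ξ => μ * u (ξ / κ) ^ (1 / m)) := by
  have hd : HasDerivWithinAt (fun ξ => u (ξ / κ)) 0 (Ici 0) 0 := by
    have h0 : HasDerivWithinAt u 0 (Ici 0) (0 / κ) := by
      rw [zero_div]; exact h.hasDerivWithinAt_zero
    have := h0.comp 0 ((hasDerivAt_id (0 : ℝ)).div_const κ).hasDerivWithinAt
      (s := Ici 0) fun x hx => div_nonneg hx hκ.le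
    simpa [Function.comp_def] using this
  rcases (hu 0).eq_or_lt with h0 | h0
  · refine Or.inr ⟨?_, ?_⟩
    · simp [← h0, hm.ne']
    · rw [Fm_rescaled hm hμ hu]
      simpa using hd.const_mul (μ ^ m)
  · refine Or.inl ⟨?_, ?_⟩
    · simp only [zero_div]
      exact mul_pos hμ (Real.rpow_pos_of_pos h0 _)
    · have := (hd.rpow_const (p := 1 / m) (Or.inl (by rw [zero_div]; exact h0.ne'))).const_mul μ
      simpa using this

lemma IsLimitSolution.hasInterface (h : IsLimitSolution m p σ α β Λ u z) (hm : 0 < m)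
    (hκ : 0 < κ) (hμ : 0 < μ) (hu : ∀ t, 0 ≤ u t) (hzero : ∀ t, 1 ≤ t → u t = 0)
    (hpos : ∀ t ∈ Ioo (0 : ℝ) 1, 0 < u t) :
    HasInterface m (fun ξ => μ * u (ξ / κ) ^ (1 / m)) κ := by
  refine ⟨hκ, ?_, ?_, κ, hκ, fun ξ hξ => ?_⟩
  · simp [div_self hκ.ne', h.u_one, hm.ne']
  · rw [Fm_rescaled hm hμ hu]
    have h1 : HasDerivAt u 0 (κ / κ) := by
      rw [div_self hκ.ne']; exact h.hasDerivAt_one hm hzero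
    have := (h1.comp κ (h := fun ξ => ξ / κ) ((hasDerivAt_id κ).div_const κ)).const_mul (μ ^ m)
    simpa [Function.comp_def] using this
  · rw [sub_self, ← positivitySet_rescaled hm hκ hμ hzero hpos] at hξ
    exact hξ.2

lemma typeI_rescaled {L : ℝ} (hκ : 0 < κ) (hμ : 0 < μ) (hL : 0 < L)
    (hlim : Tendsto (fun t => u t ^ (1 / m) * (1 - t) ^ (-(1 / (m - 1)))) (𝓝[<] 1) (𝓝 L)) :
    TypeI m (fun ξ => μ * u (ξ / κ) ^ (1 / m)) κ := by
  refine ⟨μ * κ ^ (-(1 / (m - 1))) * L, by positivity, ?_⟩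
  have hmap : Tendsto (fun ξ => ξ / κ) (𝓝[<] κ) (𝓝[<] 1) := by
    refine tendsto_nhdsWithin_iff.2 ⟨?_, ?_⟩
    · have := ((continuous_id.div_const κ).tendsto κ).mono_left (nhdsWithin_le_nhds (s := Iio κ))
      simpa [div_self hκ.ne'] using this
    · filter_upwards [self_mem_nhdsWithin] with ξ hξ
      exact (div_lt_one hκ).2 hξ
  refine ((hlim.comp hmap).const_mul (μ * κ ^ (-(1 / (m - 1))))).congr' ?_
  filter_upwards [self_mem_nhdsWithin] with ξ hξ
  have h1 : κ - ξ = κ * (1 - ξ / κ) := by field_simp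
  have h2 : 0 ≤ 1 - ξ / κ := sub_nonneg.2 ((div_lt_one hκ).2 hξ).le
  rw [h1, Real.mul_rpow hκ.le h2, Function.comp_apply]
  ring

end RescaledProfile

/-- for `m>1`, `0<p<1`, `m+p>2`, `σ>2(1-p)/(m-1)`, there exists at
least one good profile (satisfying (P1) or (P2)), positive on `(0,ξ₀)`, with an
interface of Type I at some `ξ₀ ∈ (0,∞)`. -/
theorem existence_good_profile_typeI (m p σ α β : ℝ)
    (hm : 1 < m) (hp0 : 0 < p) (hp1 : p < 1) (hmp : 2 < m + p)
    (hσ : 2 * (1 - p) / (m - 1) < σ)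
    (hα : α = (σ + 2) / (σ * (m - 1) + 2 * (p - 1)))
    (hβ : β = (m - p) / (σ * (m - 1) + 2 * (p - 1))) :
    ∃ f : ℝ → ℝ, ∃ ξ₀ : ℝ,
      IsProfile m p σ α β f ∧ (GoodP1 f ∨ GoodP2 m f) ∧
      (∀ ξ ∈ Set.Ioo 0 ξ₀, 0 < f ξ) ∧
      HasInterface m f ξ₀ ∧ TypeI m f ξ₀ := by
  have hm0 : 0 < m := by linarith
  have hm1 : 0 < m - 1 := by linarith
  have hσ0 : 0 < σ := lt_trans (div_pos (by linarith) hm1) hσ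
  have hden : 0 < σ * (m - 1) + 2 * (p - 1) := by
    have := (div_lt_iff₀ hm1).1 hσ
    linarith
  have hα0 : 0 < α := hα ▸ div_pos (by linarith) hden
  have hβ0 : 0 < β := hβ ▸ div_pos (by linarith) hden
  obtain ⟨Λ, hΛ, u₀, z, h₀, δ, hδ, c, hc, hest₀⟩ := exists_limitSolution hm hp0 hp1 hmp hσ hα0 hβ0
  obtain ⟨u, hcont, hu, hzero, heq, h⟩ := h₀.exists_extension
  have hest : ∀ t ∈ Icc (1 - δ) 1, z t ≤ β / 2 * t * u t ^ (1 / m) ∧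
      c * (1 - t) ≤ (u t ^ (1 / m)) ^ (m - 1) := fun t ht => by
    rw [heq ⟨by linarith [ht.1, hδ.2], ht.2⟩]
    exact hest₀ t ht
  have hpos := h.pos hm hp0 hp1 hσ0 hβ0 hΛ hδ hc fun t ht => (hest t ht).2
  obtain ⟨L, hL, hlim⟩ := h.exists_interface_limit hm hp0 hmp hσ0 hα0 hβ0 hΛ hδ hc hest
  obtain ⟨κ, μ, hκ, hμ, hμm, hκσ⟩ := exists_scaling hm hσ hΛ
  refine ⟨fun ξ => μ * u (ξ / κ) ^ (1 / m), κ,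
    h.isProfile hm0 hκ hμ hμm hκσ hcont hu hzero hpos, h.good hm0 hκ hμ hu, fun ξ hξ => ?_,
    h.hasInterface hm0 hκ hμ hu hzero hpos, typeI_rescaled hκ hμ hL hlim⟩
  rw [← positivitySet_rescaled hm0 hκ hμ hzero hpos] at hξ
  exact hξ.2
end

section
/- Let m>1, 0<p<1 with m+p>2, and let σ>2(1−p)/(m−1). Then there exists a good profile f satisfying (P2), positive on (0,ξ₀), having an interface of Type II at some ξ₀∈(0,∞), and whose behavior near the origin is f(ξ)ξ^{−(σ+2)/(m−p)} → K for some constant K>0 as ξ→0⁺. -/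
open Real Filter Set Topology

/-- The value of `q'` in the system `z' = -q`, `q' = slopeField …`, to which the profile equation
reduces. -/
noncomputable def slopeField (A δ d₀ c₁ c₂ y z q : ℝ) : ℝ :=
  (1 - q) / (δ * z ^ A * y ^ 2) + d₀ * z / y ^ 2 + c₁ * q / y + c₂ * q ^ 2 / z

theorem slopeField_lipschitzOn (A δ d₀ c₁ c₂ : ℝ) (hδ : 0 < δ) {η : ℝ} (hη : 0 < η) :
    ∃ L : NNReal, LipschitzOnWith L (fun x : ℝ × ℝ × ℝ => slopeField A δ d₀ c₁ c₂ x.1 x.2.1 x.2.2)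
      (Icc η 3 ×ˢ Icc η 1 ×ˢ Icc (1 / 2) (3 / 2)) := by
  refine ContDiffOn.exists_lipschitzOnWith (n := 1) ?_ one_ne_zero
    ((convex_Icc _ _).prod ((convex_Icc _ _).prod (convex_Icc _ _)))
    (isCompact_Icc.prod (isCompact_Icc.prod isCompact_Icc))
  have h1 : ContDiff ℝ 1 (fun x : ℝ × ℝ × ℝ => x.1) := by fun_prop
  have h2 : ContDiff ℝ 1 (fun x : ℝ × ℝ × ℝ => x.2.1) := by fun_prop
  have h3 : ContDiff ℝ 1 (fun x : ℝ × ℝ × ℝ => x.2.2) := by fun_prop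
  intro x hx
  obtain ⟨⟨hy, -⟩, ⟨hz, -⟩, -⟩ := hx
  have hy0 : 0 < x.1 := hη.trans_le hy
  have hz0 : 0 < x.2.1 := hη.trans_le hz
  have hzA : ContDiffAt ℝ 1 (fun x : ℝ × ℝ × ℝ => x.2.1 ^ A) x :=
    h2.contDiffAt.rpow_const_of_ne hz0.ne'
  have hzA0 : x.2.1 ^ A ≠ 0 := (rpow_pos_of_pos hz0 A).ne'
  refine ContDiffAt.contDiffWithinAt ?_
  unfold slopeField
  refine (((ContDiffAt.div (by fun_prop) ?_ ?_).add (ContDiffAt.div (by fun_prop) (by fun_prop) ?_)).add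
    (ContDiffAt.div (by fun_prop) (by fun_prop) ?_)).add
    (ContDiffAt.div (by fun_prop) (by fun_prop) ?_)
  · exact (contDiffAt_const.mul hzA).mul (h1.contDiffAt.pow 2)
  all_goals positivity

/-- Global existence on a compact interval for a bounded, globally Lipschitz vector field. -/
theorem exists_solution_of_bounded_lipschitz {E : Type*} [NormedAddCommGroup E] [NormedSpace ℝ E]
    [CompleteSpace E] {F : ℝ → E → E} {a b : ℝ} (hab : a ≤ b) {K M : NNReal}
    (hlip : ∀ t ∈ Icc a b, LipschitzWith K (F t))
    (hcont : ∀ x, ContinuousOn (F · x) (Icc a b))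
    (hbdd : ∀ t ∈ Icc a b, ∀ x, ‖F t x‖ ≤ M) (x₀ : E) :
    ∃ x : ℝ → E, x a = x₀ ∧ ∀ t ∈ Icc a b, HasDerivWithinAt x (F t (x t)) (Icc a b) t := by
  have h : IsPicardLindelof F (⟨a, left_mem_Icc.2 hab⟩ : Icc a b) x₀
      (M * (b - a).toNNReal) 0 M K :=
    { lipschitzOnWith := fun t ht => (hlip t ht).lipschitzOnWith
      continuousOn := fun x _ => hcont x
      norm_le := fun t ht x _ => hbdd t ht x
      mul_max_le := by
        simp [hab] }
  exact h.exists_eq_forall_mem_Icc_hasDerivWithinAt₀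

theorem exists_truncated_solution (A δ d₀ c₁ c₂ : ℝ) (hδ : 0 < δ) {η : ℝ} (hη : 0 < η)
    (hη1 : η ≤ 1) :
    ∃ z q : ℝ → ℝ, z η = 1 ∧ q η = 1 ∧ ∀ y ∈ Icc η 3,
      HasDerivWithinAt z (-max (1 / 2) (min (3 / 2) (q y))) (Icc η 3) y ∧
      HasDerivWithinAt q (slopeField A δ d₀ c₁ c₂ y (max η (min 1 (z y)))
        (max (1 / 2) (min (3 / 2) (q y)))) (Icc η 3) y := by
  obtain ⟨L, hL⟩ := slopeField_lipschitzOn A δ d₀ c₁ c₂ hδ hη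
  set S : Set (ℝ × ℝ × ℝ) := Icc η 3 ×ˢ Icc η 1 ×ˢ Icc (1 / 2) (3 / 2)
  set H : ℝ × ℝ × ℝ → ℝ := fun x => slopeField A δ d₀ c₁ c₂ x.1 x.2.1 x.2.2
  have hScomp : IsCompact S := isCompact_Icc.prod (isCompact_Icc.prod isCompact_Icc)
  obtain ⟨M, hM⟩ := hScomp.exists_bound_of_continuousOn hL.continuousOn
  have hc1 : LipschitzWith 1 (fun x : ℝ => max η (min 1 x)) :=
    (LipschitzWith.id.const_min 1).const_max η
  have hc2 : LipschitzWith 1 (fun x : ℝ => max (1 / 2) (min (3 / 2) x)) :=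
    (LipschitzWith.id.const_min (3 / 2)).const_max (1 / 2)
  have hm1 (x : ℝ) : max η (min 1 x) ∈ Icc η 1 := ⟨le_max_left _ _, max_le hη1 (min_le_left _ _)⟩
  have hm2 (x : ℝ) : max (1 / 2) (min (3 / 2) x) ∈ Icc (1 / 2 : ℝ) (3 / 2) :=
    ⟨le_max_left _ _, max_le (by norm_num) (min_le_left _ _)⟩
  set c : ℝ × ℝ → ℝ × ℝ := fun x => (max η (min 1 x.1), max (1 / 2) (min (3 / 2) x.2))
  have hc : LipschitzWith 1 c :=
    ((hc1.comp LipschitzWith.prod_fst).prodMk (hc2.comp LipschitzWith.prod_snd)).weaken (by simp)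
  set F : ℝ → ℝ × ℝ → ℝ × ℝ := fun y x => (-(c x).2, H (y, c x))
  have hmem {y : ℝ} (hy : y ∈ Icc η 3) (x : ℝ × ℝ) : (y, c x) ∈ S := ⟨hy, hm1 _, hm2 _⟩
  have hF : ∀ t ∈ Icc η 3, LipschitzWith (max 1 L) (F t) := by
    intro t ht
    refine LipschitzWith.prodMk (α := ℝ × ℝ) ?_ ?_
    · exact (LipschitzWith.prod_snd.comp hc).neg.weaken (by simp)
    · refine LipschitzWith.of_dist_le_mul fun x x' => ?_
      refine (hL.dist_le_mul _ (hmem ht x) _ (hmem ht x')).trans ?_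
      gcongr
      have := hc.dist_le_mul x x'
      simpa [Prod.dist_eq] using this
  have hb : ∀ t ∈ Icc η 3, ∀ x, ‖F t x‖ ≤ (max 2 M).toNNReal := by
    intro t ht x
    rw [Real.coe_toNNReal _ (by positivity), Prod.norm_def]
    refine max_le_max ?_ (hM _ (hmem ht x))
    have := hm2 x.2
    rw [Real.norm_eq_abs, abs_le]
    constructor <;> simp only [F, c] <;> linarith [this.1, this.2]
  have hcont : ∀ x, ContinuousOn (F · x) (Icc η 3) := by
    intro x
    refine continuousOn_const.prodMk ?_
    exact hL.continuousOn.comp (by fun_prop) fun t ht => hmem ht x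
  have hη3 : η ≤ 3 := by linarith
  obtain ⟨x, hx0, hx⟩ := exists_solution_of_bounded_lipschitz hη3 hF hcont hb (1, 1)
  refine ⟨fun t => (x t).1, fun t => (x t).2, by simp [hx0], by simp [hx0], fun y hy => ⟨?_, ?_⟩⟩
  · exact (hx y hy).fst
  · exact (hx y hy).snd

theorem slopeField_barrier {A δ d₀ c₁ c₂ y z q s : ℝ} (hδ : 0 < δ) (hA : 1 < A)
    (hsmall : |d₀| + 9 / 2 * |c₁| + 81 / 4 * |c₂| + 27 / 4 * (A - 1) < 1 / (2 * δ))
    (hy : 0 < y) (hy3 : y ≤ 3) (hz : 0 < z) (hz1 : z ≤ 1) (hs : s = 1 ∨ s = -1)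
    (hq : q = 1 + s * (z ^ (A - 1) / 2)) :
    s * slopeField A δ d₀ c₁ c₂ y z q < -((A - 1) * z ^ (A - 2) * q / 2) := by
  have hw : 0 < z ^ (A - 1) := rpow_pos_of_pos hz _
  have hw1 : z ^ (A - 1) ≤ 1 := rpow_le_one hz.le hz1 (by linarith)
  have hzA : z ^ A = z ^ (A - 1) * z := by
    rw [← rpow_add_one hz.ne']; congr 1; ring
  have hzA2 : z ^ (A - 2) = z ^ (A - 1) / z := by
    rw [← rpow_sub_one hz.ne']; congr 1; ring
  set w := z ^ (A - 1)
  have hs2 : s * s = 1 := by rcases hs with rfl | rfl <;> norm_num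
  have hq0 : 0 ≤ q := by rcases hs with rfl | rfl <;> linarith
  have hq1 : q ≤ 3 / 2 := by rcases hs with rfl | rfl <;> linarith
  have habs : |s| = 1 := by rcases hs with rfl | rfl <;> norm_num
  have e : s * slopeField A δ d₀ c₁ c₂ y z q =
      (-(1 / (2 * δ)) + s * d₀ * z ^ 2 + s * c₁ * (q * y * z) + s * c₂ * (q ^ 2 * y ^ 2))
        / (z * y ^ 2) := by
    have : s * (1 - q) = -(w / 2) := by rw [hq]; linear_combination (-(w / 2)) * hs2
    have h2 : s * ((1 - q) / (δ * (w * z) * y ^ 2)) = -(1 / (2 * δ)) / (z * y ^ 2) := by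
      rw [← mul_div_assoc, this]; field_simp
    unfold slopeField
    rw [hzA, mul_add, mul_add, mul_add, h2]
    field_simp
  have hz2 : z ^ 2 ≤ 1 := pow_le_one₀ hz.le hz1
  have hyz : q * y * z ≤ 9 / 2 := by
    calc q * y * z ≤ 3 / 2 * 3 * 1 := by gcongr
      _ = 9 / 2 := by norm_num
  have hqy : q ^ 2 * y ^ 2 ≤ 81 / 4 := by
    calc q ^ 2 * y ^ 2 ≤ (3 / 2) ^ 2 * 3 ^ 2 := by gcongr
      _ = 81 / 4 := by norm_num
  have hwq : w * q * y ^ 2 ≤ 27 / 2 := by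
    calc w * q * y ^ 2 ≤ 1 * (3 / 2) * 3 ^ 2 := by gcongr
      _ = 27 / 2 := by norm_num
  have hle (d t T : ℝ) (ht : 0 ≤ t) (htT : t ≤ T) : s * d * t ≤ T * |d| := by
    calc s * d * t ≤ |s * d * t| := le_abs_self _
      _ = t * |d| := by rw [abs_mul, abs_mul, habs, abs_of_nonneg ht]; ring
      _ ≤ T * |d| := by gcongr
  have b0 := hle d₀ _ _ (by positivity) hz2
  have b1 := hle c₁ _ _ (by positivity) hyz
  have b2 := hle c₂ _ _ (by positivity) hqy
  rw [e, hzA2, div_lt_iff₀ (by positivity)]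
  have e2 : -((A - 1) * (w / z) * q / 2) * (z * y ^ 2) = -((A - 1) * (w * q * y ^ 2) / 2) := by
    field_simp
  rw [e2]
  have : (A - 1) * (w * q * y ^ 2) ≤ (A - 1) * (27 / 2) := by gcongr
  linarith

theorem barrier_of_truncated {A δ d₀ c₁ c₂ η Y : ℝ} (hδ : 0 < δ) (hA : 1 < A)
    (hsmall : |d₀| + 9 / 2 * |c₁| + 81 / 4 * |c₂| + 27 / 4 * (A - 1) < 1 / (2 * δ))
    (hη : 0 < η) (hY : Y ≤ 3) {z q : ℝ → ℝ} (hq0 : q η = 1)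
    (hzmem : ∀ y ∈ Icc η Y, z y ∈ Icc η 1)
    (hz : ∀ y ∈ Icc η Y, HasDerivWithinAt z (-max (1 / 2) (min (3 / 2) (q y))) (Icc η Y) y)
    (hq : ∀ y ∈ Icc η Y, HasDerivWithinAt q (slopeField A δ d₀ c₁ c₂ y (max η (min 1 (z y)))
        (max (1 / 2) (min (3 / 2) (q y)))) (Icc η Y) y)
    {s : ℝ} (hs : s = 1 ∨ s = -1) :
    ∀ y ∈ Icc η Y, s * (q y - 1) ≤ z y ^ (A - 1) / 2 := by
  have hzpos : ∀ y ∈ Icc η Y, 0 < z y := fun y hy => hη.trans_le (hzmem y hy).1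
  have hB : ∀ y ∈ Icc η Y, HasDerivWithinAt (fun y => z y ^ (A - 1) / 2)
      (-max (1 / 2) (min (3 / 2) (q y)) * (A - 1) * z y ^ (A - 1 - 1) / 2) (Icc η Y) y :=
    fun y hy => ((hz y hy).rpow_const (Or.inl (hzpos y hy).ne')).div_const 2
  have hf : ∀ y ∈ Icc η Y, HasDerivWithinAt (fun y => s * (q y - 1))
      (s * slopeField A δ d₀ c₁ c₂ y (max η (min 1 (z y))) (max (1 / 2) (min (3 / 2) (q y))))
      (Icc η Y) y := fun y hy => ((hq y hy).sub_const 1).const_mul s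
  intro y hy
  refine image_le_of_deriv_right_lt_deriv_boundary' (f := fun y => s * (q y - 1))
    (fun x hx => (hf x hx).continuousWithinAt)
    (fun x hx => (hf x (Ico_subset_Icc_self hx)).mono_of_mem_nhdsWithin
      (Icc_mem_nhdsGE_of_mem hx)) ?_
    (fun x hx => (hB x hx).continuousWithinAt)
    (fun x hx => (hB x (Ico_subset_Icc_self hx)).mono_of_mem_nhdsWithin
      (Icc_mem_nhdsGE_of_mem hx)) ?_ hy
  · have := rpow_nonneg (hzpos η (left_mem_Icc.2 (hy.1.trans hy.2))).le (A - 1)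
    simp only [hq0, sub_self, mul_zero]; positivity
  · intro x hx hxe
    replace hx := Ico_subset_Icc_self hx
    obtain ⟨hz0, hz1⟩ := hzmem x hx
    have hzx := hzpos x hx
    have hw : 0 < z x ^ (A - 1) := rpow_pos_of_pos hzx _
    have hw1 : z x ^ (A - 1) ≤ 1 := rpow_le_one hzx.le hz1 (by linarith)
    have hqe : q x = 1 + s * (z x ^ (A - 1) / 2) := by
      rcases hs with rfl | rfl <;> linarith
    have hclamp : max (1 / 2) (min (3 / 2) (q x)) = q x := by
      rw [min_eq_right, max_eq_right] <;> rcases hs with rfl | rfl <;> linarith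
    rw [min_eq_right hz1, max_eq_right hz0, hclamp]
    have := slopeField_barrier hδ hA hsmall (hη.trans_le hx.1) (hx.2.trans hY) hzx hz1 hs hqe
    rw [show A - 1 - 1 = A - 2 by ring]
    linarith

theorem exists_approximation {A δ d₀ c₁ c₂ : ℝ} (hδ : 0 < δ) (hA : 1 < A)
    (hsmall : |d₀| + 9 / 2 * |c₁| + 81 / 4 * |c₂| + 27 / 4 * (A - 1) < 1 / (2 * δ))
    {η : ℝ} (hη : 0 < η) (hη1 : η ≤ 1) :
    ∃ z q : ℝ → ℝ, z η = 1 ∧ (∀ y, q y ∈ Icc (1 / 2) (3 / 2)) ∧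
      (∀ y ∈ Icc η 3, HasDerivWithinAt z (-q y) (Icc η 3) y) ∧
      ∀ Y ∈ Icc η 3, η ≤ z Y → ∀ y ∈ Icc η Y, |q y - 1| ≤ z y ^ (A - 1) / 2 ∧
        HasDerivWithinAt q (slopeField A δ d₀ c₁ c₂ y (z y) (q y)) (Icc η Y) y := by
  obtain ⟨z, q, hz0, hq0, h⟩ := exists_truncated_solution A δ d₀ c₁ c₂ hδ hη hη1
  refine ⟨z, fun y => max (1 / 2) (min (3 / 2) (q y)), hz0,
    fun y => ⟨le_max_left _ _, max_le (by norm_num) (min_le_left _ _)⟩, fun y hy => (h y hy).1, ?_⟩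
  intro Y hY hzY
  have hsub : Icc η Y ⊆ Icc η 3 := Icc_subset_Icc_right hY.2
  have hanti : AntitoneOn z (Icc η 3) :=
    antitoneOn_of_hasDerivWithinAt_nonpos (convex_Icc _ _)
      (fun y hy => (h y hy).1.continuousWithinAt)
      (fun y hy => (h y (interior_subset hy)).1.mono interior_subset)
      (fun y _ => by
        have := le_max_left (1 / 2) (min (3 / 2) (q y))
        linarith)
  have hzmem : ∀ y ∈ Icc η Y, z y ∈ Icc η 1 := fun y hy =>
    ⟨hzY.trans (hanti (hsub hy) hY hy.2),
      hz0 ▸ hanti (left_mem_Icc.2 (hη1.trans (by norm_num))) (hsub hy) hy.1⟩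
  have hb {s : ℝ} (hs : s = 1 ∨ s = -1) := barrier_of_truncated hδ hA hsmall hη hY.2 hq0 hzmem
    (fun y hy => (h y (hsub hy)).1.mono hsub) (fun y hy => (h y (hsub hy)).2.mono hsub) hs
  have habs : ∀ y ∈ Icc η Y, |q y - 1| ≤ z y ^ (A - 1) / 2 := fun y hy =>
    abs_le.2 ⟨by linarith [hb (Or.inr rfl) y hy], by linarith [hb (Or.inl rfl) y hy]⟩
  have hclamp : ∀ y ∈ Icc η Y, max (1 / 2) (min (3 / 2) (q y)) = q y := fun y hy => by
    have h1 : z y ^ (A - 1) ≤ 1 :=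
      rpow_le_one (hη.le.trans (hzmem y hy).1) (hzmem y hy).2 (by linarith)
    have h2 := abs_le.1 (habs y hy)
    rw [min_eq_right, max_eq_right] <;> linarith [h2.1, h2.2]
  intro y hy
  dsimp only
  refine ⟨by rw [hclamp y hy]; exact habs y hy, ?_⟩
  have h1 := (h y (hsub hy)).2.mono hsub
  rw [min_eq_right (hzmem y hy).2, max_eq_right (hzmem y hy).1] at h1
  exact h1.congr_of_mem hclamp hy

theorem Ultrafilter.exists_tendsto_of_eventually_mem_Icc {ι : Type*} (ω : Ultrafilter ι)
    {u : ι → ℝ} {a b : ℝ} (h : ∀ᶠ n in ω, u n ∈ Icc a b) :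
    ∃ l, Tendsto u ω (𝓝 l) := by
  obtain ⟨l, -, hl⟩ := isCompact_Icc.ultrafilter_le_nhds (ω.map u) (le_principal_iff.2 h)
  exact ⟨l, hl⟩

theorem abs_sub_sub_mul_le_of_hasDerivWithinAt {x x' : ℝ → ℝ} {y ζ C : ℝ} (hζ : 0 < ζ)
    (hC : 0 ≤ C)
    (h : ∀ t ∈ Icc (y - ζ) (y + ζ), HasDerivWithinAt x (x' t) (Icc (y - ζ) (y + ζ)) t ∧
      |x' t - x' y| ≤ C * |t - y|) {t : ℝ} (ht : t ∈ Icc (y - ζ) (y + ζ)) :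
    |x t - x y - (t - y) * x' y| ≤ C * |t - y| ^ 2 := by
  have hyJ : y ∈ Icc (y - ζ) (y + ζ) := ⟨by linarith, by linarith⟩
  have hsub : uIcc y t ⊆ Icc (y - ζ) (y + ζ) := uIcc_subset_Icc hyJ ht
  have := (convex_uIcc y t).norm_image_sub_le_of_norm_hasDerivWithin_le
    (f := fun u => x u - u * x' y) (f' := fun u => x' u - x' y) (C := C * |t - y|)
    (fun u hu => (((h u (hsub hu)).1.mono hsub).sub
      ((hasDerivWithinAt_id u _).mul_const (x' y))).congr_deriv (by ring))
    (fun u hu => (h u (hsub hu)).2.trans (by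
      gcongr ?_ * ?_
      exact abs_sub_left_of_mem_uIcc hu))
    left_mem_uIcc right_mem_uIcc
  simp only [Real.norm_eq_abs] at this
  convert this using 1 <;> ring_nf

theorem hasDerivAt_of_tendsto_of_equiLipschitz {ι : Type*} {ω : Filter ι} [ω.NeBot]
    {x x' : ι → ℝ → ℝ} {X : ℝ → ℝ} {d y ζ C : ℝ} (hζ : 0 < ζ) (hC : 0 ≤ C)
    (hX : ∀ t ∈ Icc (y - ζ) (y + ζ), Tendsto (fun n => x n t) ω (𝓝 (X t)))
    (hd : Tendsto (fun n => x' n y) ω (𝓝 d))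
    (h : ∀ᶠ n in ω, ∀ t ∈ Icc (y - ζ) (y + ζ),
      HasDerivWithinAt (x n) (x' n t) (Icc (y - ζ) (y + ζ)) t ∧
        |x' n t - x' n y| ≤ C * |t - y|) : HasDerivAt X d y := by
  have hyJ : y ∈ Icc (y - ζ) (y + ζ) := ⟨by linarith, by linarith⟩
  have key : ∀ t ∈ Icc (y - ζ) (y + ζ), |X t - X y - (t - y) * d| ≤ C * |t - y| ^ 2 := by
    intro t ht
    refine le_of_tendsto ((((hX t ht).sub (hX y hyJ)).sub (hd.const_mul (t - y))).abs) ?_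
    filter_upwards [h] with n hn
    exact abs_sub_sub_mul_le_of_hasDerivWithinAt hζ hC hn ht
  rw [hasDerivAt_iff_isLittleO]
  have hO : (fun t => X t - X y - (t - y) • d) =O[𝓝 y] fun t => ‖t - y‖ ^ 2 := by
    refine Asymptotics.IsBigO.of_bound C ?_
    filter_upwards [Icc_mem_nhds (show y - ζ < y by linarith) (show y < y + ζ by linarith)]
      with t ht
    simpa using key t ht
  exact hO.trans_isLittleO (Asymptotics.isLittleO_pow_sub_sub y one_lt_two)

set_option maxHeartbeats 1000000 in
theorem exists_limit_system {A δ d₀ c₁ c₂ : ℝ} (hδ : 0 < δ) (hA : 1 < A)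
    (hsmall : |d₀| + 9 / 2 * |c₁| + 81 / 4 * |c₂| + 27 / 4 * (A - 1) < 1 / (2 * δ)) :
    ∃ z q : ℝ → ℝ,
      (∀ y ∈ Ioc (0 : ℝ) 3, z y ∈ Icc (1 - 3 / 2 * y) (1 - y / 2)) ∧
      (∀ s ∈ Ioc (0 : ℝ) 3, ∀ t ∈ Ioc (0 : ℝ) 3, s ≤ t →
        z s - z t ∈ Icc ((t - s) / 2) (3 / 2 * (t - s))) ∧
      ∀ y ∈ Ioo (0 : ℝ) 3, 0 < z y → |q y - 1| ≤ z y ^ (A - 1) / 2 ∧ HasDerivAt z (-q y) y ∧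
        HasDerivAt q (slopeField A δ d₀ c₁ c₂ y (z y) (q y)) y := by
  have hη (n : ℕ) : 0 < 1 / ((n : ℝ) + 1) := by positivity
  have hη1 (n : ℕ) : 1 / ((n : ℝ) + 1) ≤ 1 := by
    rw [div_le_one (by positivity)]; linarith [n.cast_nonneg (α := ℝ)]
  choose z q hz0 hqmem hz hq using
    fun n : ℕ => exists_approximation (d₀ := d₀) (c₁ := c₁) (c₂ := c₂) hδ hA hsmall (hη n) (hη1 n)
  set η : ℕ → ℝ := fun n => 1 / ((n : ℝ) + 1)
  obtain ⟨ω, hω⟩ : ∃ ω : Ultrafilter ℕ, (ω : Filter ℕ) ≤ atTop :=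
    ⟨hyperfilter ℕ, Nat.hyperfilter_le_atTop⟩
  have hηlim : Tendsto η ω (𝓝 0) :=
    tendsto_one_div_add_atTop_nhds_zero_nat.mono_left hω
  have hηev {y : ℝ} (hy : 0 < y) : ∀ᶠ n in ω, η n ≤ y := hηlim.eventually_le_const hy
  have hdiff (n : ℕ) {s t : ℝ} (hs : s ∈ Icc (η n) 3) (ht : t ∈ Icc (η n) 3) (hst : s ≤ t) :
      z n s - z n t ∈ Icc ((t - s) / 2) (3 / 2 * (t - s)) := by
    have hsub : Icc s t ⊆ Icc (η n) 3 := Icc_subset_Icc hs.1 ht.2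
    have := norm_image_sub_le_of_norm_deriv_le_segment' (f := fun u => z n u + u)
      (f' := fun u => -q n u + 1) (C := 1 / 2) (a := s) (b := t)
      (fun u hu => ((hz n u (hsub hu)).mono hsub).add (hasDerivWithinAt_id u _))
      (fun u _ => by
        have := hqmem n u
        rw [Real.norm_eq_abs, abs_le]; constructor <;> linarith [this.1, this.2])
      t (right_mem_Icc.2 hst)
    rw [Real.norm_eq_abs, abs_le] at this
    constructor <;> linarith [this.1, this.2]
  have hbd {y : ℝ} (n : ℕ) (hy : y ∈ Icc (η n) 3) :
      z n y ∈ Icc (1 - 3 / 2 * (y - η n)) (1 - (y - η n) / 2) := by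
    have := hdiff n (left_mem_Icc.2 (hy.1.trans hy.2)) hy hy.1
    rw [hz0] at this
    constructor <;> linarith [this.1, this.2]
  have hZex : ∀ y : ℝ, ∃ l, y ∈ Ioc 0 3 → Tendsto (fun n => z n y) ω (𝓝 l) := by
    intro y
    by_cases hy : y ∈ Ioc (0 : ℝ) 3
    · obtain ⟨l, hl⟩ := ω.exists_tendsto_of_eventually_mem_Icc (u := fun n => z n y)
        (a := -4) (b := 1) (by
          filter_upwards [hηev hy.1] with n hn
          have := hbd n ⟨hn, hy.2⟩
          constructor <;> linarith [this.1, this.2, hη n, hy.2])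
      exact ⟨l, fun _ => hl⟩
    · exact ⟨0, fun h => absurd h hy⟩
  choose Z hZ using hZex
  have hQex : ∀ y : ℝ, ∃ l, Tendsto (fun n => q n y) ω (𝓝 l) := fun y =>
    ω.exists_tendsto_of_eventually_mem_Icc (Eventually.of_forall fun n => hqmem n y)
  choose Q hQ using hQex
  refine ⟨Z, Q, ?_, ?_, ?_⟩
  · intro y hy
    refine ⟨?_, ?_⟩
    · have h1 : Tendsto (fun n => 1 - 3 / 2 * (y - η n)) ω (𝓝 (1 - 3 / 2 * (y - 0))) :=
        ((hηlim.const_sub y).const_mul _).const_sub 1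
      rw [sub_zero] at h1
      refine le_of_tendsto_of_tendsto h1 (hZ y hy) ?_
      filter_upwards [hηev hy.1] with n hn using (hbd n ⟨hn, hy.2⟩).1
    · have h1 : Tendsto (fun n => 1 - (y - η n) / 2) ω (𝓝 (1 - (y - 0) / 2)) :=
        ((hηlim.const_sub y).div_const _).const_sub 1
      rw [sub_zero] at h1
      refine le_of_tendsto_of_tendsto (hZ y hy) h1 ?_
      filter_upwards [hηev hy.1] with n hn using (hbd n ⟨hn, hy.2⟩).2
  · intro s hs t ht hst
    refine isClosed_Icc.mem_of_tendsto ((hZ s hs).sub (hZ t ht)) ?_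
    filter_upwards [hηev hs.1] with n hn using hdiff n ⟨hn, hs.2⟩ ⟨hn.trans hst, ht.2⟩ hst
  · intro y hy hZy
    have hyI : y ∈ Ioc (0 : ℝ) 3 := ⟨hy.1, hy.2.le⟩
    obtain ⟨ζ, hζ, hζy, hζ3, hζZ⟩ : ∃ ζ : ℝ, 0 < ζ ∧ ζ ≤ y / 2 ∧ ζ ≤ 3 - y ∧ 4 * ζ ≤ Z y := by
      refine ⟨min (y / 2) (min (3 - y) (Z y / 4)), ?_, min_le_left _ _,
        (min_le_right _ _).trans (min_le_left _ _), ?_⟩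
      · have := hy.1; have := hy.2
        refine lt_min (by linarith) (lt_min (by linarith) (by linarith))
      · have := (min_le_right (y / 2) _).trans (min_le_right (3 - y) (Z y / 4))
        linarith
    set J := Icc (y - ζ) (y + ζ)
    have hyJ : y ∈ J := ⟨by linarith, by linarith⟩
    have hev : ∀ᶠ n in ω, η n ≤ ζ ∧ 3 * ζ < z n y :=
      (hηev hζ).and ((hZ y hyI).eventually_const_lt (by linarith))
    have hJsub (n : ℕ) (hn : η n ≤ ζ) : J ⊆ Icc (η n) 3 := fun t ht =>
      ⟨by linarith [ht.1], by linarith [ht.2]⟩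
    have hzJ : ∀ n, η n ≤ ζ → 3 * ζ < z n y → ∀ t ∈ J, z n t ∈ Icc ζ 1 := by
      intro n hn hn' t ht
      have h1 := (hbd n (hJsub n hn ht)).2
      refine ⟨?_, by linarith [(hJsub n hn ht).1]⟩
      rcases le_total t y with h | h
      · linarith [(hdiff n (hJsub n hn ht) (hJsub n hn hyJ) h).1]
      · linarith [(hdiff n (hJsub n hn hyJ) (hJsub n hn ht) h).2, ht.2]
    obtain ⟨L, hL⟩ := slopeField_lipschitzOn A δ d₀ c₁ c₂ hδ hζ
    set S : Set (ℝ × ℝ × ℝ) := Icc ζ 3 ×ˢ Icc ζ 1 ×ˢ Icc (1 / 2) (3 / 2)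
    have hScomp : IsCompact S := isCompact_Icc.prod (isCompact_Icc.prod isCompact_Icc)
    obtain ⟨M, hM⟩ := hScomp.exists_bound_of_continuousOn hL.continuousOn
    have hS : ∀ n, η n ≤ ζ → 3 * ζ < z n y → ∀ t ∈ J, (t, z n t, q n t) ∈ S :=
      fun n hn hn' t ht => ⟨⟨by linarith [ht.1], by linarith [ht.2]⟩, hzJ n hn hn' t ht, hqmem n t⟩
    have hM0 : 0 ≤ M := by
      obtain ⟨n, hn, hn'⟩ := hev.exists
      exact (norm_nonneg _).trans (hM _ (hS n hn hn' y hyJ))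
    have hqder : ∀ n, η n ≤ ζ → 3 * ζ < z n y → ∀ t ∈ J,
        |q n t - 1| ≤ z n t ^ (A - 1) / 2 ∧
        HasDerivWithinAt (q n) (slopeField A δ d₀ c₁ c₂ t (z n t) (q n t)) J t := by
      intro n hn hn' t ht
      have hend : y + ζ ∈ J := ⟨by linarith, le_rfl⟩
      have hsub : J ⊆ Icc (η n) (y + ζ) := fun u hu => ⟨(hJsub n hn hu).1, hu.2⟩
      have := hq n (y + ζ) (hJsub n hn hend) (hn.trans (hzJ n hn hn' _ hend).1) t (hsub ht)
      exact ⟨this.1, this.2.mono hsub⟩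
    have hqlip : ∀ n, η n ≤ ζ → 3 * ζ < z n y → ∀ t ∈ J, |q n t - q n y| ≤ M * |t - y| := by
      intro n hn hn' t ht
      exact (convex_Icc _ _).norm_image_sub_le_of_norm_hasDerivWithin_le
        (fun u hu => (hqder n hn hn' u hu).2) (fun u hu => hM _ (hS n hn hn' u hu)) hyJ ht
    have hzlip : ∀ n, η n ≤ ζ → ∀ t ∈ J, |z n t - z n y| ≤ 3 / 2 * |t - y| := by
      intro n hn t ht
      refine (convex_Icc _ _).norm_image_sub_le_of_norm_hasDerivWithin_le
        (fun u hu => (hz n u (hJsub n hn hu)).mono (hJsub n hn)) (fun u _ => ?_) hyJ ht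
      rw [norm_neg, Real.norm_eq_abs, abs_of_nonneg] <;> linarith [(hqmem n u).1, (hqmem n u).2]
    have hJIoc : ∀ t ∈ J, t ∈ Ioc (0 : ℝ) 3 := fun t ht =>
      ⟨by linarith [ht.1], by linarith [ht.2]⟩
    have hlim : Tendsto (fun n => (y, z n y, q n y)) ω (𝓝 (y, Z y, Q y)) :=
      tendsto_const_nhds.prodMk_nhds ((hZ y hyI).prodMk_nhds (hQ y))
    have hevS : ∀ᶠ n in ω, (y, z n y, q n y) ∈ S := by
      filter_upwards [hev] with n hn using hS n hn.1 hn.2 y hyJ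
    have hlimS : (y, Z y, Q y) ∈ S := hScomp.isClosed.mem_of_tendsto hlim hevS
    have hH : Tendsto (fun n => slopeField A δ d₀ c₁ c₂ y (z n y) (q n y)) ω
        (𝓝 (slopeField A δ d₀ c₁ c₂ y (Z y) (Q y))) := by
      have hw : Tendsto (fun n => (y, z n y, q n y)) ω (𝓝[S] (y, Z y, Q y)) :=
        tendsto_nhdsWithin_iff.2 ⟨hlim, hevS⟩
      have hcont : Tendsto (fun x : ℝ × ℝ × ℝ => slopeField A δ d₀ c₁ c₂ x.1 x.2.1 x.2.2)
          (𝓝[S] (y, Z y, Q y)) (𝓝 (slopeField A δ d₀ c₁ c₂ y (Z y) (Q y))) :=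
        hL.continuousOn _ hlimS
      exact hcont.comp hw
    refine ⟨?_, ?_, ?_⟩
    · refine le_of_tendsto_of_tendsto ((hQ y).sub_const 1).abs
        (((hZ y hyI).rpow_const (Or.inl hZy.ne')).div_const 2) ?_
      filter_upwards [hev] with n hn using (hqder n hn.1 hn.2 y hyJ).1
    · refine hasDerivAt_of_tendsto_of_equiLipschitz (x := z) (x' := fun n t => -q n t) hζ hM0
        (fun t ht => hZ t (hJIoc t ht)) (hQ y).neg ?_
      filter_upwards [hev] with n hn t ht
      refine ⟨(hz n t (hJsub n hn.1 ht)).mono (hJsub n hn.1), ?_⟩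
      have := hqlip n hn.1 hn.2 t ht
      rwa [neg_sub_neg, abs_sub_comm]
    · refine hasDerivAt_of_tendsto_of_equiLipschitz (x := q)
        (x' := fun n t => slopeField A δ d₀ c₁ c₂ t (z n t) (q n t)) (C := L * (3 / 2 + M)) hζ
        (by positivity) (fun t ht => hQ t) hH ?_
      filter_upwards [hev] with n hn t ht
      refine ⟨(hqder n hn.1 hn.2 t ht).2, ?_⟩
      have h1 := hL.dist_le_mul _ (hS n hn.1 hn.2 t ht) _ (hS n hn.1 hn.2 y hyJ)
      rw [Real.dist_eq] at h1
      refine h1.trans ?_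
      rw [mul_assoc]
      gcongr
      rw [Prod.dist_eq, Prod.dist_eq]
      simp only [Real.dist_eq]
      have h2 := hqlip n hn.1 hn.2 t ht
      have h3 := hzlip n hn.1 t ht
      have h4 := abs_nonneg (t - y)
      have h5 := mul_nonneg hM0 h4
      refine max_le (by linarith) (max_le (by linarith) (by linarith))

theorem exists_reduced_profile {A : ℝ} (d₀ c₁ c₂ : ℝ) (hA : 1 < A) :
    ∃ δ > 0, ∃ y₀ > 0, ∃ z q : ℝ → ℝ, Continuous z ∧ z 0 = 1 ∧ (∀ y, z y ≤ 1) ∧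
      (∀ y < y₀, 0 < z y) ∧ (∀ y, y₀ ≤ y → z y = 0) ∧
      (∀ y ∈ Ioo 0 y₀, HasDerivAt z (-q y) y ∧
        HasDerivAt q (slopeField A δ d₀ c₁ c₂ y (z y) (q y)) y) ∧
      HasDerivWithinAt z (-1) (Iic y₀) y₀ := by
  obtain ⟨δ, hδ, hsmall⟩ : ∃ δ : ℝ, 0 < δ ∧
      |d₀| + 9 / 2 * |c₁| + 81 / 4 * |c₂| + 27 / 4 * (A - 1) < 1 / (2 * δ) := by
    set B := |d₀| + 9 / 2 * |c₁| + 81 / 4 * |c₂| + 27 / 4 * (A - 1)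
    have hB : 0 < B := by
      have : 0 < A - 1 := by linarith
      positivity
    refine ⟨1 / (4 * B), by positivity, ?_⟩
    have : 1 / (2 * (1 / (4 * B))) = 2 * B := by field_simp; norm_num
    rw [this]; linarith
  obtain ⟨Z, q, hbd, hdiff, hode⟩ := exists_limit_system hδ hA hsmall
  set W : ℝ → ℝ := fun y => if y ≤ 0 then 1 else Z y
  have hWZ {y : ℝ} (hy : 0 < y) : W y = Z y := if_neg hy.not_ge
  have hW0 : W 0 = 1 := if_pos le_rfl
  have hWdiff : ∀ s ∈ Icc (0 : ℝ) 3, ∀ t ∈ Icc (0 : ℝ) 3, s ≤ t →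
      W s - W t ∈ Icc ((t - s) / 2) (3 / 2 * (t - s)) := by
    intro s hs t ht hst
    rcases hs.1.eq_or_lt with rfl | hs0
    · rcases ht.1.eq_or_lt with rfl | ht0
      · simp
      · rw [hW0, hWZ ht0]
        have := hbd t ⟨ht0, ht.2⟩
        constructor <;> linarith [this.1, this.2]
    · rw [hWZ hs0, hWZ (hs0.trans_le hst)]
      exact hdiff s ⟨hs0, hs.2⟩ t ⟨hs0.trans_le hst, ht.2⟩ hst
  have hWcont : ContinuousOn W (Icc 0 3) := by
    refine LipschitzOnWith.continuousOn (K := 3 / 2) (LipschitzOnWith.of_dist_le_mul ?_)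
    intro s hs t ht
    simp only [Real.dist_eq, NNReal.coe_div, NNReal.coe_ofNat]
    rcases le_total s t with h | h
    · have := hWdiff s hs t ht h
      rw [abs_le, abs_of_nonpos (sub_nonpos.2 h)]
      constructor <;> linarith [this.1, this.2]
    · have := hWdiff t ht s hs h
      rw [abs_le, abs_of_nonneg (sub_nonneg.2 h)]
      constructor <;> linarith [this.1, this.2]
  obtain ⟨y₀, hy₀, hWy₀⟩ : ∃ y ∈ Icc (0 : ℝ) 3, W y = 0 := by
    refine intermediate_value_Icc' (by norm_num) hWcont ⟨?_, by rw [hW0]; norm_num⟩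
    have := hWdiff 0 ⟨le_rfl, by norm_num⟩ 3 ⟨by norm_num, le_rfl⟩ (by norm_num)
    rw [hW0] at this
    linarith [this.1]
  have hy₀0 : 0 < y₀ := by
    rcases hy₀.1.eq_or_lt with h | h
    · rw [← h, hW0] at hWy₀; norm_num at hWy₀
    · exact h
  have hclamp (y : ℝ) : max 0 (min y₀ y) ∈ Icc 0 y₀ :=
    ⟨le_max_left _ _, max_le hy₀.1 (min_le_left _ _)⟩
  have hsub : Icc 0 y₀ ⊆ Icc 0 3 := Icc_subset_Icc_right hy₀.2
  set z : ℝ → ℝ := fun y => W (max 0 (min y₀ y))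
  have hzW {y : ℝ} (hy : y ∈ Ioo 0 y₀) : z y = Z y := by
    simp only [z]
    rw [min_eq_right hy.2.le, max_eq_right hy.1.le, hWZ hy.1]
  have hzcont : Continuous z :=
    hWcont.comp_continuous (by fun_prop) fun y => hsub (hclamp y)
  have hzpos : ∀ y < y₀, 0 < z y := by
    intro y hy
    have h1 : max 0 (min y₀ y) < y₀ := max_lt hy₀0 (by rwa [min_eq_right hy.le])
    have := (hWdiff _ (hsub (hclamp y)) y₀ hy₀ h1.le).1
    simp only [z]
    linarith
  have hzzero : ∀ y, y₀ ≤ y → z y = 0 := by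
    intro y hy
    simp only [z]
    rw [min_eq_left hy, max_eq_right hy₀.1, hWy₀]
  have hzode : ∀ y ∈ Ioo 0 y₀, |q y - 1| ≤ z y ^ (A - 1) / 2 ∧ HasDerivAt z (-q y) y ∧
      HasDerivAt q (slopeField A δ d₀ c₁ c₂ y (z y) (q y)) y := by
    intro y hy
    have hev : z =ᶠ[𝓝 y] Z := by
      filter_upwards [Ioo_mem_nhds hy.1 hy.2] with u hu using hzW hu
    have := hode y ⟨hy.1, hy.2.trans_le hy₀.2⟩ (hzW hy ▸ hzpos y hy.2)
    rw [← hzW hy] at this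
    exact ⟨this.1, this.2.1.congr_of_eventuallyEq hev, this.2.2⟩
  refine ⟨δ, hδ, y₀, hy₀0, z, q, hzcont, ?_, ?_, hzpos, hzzero, fun y hy => (hzode y hy).2, ?_⟩
  · simp [z, hy₀.1, hW0]
  · intro y
    have h1 := hclamp y
    have := (hWdiff 0 ⟨le_rfl, by norm_num⟩ _ (hsub h1) h1.1).1
    simp only [z]
    rw [hW0] at this
    linarith [h1.1]
  · have hmem : Ioo 0 y₀ ∈ 𝓝[<] y₀ := Ioo_mem_nhdsLT hy₀0
    refine hasDerivWithinAt_Iic_of_tendsto_deriv (s := Ioo 0 y₀)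
      (fun y hy => (hzode y hy).2.1.differentiableAt.differentiableWithinAt)
      hzcont.continuousWithinAt hmem ?_
    have hz0 : Tendsto (fun y => z y ^ (A - 1) / 2) (𝓝[<] y₀) (𝓝 0) := by
      have : Tendsto z (𝓝[<] y₀) (𝓝 0) := by
        have := hzcont.continuousWithinAt (s := Iio y₀) (x := y₀)
        rwa [ContinuousWithinAt, hzzero y₀ le_rfl] at this
      have := (this.rpow_const (p := A - 1) (Or.inr (by linarith))).div_const 2
      rwa [zero_rpow (by linarith), zero_div] at this
    have hq : Tendsto (fun y => q y - 1) (𝓝[<] y₀) (𝓝 0) := by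
      refine squeeze_zero_norm' ?_ hz0
      filter_upwards [hmem] with y hy using (hzode y hy).1
    have := (hq.add_const 1).neg
    simp only [sub_add_cancel, zero_add] at this
    refine this.congr' ?_
    filter_upwards [hmem] with y hy using (hzode y hy).2.1.deriv.symm

theorem hasDerivAt_mul_rpow {lam κ ξ : ℝ} (hξ : 0 < ξ) :
    HasDerivAt (fun x : ℝ => lam * x ^ κ) (κ * (lam * ξ ^ κ) / ξ) ξ := by
  refine ((hasDerivAt_rpow_const (Or.inl hξ.ne')).const_mul lam).congr_deriv ?_
  rw [rpow_sub_one hξ.ne']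
  ring

theorem hasDerivAt_rpow_mul_rpow_comp {z : ℝ → ℝ} {q lam κ ξ y : ℝ} (s t : ℝ) (hξ : 0 < ξ)
    (hy : y = lam * ξ ^ κ) (hz : HasDerivAt z (-q) y) (hzpos : 0 < z y) :
    HasDerivAt (fun x => x ^ s * z (lam * x ^ κ) ^ t)
      (ξ ^ s * z y ^ t / ξ * (s - t * κ * (y * q / z y))) ξ := by
  subst hy
  have h1 : HasDerivAt (fun x => z (lam * x ^ κ)) (-q * (κ * (lam * ξ ^ κ) / ξ)) ξ :=
    hz.comp ξ (hasDerivAt_mul_rpow hξ)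
  refine ((hasDerivAt_rpow_const (p := s) (Or.inl hξ.ne')).mul
    (h1.rpow_const (p := t) (Or.inl hzpos.ne'))).congr_deriv ?_
  rw [rpow_sub_one hξ.ne', rpow_sub_one hzpos.ne']
  field_simp
  ring

theorem hasDerivAt_deriv_rpow_mul_rpow_comp {z q : ℝ → ℝ} {q' lam κ ξ y : ℝ} (s t : ℝ)
    (hξ : 0 < ξ) (hy : y = lam * ξ ^ κ) (hz : HasDerivAt z (-q y) y) (hq : HasDerivAt q q' y)
    (hzpos : 0 < z y) :
    HasDerivAt (fun x => x ^ s * z (lam * x ^ κ) ^ t / x *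
        (s - t * κ * (lam * x ^ κ * q (lam * x ^ κ) / z (lam * x ^ κ))))
      (ξ ^ s * z y ^ t / ξ ^ 2 * ((s - t * κ * (y * q y / z y)) ^ 2 - (s - t * κ * (y * q y / z y))
        - t * κ ^ 2 * (y * q y / z y + y ^ 2 * q' / z y + y ^ 2 * q y ^ 2 / z y ^ 2))) ξ := by
  have h0 := hasDerivAt_rpow_mul_rpow_comp s t hξ hy hz hzpos
  subst hy
  have hy' := hasDerivAt_mul_rpow (lam := lam) (κ := κ) hξ
  have h1 : HasDerivAt (fun x => z (lam * x ^ κ)) (-q (lam * ξ ^ κ) * (κ * (lam * ξ ^ κ) / ξ)) ξ :=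
    hz.comp ξ hy'
  have h2 : HasDerivAt (fun x => q (lam * x ^ κ)) (q' * (κ * (lam * ξ ^ κ) / ξ)) ξ :=
    hq.comp ξ hy'
  have h3 := ((hy'.mul h2).div h1 hzpos.ne').const_mul (t * κ) |>.const_sub s
  refine ((h0.div (hasDerivAt_id ξ) hξ.ne').mul h3).congr_deriv ?_
  simp only [Pi.mul_apply, Pi.div_apply, id]
  field_simp
  ring

theorem reduced_identity {m γ κ ρ δ X y z q q' : ℝ} (hδ : δ ≠ 0) (hm : m ≠ 0) (hκ : κ ≠ 0)
    (hρ : ρ ≠ 0) (hX : X ≠ 0) (hy : y ≠ 0) (hz : z ≠ 0)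
    (hq' : q' = (1 - q) / (δ * (ρ * m * κ ^ 2) * X * y ^ 2) +
      m * γ * (γ * m - 1) / (ρ * m * κ ^ 2) * z / y ^ 2 +
      -(ρ * m * κ * (2 * γ * m - 1 + κ)) / (ρ * m * κ ^ 2) * q / y + (ρ * m - 1) * q ^ 2 / z) :
    δ * X * z * ((γ * m - ρ * m * κ * (y * q / z)) ^ 2 - (γ * m - ρ * m * κ * (y * q / z))
        - ρ * m * κ ^ 2 * (y * q / z + y ^ 2 * q' / z + y ^ 2 * q ^ 2 / z ^ 2)) + (1 - q) = 0 := by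
  subst hq'
  field_simp
  ring

theorem contDiffOn_two_of_hasDerivAt {w w₁ w₂ : ℝ → ℝ} {S : Set ℝ} (hS : IsOpen S)
    (h1 : ∀ x ∈ S, HasDerivAt w (w₁ x) x) (h2 : ∀ x ∈ S, HasDerivAt w₁ (w₂ x) x)
    (h3 : ContinuousOn w₂ S) : ContDiffOn ℝ 2 w S := by
  have e1 : EqOn (deriv w) w₁ S := fun x hx => (h1 x hx).deriv
  have e2 : EqOn (deriv w₁) w₂ S := fun x hx => (h2 x hx).deriv
  have hw₁ : ContDiffOn ℝ 1 w₁ S := by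
    rw [show (1 : WithTop ℕ∞) = 0 + 1 by norm_num, contDiffOn_succ_iff_deriv_of_isOpen hS]
    exact ⟨fun x hx => (h2 x hx).differentiableAt.differentiableWithinAt, by simp,
      contDiffOn_zero.2 (h3.congr e2)⟩
  rw [show (2 : WithTop ℕ∞) = 1 + 1 by norm_num, contDiffOn_succ_iff_deriv_of_isOpen hS]
  exact ⟨fun x hx => (h1 x hx).differentiableAt.differentiableWithinAt, by simp, hw₁.congr e1⟩

theorem deriv_deriv_of_hasDerivAt {w w₁ : ℝ → ℝ} {w₂ x : ℝ} {S : Set ℝ} (hS : IsOpen S)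
    (h1 : ∀ x ∈ S, HasDerivAt w (w₁ x) x) (hx : x ∈ S) (h2 : HasDerivAt w₁ w₂ x) :
    deriv (deriv w) x = w₂ := by
  have : deriv w =ᶠ[𝓝 x] w₁ := by
    filter_upwards [hS.mem_nhds hx] with u hu using (h1 u hu).deriv
  rw [this.deriv_eq, h2.deriv]

/-- The profile, in terms of the solution `z` of the reduced system. -/
noncomputable def reducedProfile (K γ lam κ ρ : ℝ) (z : ℝ → ℝ) : ℝ → ℝ :=
  fun ξ => K * (ξ ^ γ * z (lam * ξ ^ κ) ^ ρ)

theorem Fm_reducedProfile {K γ lam κ ρ m ξ : ℝ} {z : ℝ → ℝ} (hK : 0 < K) (hz : ∀ y, 0 ≤ z y)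
    (hξ : 0 ≤ ξ) :
    Fm m (reducedProfile K γ lam κ ρ z) ξ =
      K ^ m * (ξ ^ (γ * m) * z (lam * ξ ^ κ) ^ (ρ * m)) := by
  have h := hz (lam * ξ ^ κ)
  rw [Fm, reducedProfile, mul_rpow hK.le (by positivity), mul_rpow (by positivity) (by positivity),
    rpow_mul hξ, rpow_mul h]

theorem profile_identity {m p σ α β γ κ ρ A K δ lam ξ y z q q' : ℝ} (hm : m ≠ 0)
    (hK : 0 < K) (hξ : 0 < ξ) (hz : 0 < z) (hκ : κ ≠ 0) (hρ : 0 < ρ) (hy : y = lam * ξ ^ κ)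
    (hlam : lam = K ^ (p - 1) / ρ) (hδ : δ = K ^ (m - p)) (hα : α = β * γ) (hβκ : β * κ = 1)
    (hρp : ρ - 1 = p * ρ) (hγκ : γ + κ = σ + γ * p) (hγm : γ * m - 2 = γ + κ)
    (hρm : ρ * m = ρ + A)
    (hq' : q' = slopeField A (δ * (ρ * m * κ ^ 2)) (m * γ * (γ * m - 1) / (ρ * m * κ ^ 2))
      (-(ρ * m * κ * (2 * γ * m - 1 + κ)) / (ρ * m * κ ^ 2)) (ρ * m - 1) y z q) :
    K ^ m * (ξ ^ (γ * m) * z ^ (ρ * m) / ξ ^ 2 *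
        ((γ * m - ρ * m * κ * (y * q / z)) ^ 2 - (γ * m - ρ * m * κ * (y * q / z))
        - ρ * m * κ ^ 2 * (y * q / z + y ^ 2 * q' / z + y ^ 2 * q ^ 2 / z ^ 2)))
      - α * (K * (ξ ^ γ * z ^ ρ)) + β * ξ * (K * (ξ ^ γ * z ^ ρ / ξ * (γ - ρ * κ * (y * q / z))))
      + ξ ^ σ * (K * (ξ ^ γ * z ^ ρ)) ^ p = 0 := by
  have hypos : 0 < y := by rw [hy, hlam]; positivity
  have hδpos : 0 < δ := by rw [hδ]; positivity
  obtain ⟨F, hF⟩ : ∃ F, F = K * (ξ ^ γ * z ^ ρ) := ⟨_, rfl⟩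
  obtain ⟨T, hT⟩ : ∃ T, T = ξ ^ σ * F ^ p := ⟨_, rfl⟩
  have hT' : T = K ^ p * ξ ^ (γ + κ) * z ^ (ρ - 1) := by
    rw [hT, hF, mul_rpow hK.le (by positivity), mul_rpow (by positivity) (by positivity),
      ← rpow_mul hξ.le, ← rpow_mul hz.le, hγκ, hρp, rpow_add hξ, mul_comm p ρ]
    ring
  have hTF : T = F * ρ * y / z := by
    rw [hT', hF, hy, hlam, rpow_add hξ, rpow_sub_one hz.ne', rpow_sub_one hK.ne']
    field_simp
  have hw : K ^ m * (ξ ^ (γ * m) * z ^ (ρ * m) / ξ ^ 2) = T * (δ * z ^ A * z) := by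
    rw [hT', hδ, hρm, ← hγm, rpow_sub hξ, rpow_sub hK, rpow_sub_one hz.ne', rpow_add hz,
      rpow_two]
    field_simp
  have hid := reduced_identity hδpos.ne' hm hκ hρ.ne' (rpow_pos_of_pos hz A).ne' hypos.ne' hz.ne'
    hq'
  have hlow : β * ξ * (K * (ξ ^ γ * z ^ ρ / ξ * (γ - ρ * κ * (y * q / z)))) - α * F = -T * q := by
    have : β * ξ * (K * (ξ ^ γ * z ^ ρ / ξ * (γ - ρ * κ * (y * q / z)))) - α * F
        = F * (β * γ - α) - F * ρ * y / z * q * (β * κ) := by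
      rw [hF]
      field_simp
      ring
    rw [this, hα, hβκ, ← hTF]
    ring
  rw [← hF, ← hT]
  linear_combination T * hid + hlow + ((γ * m - ρ * m * κ * (y * q / z)) ^ 2 -
    (γ * m - ρ * m * κ * (y * q / z)) - ρ * m * κ ^ 2 * (y * q / z + y ^ 2 * q' / z +
    y ^ 2 * q ^ 2 / z ^ 2)) * hw

theorem isProfile_reducedProfile {m p σ α β γ κ ρ A K δ lam ξ₀ : ℝ} {z q : ℝ → ℝ} (hm : 0 < m)
    (hp : 0 < p)
    (hK : 0 < K) (hγ : 0 < γ) (hκ : 0 < κ) (hρ : 0 < ρ)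
    (hlam : lam = K ^ (p - 1) / ρ) (hδ : δ = K ^ (m - p)) (hα : α = β * γ) (hβκ : β * κ = 1)
    (hρp : ρ - 1 = p * ρ) (hγκ : γ + κ = σ + γ * p) (hγm : γ * m - 2 = γ + κ)
    (hρm : ρ * m = ρ + A) (hzc : Continuous z) (hz0 : ∀ y, 0 ≤ z y)
    (hzpos : ∀ ξ ∈ Ioo 0 ξ₀, 0 < z (lam * ξ ^ κ)) (hzzero : ∀ ξ, 0 < ξ → ξ₀ ≤ ξ → z (lam * ξ ^ κ) = 0)
    (hzq : ∀ ξ ∈ Ioo 0 ξ₀, HasDerivAt z (-q (lam * ξ ^ κ)) (lam * ξ ^ κ))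
    (hq : ∀ ξ ∈ Ioo 0 ξ₀, HasDerivAt q (slopeField A (δ * (ρ * m * κ ^ 2))
      (m * γ * (γ * m - 1) / (ρ * m * κ ^ 2))
      (-(ρ * m * κ * (2 * γ * m - 1 + κ)) / (ρ * m * κ ^ 2)) (ρ * m - 1) (lam * ξ ^ κ)
        (z (lam * ξ ^ κ)) (q (lam * ξ ^ κ))) (lam * ξ ^ κ)) :
    IsProfile m p σ α β (reducedProfile K γ lam κ ρ z) := by
  set f := reducedProfile K γ lam κ ρ z with hf
  have hset : {ξ : ℝ | 0 < ξ ∧ 0 < f ξ} = Ioo 0 ξ₀ := by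
    ext ξ
    refine ⟨fun ⟨h0, h⟩ => ⟨h0, ?_⟩, fun h => ⟨h.1, ?_⟩⟩
    · by_contra! hle
      simp [hf, reducedProfile, hzzero ξ h0 hle, zero_rpow hρ.ne'] at h
    · have h1 := h.1
      have h2 := hzpos ξ h
      simp only [hf, reducedProfile]
      positivity
  have hfd : ∀ ξ ∈ Ioo 0 ξ₀, HasDerivAt f (K * (ξ ^ γ * z (lam * ξ ^ κ) ^ ρ / ξ *
      (γ - ρ * κ * (lam * ξ ^ κ * q (lam * ξ ^ κ) / z (lam * ξ ^ κ))))) ξ := fun ξ h =>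
    (hasDerivAt_rpow_mul_rpow_comp γ ρ h.1 rfl (hzq ξ h) (hzpos ξ h)).const_mul K
  have hw₁ : ∀ ξ ∈ Ioo 0 ξ₀, HasDerivAt (Fm m f)
      (K ^ m * (ξ ^ (γ * m) * z (lam * ξ ^ κ) ^ (ρ * m) / ξ *
      (γ * m - ρ * m * κ * (lam * ξ ^ κ * q (lam * ξ ^ κ) / z (lam * ξ ^ κ))))) ξ := fun ξ h =>
    ((hasDerivAt_rpow_mul_rpow_comp (γ * m) (ρ * m) h.1 rfl (hzq ξ h)
      (hzpos ξ h)).const_mul (K ^ m)).congr_of_eventuallyEq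
      (by filter_upwards [Ioi_mem_nhds h.1] with x hx using Fm_reducedProfile hK hz0 (le_of_lt hx))
  have hw₂ : ∀ ξ ∈ Ioo 0 ξ₀, HasDerivAt (fun ξ => K ^ m * (ξ ^ (γ * m) *
      z (lam * ξ ^ κ) ^ (ρ * m) / ξ *
      (γ * m - ρ * m * κ * (lam * ξ ^ κ * q (lam * ξ ^ κ) / z (lam * ξ ^ κ)))))
      (α * f ξ - β * ξ * (K * (ξ ^ γ * z (lam * ξ ^ κ) ^ ρ / ξ *
      (γ - ρ * κ * (lam * ξ ^ κ * q (lam * ξ ^ κ) / z (lam * ξ ^ κ))))) - ξ ^ σ * f ξ ^ p) ξ := by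
    intro ξ h
    refine ((hasDerivAt_deriv_rpow_mul_rpow_comp (γ * m) (ρ * m) h.1 rfl (hzq ξ h) (hq ξ h)
      (hzpos ξ h)).const_mul (K ^ m)).congr_deriv ?_
    have := profile_identity (σ := σ) hm.ne' hK h.1 (hzpos ξ h) hκ.ne' hρ rfl hlam hδ hα hβκ hρp
      hγκ hγm hρm (q := q (lam * ξ ^ κ)) rfl
    simp only [hf, reducedProfile]
    linear_combination this
  have hzlim : Continuous fun ξ : ℝ => ξ ^ κ := continuous_rpow_const hκ.le
  have hfc : Continuous f :=
    continuous_const.mul ((continuous_rpow_const hγ.le).mul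
      ((hzc.comp (continuous_const.mul hzlim)).rpow_const fun _ => Or.inr hρ.le))
  have hqc : ContinuousOn (fun ξ => q (lam * ξ ^ κ)) (Ioo 0 ξ₀) := fun ξ h =>
    (ContinuousAt.comp (f := fun ξ : ℝ => lam * ξ ^ κ) (hq ξ h).continuousAt
      (continuous_const.mul hzlim).continuousAt).continuousWithinAt
  have hne : ∀ ξ ∈ Ioo 0 ξ₀, ξ ≠ 0 := fun ξ h => h.1.ne'
  refine ⟨hfc.continuousOn, fun ξ hξ => ?_, ?_, ?_⟩
  · have h1 : (0:ℝ) ≤ ξ := hξ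
    have h2 := hz0 (lam * ξ ^ κ)
    simp only [hf, reducedProfile]
    positivity
  · rw [hset]
    refine contDiffOn_two_of_hasDerivAt isOpen_Ioo hw₁ hw₂ ?_
    have hzc' : ContinuousOn (fun ξ => z (lam * ξ ^ κ)) (Ioo 0 ξ₀) :=
      (hzc.comp (continuous_const.mul hzlim)).continuousOn
    have h1 : ContinuousOn (fun ξ => lam * ξ ^ κ * q (lam * ξ ^ κ) / z (lam * ξ ^ κ)) (Ioo 0 ξ₀) :=
      ((continuous_const.mul hzlim).continuousOn.mul hqc).div hzc' fun ξ h => (hzpos ξ h).ne'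
    have h2 : ContinuousOn (fun ξ => ξ ^ γ * z (lam * ξ ^ κ) ^ ρ / ξ) (Ioo 0 ξ₀) :=
      ((continuous_rpow_const hγ.le).continuousOn.mul
        (hzc'.rpow_const fun _ _ => Or.inr hρ.le)).div continuousOn_id hne
    have h3 : ContinuousOn (fun ξ => ξ ^ σ * f ξ ^ p) (Ioo 0 ξ₀) :=
      (continuousOn_id.rpow_const fun ξ h => Or.inl (hne ξ h)).mul
        (hfc.continuousOn.rpow_const fun _ _ => Or.inr hp.le)
    have h4 := hfc.continuousOn (s := Ioo 0 ξ₀)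
    fun_prop
  · rw [hset]
    intro ξ h
    rw [deriv_deriv_of_hasDerivAt isOpen_Ioo hw₁ h (hw₂ ξ h), (hfd ξ h).deriv]
    ring

theorem goodP2_reducedProfile {m γ κ ρ K lam : ℝ} {z : ℝ → ℝ} (hK : 0 < K) (hγ : 0 < γ)
    (hm : 0 < m) (hρ : 0 < ρ) (hγm : 1 < γ * m) (hz0 : ∀ y, 0 ≤ z y) (hz1 : ∀ y, z y ≤ 1) :
    GoodP2 m (reducedProfile K γ lam κ ρ z) := by
  refine ⟨by simp [reducedProfile, zero_rpow hγ.ne'], ?_⟩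
  have h0 : HasDerivAt (fun x : ℝ => K ^ m * x ^ (γ * m)) 0 0 :=
    ((hasDerivAt_rpow_const (p := γ * m) (x := 0) (Or.inr hγm.le)).const_mul (K ^ m)).congr_deriv
      (by rw [zero_rpow (by linarith)]; ring)
  rw [hasDerivWithinAt_iff_isLittleO]
  have h1 := h0.hasDerivWithinAt (s := Ici 0)
  rw [hasDerivWithinAt_iff_isLittleO] at h1
  refine Asymptotics.IsBigO.trans_isLittleO (Asymptotics.IsBigO.of_bound 1 ?_) h1
  filter_upwards [self_mem_nhdsWithin] with x hx
  have hx : 0 ≤ x := hx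
  rw [Fm_reducedProfile hK hz0 hx, Fm_reducedProfile hK hz0 le_rfl, zero_rpow (by linarith)]
  have h2 : z (lam * x ^ κ) ^ (ρ * m) ≤ 1 := rpow_le_one (hz0 _) (hz1 _) (by positivity)
  have h3 := rpow_nonneg (hz0 (lam * x ^ κ)) (ρ * m)
  simp only [zero_mul, mul_zero, smul_zero, sub_zero, norm_eq_abs, one_mul]
  rw [abs_of_nonneg (by positivity), abs_of_nonneg (by positivity)]
  have : x ^ (γ * m) * z (lam * x ^ κ) ^ (ρ * m) ≤ x ^ (γ * m) * 1 := by gcongr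
  rw [mul_one] at this
  gcongr

theorem hasDerivWithinAt_comp_interface {κ lam ξ₀ y₀ : ℝ} {z : ℝ → ℝ} (hξ₀ : 0 < ξ₀) (hκ : 0 < κ)
    (hlam : 0 < lam) (hy₀ : lam * ξ₀ ^ κ = y₀) (hz : HasDerivWithinAt z (-1) (Iic y₀) y₀) :
    HasDerivWithinAt (fun ξ => z (lam * ξ ^ κ)) (-(κ * y₀ / ξ₀)) (Icc 0 ξ₀) ξ₀ := by
  subst hy₀
  refine (hz.comp ξ₀ (hasDerivAt_mul_rpow hξ₀).hasDerivWithinAt fun ξ h => ?_).congr_deriv (by ring)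
  have h0 := h.1
  have := h.2
  simp only [mem_Iic]
  gcongr

theorem hasInterface_reducedProfile {m γ κ ρ K lam ξ₀ y₀ : ℝ} {z : ℝ → ℝ} (hK : 0 < K)
    (hρ : 0 < ρ) (hρm : 1 < ρ * m) (hξ₀ : 0 < ξ₀) (hκ : 0 < κ)
    (hlam : 0 < lam) (hy₀ : lam * ξ₀ ^ κ = y₀) (hz : HasDerivWithinAt z (-1) (Iic y₀) y₀)
    (hz0 : ∀ y, 0 ≤ z y) (hzpos : ∀ ξ ∈ Ioo 0 ξ₀, 0 < z (lam * ξ ^ κ))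
    (hzzero : ∀ ξ, 0 < ξ → ξ₀ ≤ ξ → z (lam * ξ ^ κ) = 0) :
    HasInterface m (reducedProfile K γ lam κ ρ z) ξ₀ := by
  have h0 := hzzero ξ₀ hξ₀ le_rfl
  refine ⟨hξ₀, by simp [reducedProfile, h0, zero_rpow hρ.ne'], ?_, ξ₀, hξ₀, fun ξ h => ?_⟩
  · have hl : HasDerivWithinAt (fun ξ => z (lam * ξ ^ κ) ^ (ρ * m)) 0 (Icc 0 ξ₀) ξ₀ :=
      ((hasDerivWithinAt_comp_interface hξ₀ hκ hlam hy₀ hz).rpow_const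
        (Or.inr hρm.le)).congr_deriv (by rw [h0, zero_rpow (by linarith)]; ring)
    have hr : HasDerivWithinAt (fun ξ => z (lam * ξ ^ κ) ^ (ρ * m)) 0 (Ici ξ₀) ξ₀ :=
      (hasDerivWithinAt_const ξ₀ (Ici ξ₀) (0 : ℝ)).congr
        (fun ξ h => by rw [hzzero ξ (hξ₀.trans_le h) h, zero_rpow (by linarith)])
        (by rw [h0, zero_rpow (by linarith)])
    have hd : HasDerivAt (fun ξ => z (lam * ξ ^ κ) ^ (ρ * m)) 0 ξ₀ :=
      (hl.union hr).hasDerivAt (by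
        rw [Icc_union_Ici_eq_Ici hξ₀.le]
        exact Ici_mem_nhds hξ₀)
    refine ((((hasDerivAt_rpow_const (p := γ * m) (Or.inl hξ₀.ne')).mul hd).const_mul
      (K ^ m)).congr_deriv ?_).congr_of_eventuallyEq ?_
    · rw [h0, zero_rpow (by linarith)]
      ring
    · filter_upwards [Ioi_mem_nhds hξ₀] with x hx using Fm_reducedProfile hK hz0 (le_of_lt hx)
  · rw [sub_self] at h
    have h1 := h.1
    have h2 := hzpos ξ h
    simp only [reducedProfile]
    positivity

theorem typeII_reducedProfile {p γ κ ρ K lam ξ₀ y₀ : ℝ} {z : ℝ → ℝ} (hK : 0 < K)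
    (hρ : ρ = 1 / (1 - p)) (hξ₀ : 0 < ξ₀) (hκ : 0 < κ)
    (hlam : 0 < lam) (hy₀ : lam * ξ₀ ^ κ = y₀) (hz : HasDerivWithinAt z (-1) (Iic y₀) y₀)
    (hz0 : ∀ y, 0 ≤ z y) (hzy₀ : z y₀ = 0) :
    TypeII p (reducedProfile K γ lam κ ρ z) ξ₀ := by
  have hD : 0 < κ * y₀ / ξ₀ := by rw [← hy₀]; positivity
  refine ⟨K * (ξ₀ ^ γ * (κ * y₀ / ξ₀) ^ ρ), by positivity, ?_⟩
  have hs := ((hasDerivWithinAt_iff_tendsto_slope' (by simp)).1 ((hasDerivWithinAt_comp_interface hξ₀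
    hκ hlam hy₀ hz).mono (s := Ioo 0 ξ₀) Ioo_subset_Icc_self)).neg
  rw [neg_neg, nhdsWithin_Ioo_eq_nhdsLT hξ₀] at hs
  have hpow := hs.rpow_const (p := ρ) (Or.inl hD.ne')
  have hγ : Tendsto (fun ξ : ℝ => ξ ^ γ) (𝓝[<] ξ₀) (𝓝 (ξ₀ ^ γ)) :=
    ((continuousAt_rpow_const ξ₀ γ (Or.inl hξ₀.ne')).tendsto).mono_left nhdsWithin_le_nhds
  refine ((hγ.mul hpow).const_mul K).congr' ?_
  filter_upwards [self_mem_nhdsWithin] with ξ hξ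
  have hpos : 0 < ξ₀ - ξ := sub_pos.2 hξ
  have : -slope (fun ξ => z (lam * ξ ^ κ)) ξ₀ ξ = z (lam * ξ ^ κ) / (ξ₀ - ξ) := by
    rw [slope_def_field, hy₀, hzy₀, sub_zero, ← div_neg, neg_sub]
  rw [this, div_rpow (hz0 _) hpos.le, ← hρ, rpow_neg hpos.le, reducedProfile]
  ring

theorem tendsto_reducedProfile_div {γ κ ρ K lam : ℝ} {z : ℝ → ℝ} (hκ : 0 < κ) (hρ : 0 < ρ)
    (hzc : Continuous z) (hz0 : z 0 = 1) :
    Tendsto (fun ξ => reducedProfile K γ lam κ ρ z ξ * ξ ^ (-γ)) (𝓝[>] 0) (𝓝 K) := by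
  have hc : Continuous fun ξ => K * z (lam * ξ ^ κ) ^ ρ :=
    continuous_const.mul ((hzc.comp (continuous_const.mul
      (continuous_rpow_const hκ.le))).rpow_const fun _ => Or.inr hρ.le)
  have h := (hc.tendsto 0).mono_left (nhdsWithin_le_nhds (s := Ioi 0))
  rw [zero_rpow hκ.ne', mul_zero, hz0, one_rpow, mul_one] at h
  refine h.congr' ?_
  filter_upwards [self_mem_nhdsWithin] with ξ hξ
  have hξ : 0 < ξ := hξ
  rw [reducedProfile, rpow_neg hξ.le]
  have := (rpow_pos_of_pos hξ γ).ne'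
  field_simp

/-- existence of a good profile satisfying (P2), positive on
`(0,ξ₀)`, with an interface of Type II at some `ξ₀ ∈ (0,∞)` and behavior
`f(ξ) ξ^{-(σ+2)/(m-p)} → K > 0` as `ξ → 0⁺`. -/
theorem existence_good_profile_typeII (m p σ α β : ℝ)
    (hm : 1 < m) (hp0 : 0 < p) (hp1 : p < 1) (hmp : 2 < m + p)
    (hσ : 2 * (1 - p) / (m - 1) < σ)
    (hα : α = (σ + 2) / (σ * (m - 1) + 2 * (p - 1)))
    (hβ : β = (m - p) / (σ * (m - 1) + 2 * (p - 1))) :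
    ∃ f : ℝ → ℝ, ∃ ξ₀ : ℝ,
      IsProfile m p σ α β f ∧ GoodP2 m f ∧
      (∀ ξ ∈ Set.Ioo 0 ξ₀, 0 < f ξ) ∧
      HasInterface m f ξ₀ ∧ TypeII p f ξ₀ ∧
      ∃ K > 0, Filter.Tendsto (fun ξ => f ξ * ξ ^ (-((σ + 2) / (m - p))))
        (nhdsWithin 0 (Set.Ioi 0)) (nhds K) := by
  have hL : 0 < σ * (m - 1) + 2 * (p - 1) := by
    rw [div_lt_iff₀ (by linarith)] at hσ
    linarith
  have hσ0 : 0 < σ := lt_trans (div_pos (by linarith) (by linarith)) hσ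
  have hmp' : 0 < m - p := by linarith
  have hp' : 0 < 1 - p := by linarith
  obtain ⟨γ, hγ⟩ : ∃ γ, γ = (σ + 2) / (m - p) := ⟨_, rfl⟩
  obtain ⟨κ, hκ⟩ : ∃ κ, κ = (σ * (m - 1) + 2 * (p - 1)) / (m - p) := ⟨_, rfl⟩
  obtain ⟨ρ, hρ⟩ : ∃ ρ, ρ = 1 / (1 - p) := ⟨_, rfl⟩
  obtain ⟨A, hA⟩ : ∃ A, A = (m - 1) / (1 - p) := ⟨_, rfl⟩
  have hA1 : 1 < A := by
    rw [hA, one_lt_div hp']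
    linarith
  have hγpos : 0 < γ := by rw [hγ]; positivity
  have hκpos : 0 < κ := by rw [hκ]; positivity
  have hρpos : 0 < ρ := by rw [hρ]; positivity
  have hρm : ρ * m = ρ + A := by
    rw [hρ, hA]
    ring
  have hγm : γ * m - 2 = γ + κ := by
    rw [hγ, hκ]
    field_simp
    ring
  have hm0 : 0 < m := by linarith
  obtain ⟨δ', hδ', y₀, hy₀, z, q, hzc, hz0, hz1, hzpos, hzzero, hzq, hz⟩ :=
    exists_reduced_profile (m * γ * (γ * m - 1) / (ρ * m * κ ^ 2))
      (-(ρ * m * κ * (2 * γ * m - 1 + κ)) / (ρ * m * κ ^ 2)) (ρ * m - 1) hA1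
  have hz_nonneg : ∀ y, 0 ≤ z y := fun y =>
    (lt_or_ge y y₀).elim (fun h => (hzpos y h).le) fun h => (hzzero y h).ge
  obtain ⟨δ, hδ⟩ : ∃ δ, δ = δ' / (ρ * m * κ ^ 2) := ⟨_, rfl⟩
  have hδpos : 0 < δ := by rw [hδ]; positivity
  have hδδ : δ * (ρ * m * κ ^ 2) = δ' := by
    rw [hδ]
    field_simp
  obtain ⟨K, hK⟩ : ∃ K, K = δ ^ (1 / (m - p)) := ⟨_, rfl⟩
  have hKpos : 0 < K := by rw [hK]; positivity
  have hδK : δ = K ^ (m - p) := by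
    rw [hK, ← rpow_mul hδpos.le, one_div_mul_cancel hmp'.ne', rpow_one]
  obtain ⟨lam, hlam⟩ : ∃ lam, lam = K ^ (p - 1) / ρ := ⟨_, rfl⟩
  have hlampos : 0 < lam := by rw [hlam]; positivity
  obtain ⟨ξ₀, hξ₀⟩ : ∃ ξ₀, ξ₀ = (y₀ / lam) ^ (1 / κ) := ⟨_, rfl⟩
  have hξ₀pos : 0 < ξ₀ := by rw [hξ₀]; positivity
  have hy₀ξ₀ : lam * ξ₀ ^ κ = y₀ := by
    rw [hξ₀, ← rpow_mul (by positivity), one_div_mul_cancel hκpos.ne', rpow_one]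
    field_simp
  have hmem : ∀ ξ ∈ Ioo 0 ξ₀, lam * ξ ^ κ ∈ Ioo 0 y₀ := fun ξ h => by
    have h1 := h.1
    refine ⟨by positivity, ?_⟩
    rw [← hy₀ξ₀]
    have := h.2
    gcongr
  have hzpos' : ∀ ξ ∈ Ioo 0 ξ₀, 0 < z (lam * ξ ^ κ) := fun ξ h => hzpos _ (hmem ξ h).2
  have hzzero' : ∀ ξ, 0 < ξ → ξ₀ ≤ ξ → z (lam * ξ ^ κ) = 0 := fun ξ _ h => by
    apply hzzero
    rw [← hy₀ξ₀]
    gcongr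
  refine ⟨reducedProfile K γ lam κ ρ z, ξ₀, ?_,
    goodP2_reducedProfile hKpos hγpos hm0 hρpos (by linarith) hz_nonneg hz1, fun ξ h => ?_,
    hasInterface_reducedProfile hKpos hρpos (by nlinarith) hξ₀pos hκpos hlampos hy₀ξ₀ hz hz_nonneg
      hzpos' hzzero',
    typeII_reducedProfile hKpos hρ hξ₀pos hκpos hlampos hy₀ξ₀ hz hz_nonneg (hzzero y₀ le_rfl),
    K, hKpos, ?_⟩
  · refine isProfile_reducedProfile (q := q) (δ := δ) (A := A) (ξ₀ := ξ₀) hm0 hp0 hKpos hγpos hκpos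
      hρpos hlam hδK ?_ ?_ ?_ ?_ hγm hρm hzc hz_nonneg hzpos' hzzero'
      (fun ξ h => (hzq _ (hmem ξ h)).1) fun ξ h => ?_
    · rw [hα, hβ, hγ]
      field_simp
    · rw [hβ, hκ]
      field_simp
    · rw [hρ]
      field_simp
      ring
    · rw [hγ, hκ]
      field_simp
      ring
    · rw [hδδ]
      exact (hzq _ (hmem ξ h)).2
  · have h1 := h.1
    have h2 := hzpos' ξ h
    simp only [reducedProfile]
    positivity
  · rw [← hγ]
    exact tendsto_reducedProfile_div hκpos hρpos hzc hz0
end
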